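/- For every M ∈ ℕ, A > 0 and ε > 0 there exist N₀ and R₀ such that the following holds. Let N ≥ N₀ and R ≥ R₀ be reals with R ≤ N^{1/2}·(log N)^{−4M}, let h be a positive integer with h ≤ R^A, let H₁, H₂ ⊆ {1,…,h} with |Hᵢ| = kᵢ and |H₁ ∩ H₂| = r, let H = H₁ ∪ H₂, and let l₁, l₂ ≥ 0 be integers with k₁ + k₂ + l₁ + l₂ ≤ M. Then |Σ_{N < n ≤ 2N} Λ_R(n;H₁,k₁+l₁)·Λ_R(n;H₂,k₂+l₂) − C(l₁+l₂,l₁)·((log R)^{r+l₁+l₂}/(r+l₁+l₂)!)·𝔖(H)·N| ≤ ε·N·(log R)^{r+l₁+l₂}, where C(l₁+l₂,l₁) is the binomial coefficient. -/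

import Mathlib

open Finset

/-- The sieve weight Λ_R(n; H, a) = (1/a!) Σ_{d | P(n,H), d ≤ R} μ(d) (log (R/d))^a,
where P(n,H) = ∏_{h ∈ H} (n+h). -/
noncomputable def lamR (R : ℝ) (n : ℕ) (H : Finset ℕ) (a : ℕ) : ℝ :=
  (1 / (Nat.factorial a : ℝ)) *
    ∑ d ∈ (∏ h ∈ H, (n + h)).divisors.filter (fun d : ℕ => (d : ℝ) ≤ R),
      (ArithmeticFunction.moebius d : ℝ) * (Real.log (R / d)) ^ a

/-- |Ω_H(p)|: the number of residue classes mod p occupied by the elements of H. -/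
def residCard (H : Finset ℕ) (p : ℕ) : ℕ := (H.image (fun h => h % p)).card

/-- The singular series 𝔖(H) = ∏_p (1 - |Ω_H(p)|/p) (1 - 1/p)^{-|H|}. -/
noncomputable def singSeries (H : Finset ℕ) : ℝ :=
  ∏' p : Nat.Primes,
    ((1 - (residCard H (p : ℕ) : ℝ) / (p : ℕ)) * ((1 - 1 / ((p : ℕ) : ℝ)) ^ H.card)⁻¹)

namespace GPY

open MeasureTheory Real

section

open FourierTransform SchwartzMap

/-- Plancherel for functions in `L¹ ∩ L²`. -/
theorem eLpNorm_fourier_eq {f : ℝ → ℂ} (h1 : Integrable f) (h2 : MemLp f 2) :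
    eLpNorm (𝓕 f) 2 = eLpNorm f 2 := by
  set F : Lp ℂ 2 (volume : Measure ℝ) := h2.toLp f with hF
  have key : (𝓕 F : Lp ℂ 2 (volume : Measure ℝ)) =ᵐ[volume] 𝓕 f := by
    apply ae_eq_of_integral_contDiff_smul_eq
    · exact (Lp.memLp (𝓕 F)).locallyIntegrable (by norm_num)
    · exact (VectorFourier.fourierIntegral_continuous Real.continuous_fourierChar
        (by fun_prop) h1).locallyIntegrable
    · intro g hg hgc
      have hgC : ContDiff ℝ (⊤ : ℕ∞) (fun x => (g x : ℂ)) := Complex.ofRealCLM.contDiff.comp hg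
      have hgcC : HasCompactSupport (fun x => (g x : ℂ)) :=
        hgc.comp_left (g := fun x : ℝ => (x : ℂ)) rfl
      set G : 𝓢(ℝ, ℂ) := hgcC.toSchwartzMap hgC with hG
      have hGx : ∀ x, G x = (g x : ℂ) := fun x => rfl
      have e1 := congrArg (fun T => T G) (Lp.fourier_toTemperedDistribution_eq F)
      simp only [TemperedDistribution.fourier_apply, Lp.toTemperedDistribution_apply] at e1
      have e2 : ∫ x, (𝓕 G) x • F x = ∫ x, (𝓕 G) x • f x := by
        apply integral_congr_ae
        filter_upwards [h2.coeFn_toLp] with x hx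
        rw [hF, hx]
      have e3 : ∫ x, (𝓕 G) x • f x = ∫ x, G x • (𝓕 f) x := by
        have := VectorFourier.integral_fourierIntegral_smul_eq_flip (μ := volume) (ν := volume)
          (L := innerₗ ℝ) (e := Real.fourierChar) (f := G) (g := f)
          Real.continuous_fourierChar (by fun_prop) G.integrable h1
        simp only [flip_innerₗ] at this
        exact this
      have e4 : ∀ φ : ℝ → ℂ, ∫ x, g x • φ x = ∫ x, G x • φ x := fun φ =>
        integral_congr_ae (.of_forall fun x => by simp [hGx])
      rw [e4, e4, ← e1, e2, e3]
  have n1 := Lp.norm_fourier_eq F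
  have n2 : ‖F‖ₑ = eLpNorm f 2 := by
    rw [Lp.enorm_def]; exact eLpNorm_congr_ae h2.coeFn_toLp
  rw [← n2, ← eLpNorm_congr_ae key, ← Lp.enorm_def, ← ofReal_norm, ← ofReal_norm, n1]

end

theorem norm_sub_integral_unit_le {f f' : ℝ → ℂ} {x a b : ℝ}
    (hd : ∀ y ∈ Set.Icc x (x + 1), HasDerivAt f (f' y) y)
    (ha : ∀ y ∈ Set.Icc x (x + 1), ‖f y‖ ≤ a) (hb : ∀ y ∈ Set.Icc x (x + 1), ‖f' y‖ ≤ b) :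
    ‖f x - ∫ y in x..(x + 1), f y‖ ≤ min (2 * a) b := by
  have hx : x ∈ Set.Icc x (x + 1) := ⟨le_rfl, by linarith⟩
  have hcont : ContinuousOn f (Set.uIcc x (x + 1)) := by
    rw [Set.uIcc_of_le (by linarith)]
    exact fun y hy => (hd y hy).continuousAt.continuousWithinAt
  have hsub : Set.uIoc x (x + 1) ⊆ Set.Icc x (x + 1) := by
    rw [Set.uIoc_of_le (by linarith)]; exact Set.Ioc_subset_Icc_self
  apply le_min
  · have h1 : ‖∫ y in x..(x + 1), f y‖ ≤ a * |x + 1 - x| :=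
      intervalIntegral.norm_integral_le_of_norm_le_const fun y hy => ha y (hsub hy)
    have h2 := norm_sub_le (f x) (∫ y in x..(x + 1), f y)
    have h3 := ha x hx
    simp at h1
    linarith
  · have e : f x - ∫ y in x..(x + 1), f y = ∫ y in x..(x + 1), (f x - f y) := by
      rw [intervalIntegral.integral_sub (by simp) hcont.intervalIntegrable]
      simp
    have hb0 : 0 ≤ b := (norm_nonneg _).trans (hb x hx)
    rw [e]
    have h1 : ‖∫ y in x..(x + 1), (f x - f y)‖ ≤ b * |x + 1 - x| := by
      apply intervalIntegral.norm_integral_le_of_norm_le_const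
      intro y hy
      have hy := hsub hy
      have := Convex.norm_image_sub_le_of_norm_hasDerivWithin_le (f := f) (f' := f') (C := b)
        (s := Set.Icc x (x + 1)) (fun z hz => (hd z hz).hasDerivWithinAt) hb
        (convex_Icc x (x + 1)) hy hx
      refine this.trans ?_
      have : ‖x - y‖ ≤ 1 := by
        rw [Real.norm_eq_abs, abs_le]; constructor <;> linarith [hy.1, hy.2]
      nlinarith
    simpa using h1

/-- Comparison of a series with the corresponding integral, interpolating between the trivial
bound and the bound by the derivative. -/
theorem norm_tsum_sub_integral_le {f f' : ℝ → ℂ} {c : ℕ → ℝ} {θ T : ℝ} (hθ : 0 ≤ θ) (hθ1 : θ ≤ 1)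
    (hT : 0 ≤ T) (hc : ∀ n, 0 ≤ c n)
    (hd : ∀ y, 1 ≤ y → HasDerivAt f (f' y) y)
    (ha : ∀ n : ℕ, ∀ y ∈ Set.Icc ((n : ℝ) + 1) (n + 2), ‖f y‖ ≤ c n / (n + 1))
    (hb : ∀ n : ℕ, ∀ y ∈ Set.Icc ((n : ℝ) + 1) (n + 2), ‖f' y‖ ≤ T * c n / (n + 1) ^ 2)
    (hs : Summable fun n : ℕ => f (n + 1)) (hi : IntegrableOn f (Set.Ioi 1))
    (hcs : Summable fun n : ℕ => c n / ((n : ℝ) + 1) ^ (1 + θ)) :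
    ‖∑' n : ℕ, f (n + 1)‖ ≤
      ‖∫ y in Set.Ioi 1, f y‖ + 2 * T ^ θ * ∑' n : ℕ, c n / ((n : ℝ) + 1) ^ (1 + θ) := by
  set u : ℕ → ℂ := fun n => f (n + 1) - ∫ y in ((n : ℝ) + 1)..(n + 2), f y with hu
  have hub : ∀ n, ‖u n‖ ≤ 2 * T ^ θ * (c n / ((n : ℝ) + 1) ^ (1 + θ)) := by
    intro n
    have e2 : (n : ℝ) + 2 = n + 1 + 1 := by ring
    have hn : (0 : ℝ) < n + 1 := by positivity
    have h1 := norm_sub_integral_unit_le (f := f) (f' := f') (x := n + 1)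
      (fun y hy => hd y (by have := hy.1; have : (0 : ℝ) ≤ n := by positivity
                            linarith))
      (by rw [← e2]; exact ha n) (by rw [← e2]; exact hb n)
    simp only [hu, e2]
    set z := ‖f (n + 1) - ∫ y in ((n : ℝ) + 1)..(n + 1 + 1), f y‖
    have hz : 0 ≤ z := norm_nonneg _
    have hz1 : z ≤ 2 * (c n / (n + 1)) := h1.trans (min_le_left _ _)
    have hz2 : z ≤ 2 * (T * c n / (n + 1) ^ 2) := by
      have := h1.trans (min_le_right _ _)
      have : 0 ≤ T * c n / (n + 1) ^ 2 := by have := hc n; positivity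
      linarith
    have hq : 0 ≤ 2 * (c n / (n + 1)) := by have := hc n; positivity
    have e3 : 2 * (T * c n / (n + 1) ^ 2) = 2 * (c n / (n + 1)) * (T / (n + 1)) := by
      field_simp
    rw [e3] at hz2
    set q := 2 * (c n / (n + 1))
    calc z = z ^ (1 - θ) * z ^ θ := by
          rw [← rpow_add_of_nonneg hz (by linarith) hθ]; simp
      _ ≤ q ^ (1 - θ) * (q * (T / (n + 1))) ^ θ := by gcongr
      _ = q * (T / (n + 1)) ^ θ := by
          rw [mul_rpow hq (by positivity), ← mul_assoc, ← rpow_add_of_nonneg hq (by linarith) hθ]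
          simp
      _ = _ := by
          rw [div_rpow hT hn.le, rpow_add hn, rpow_one]
          simp only [q]; field_simp
  have hus : Summable u := .of_norm_bounded (hcs.mul_left _) hub
  have hI : HasSum (fun n : ℕ => ∫ y in ((n : ℝ) + 1)..(n + 2), f y) (∫ y in Set.Ioi 1, f y) := by
    have hs2 : Summable (fun n : ℕ => ∫ y in ((n : ℝ) + 1)..(n + 2), f y) := by
      have := hs.sub hus
      refine this.congr fun n => ?_
      simp [hu]
    rw [hs2.hasSum_iff_tendsto_nat]
    have hlim := intervalIntegral_tendsto_integral_Ioi (f := f) (μ := volume)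
      (b := fun n : ℕ => (n : ℝ) + 1) (l := Filter.atTop) 1 hi
      (Filter.tendsto_atTop_add_const_right _ _ tendsto_natCast_atTop_atTop)
    refine hlim.congr fun N => ?_
    have := intervalIntegral.sum_integral_adjacent_intervals (f := f) (μ := volume)
      (a := fun n : ℕ => (n : ℝ) + 1) (n := N) (fun k _ => ?_)
    · simp only [Nat.cast_zero, zero_add] at this
      rw [← this]
      refine Finset.sum_congr rfl fun k _ => ?_
      push_cast; ring_nf
    · refine ContinuousOn.intervalIntegrable fun y hy => ?_
      rw [Set.uIcc_of_le (by push_cast; linarith)] at hy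
      have : (0 : ℝ) ≤ k := by positivity
      exact (hd y (by linarith [hy.1])).continuousAt.continuousWithinAt
  have e : ∑' n : ℕ, f (n + 1) = (∫ y in Set.Ioi 1, f y) + ∑' n, u n := by
    rw [← hI.tsum_eq, ← hI.summable.tsum_add hus]
    refine tsum_congr fun n => ?_
    simp [hu]
  rw [e, ← tsum_mul_left]
  exact (norm_add_le _ _).trans (add_le_add le_rfl
    (tsum_of_norm_bounded (hcs.mul_left _).hasSum hub))

theorem summable_log_weight :
    Summable fun n : ℕ => (1 + log ((n : ℝ) + 2)) / ((n : ℝ) + 1) ^ (1 + 1 / 20 : ℝ) := by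
  have h : Summable fun n : ℕ => 43 * (((n + 1 : ℕ) : ℝ) ^ (1 + 1 / 40 : ℝ))⁻¹ :=
    ((summable_nat_add_iff 1).2 (Real.summable_nat_rpow_inv.2 (by norm_num))).mul_left _
  refine .of_nonneg_of_le (fun n => ?_) (fun n => ?_) h
  · have : 0 ≤ log ((n : ℝ) + 2) := log_nonneg (by linarith [(Nat.cast_nonneg n : (0 : ℝ) ≤ n)])
    positivity
  · have hn : (1 : ℝ) ≤ n + 1 := by linarith [(Nat.cast_nonneg n : (0 : ℝ) ≤ n)]
    have hn0 : (0 : ℝ) < n + 1 := by linarith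
    have h1 : log ((n : ℝ) + 2) ≤ 1 + log ((n : ℝ) + 1) := by
      have : log ((n : ℝ) + 2) ≤ log (2 * ((n : ℝ) + 1)) := log_le_log (by linarith) (by linarith)
      rw [log_mul (by norm_num) hn0.ne'] at this
      linarith [log_two_lt_d9]
    have h2 : log ((n : ℝ) + 1) ≤ ((n : ℝ) + 1) ^ (1 / 40 : ℝ) / (1 / 40) :=
      log_le_rpow_div hn0.le (by norm_num)
    have h3 : (1 : ℝ) ≤ ((n : ℝ) + 1) ^ (1 / 40 : ℝ) := one_le_rpow hn (by norm_num)
    push_cast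
    rw [div_le_iff₀ (by positivity)]
    have e : ((n : ℝ) + 1) ^ (1 + 1 / 20 : ℝ) = ((n : ℝ) + 1) ^ (1 + 1 / 40 : ℝ) *
        ((n : ℝ) + 1) ^ (1 / 40 : ℝ) := by
      rw [← rpow_add hn0]; norm_num
    rw [e]
    have hp : 0 < ((n : ℝ) + 1) ^ (1 + 1 / 40 : ℝ) := by positivity
    field_simp
    linarith

theorem integral_log_mul_cpow {s : ℂ} (hs : 1 < s.re) :
    IntegrableOn (fun y : ℝ => (log y : ℂ) * (y : ℂ) ^ (-s)) (Set.Ioi 1) ∧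
      ∫ y in Set.Ioi (1 : ℝ), (log y : ℂ) * (y : ℂ) ^ (-s) = 1 / (s - 1) ^ 2 := by
  have hs0 : s - 1 ≠ 0 := fun h => by
    have := congrArg Complex.re h; simp at this; linarith
  have hint : IntegrableOn (fun y : ℝ => (log y : ℂ) * (y : ℂ) ^ (-s)) (Set.Ioi 1) := by
    set δ := (s.re - 1) / 2 with hδ
    have hδ0 : 0 < δ := by simp only [hδ]; linarith
    have hg : IntegrableOn (fun y : ℝ => y ^ (-(1 + δ)) / δ) (Set.Ioi 1) :=
      ((integrableOn_Ioi_rpow_of_lt (by linarith) one_pos)).div_const _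
    refine hg.mono' ?_ ?_
    · refine ContinuousOn.aestronglyMeasurable ?_ measurableSet_Ioi
      intro y hy
      have hy0 : (0 : ℝ) < y := one_pos.trans hy
      refine ContinuousAt.continuousWithinAt ?_
      refine ContinuousAt.mul ?_ ?_
      · exact Complex.continuous_ofReal.continuousAt.comp (continuousAt_log hy0.ne')
      · exact Complex.continuousAt_ofReal_cpow_const _ _ (Or.inr hy0.ne')
    · filter_upwards [ae_restrict_mem measurableSet_Ioi] with y hy
      have hy1 : (1 : ℝ) < y := hy
      have hy0 : (0 : ℝ) < y := one_pos.trans hy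
      rw [norm_mul, Complex.norm_real, norm_of_nonneg (log_nonneg hy1.le),
        Complex.norm_cpow_eq_rpow_re_of_pos hy0]
      have := log_le_rpow_div hy0.le hδ0
      calc log y * y ^ (-s).re ≤ y ^ δ / δ * y ^ (-s).re := by gcongr
        _ = y ^ (-(1 + δ)) / δ := by
          rw [div_mul_eq_mul_div, ← rpow_add hy0]
          congr 2; simp only [Complex.neg_re, hδ]; ring
  refine ⟨hint, ?_⟩
  have hlim : Filter.Tendsto (fun y : ℝ => -((log y : ℂ) * (y : ℂ) ^ (1 - s) / (s - 1) +
      (y : ℂ) ^ (1 - s) / (s - 1) ^ 2)) Filter.atTop (nhds (-(0 / (s - 1) + 0 / (s - 1) ^ 2))) := by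
    have hpos : 0 < s.re - 1 := by linarith
    refine ((Filter.Tendsto.div_const ?_ _).add (Filter.Tendsto.div_const ?_ _)).neg
    · rw [tendsto_zero_iff_norm_tendsto_zero]
      have := isLittleO_log_rpow_atTop hpos
      have := this.tendsto_div_nhds_zero
      refine this.congr' ?_
      filter_upwards [Filter.eventually_gt_atTop 1] with y hy
      have hy0 : (0 : ℝ) < y := one_pos.trans hy
      rw [norm_mul, Complex.norm_real, norm_of_nonneg (log_nonneg hy.le),
        Complex.norm_cpow_eq_rpow_re_of_pos hy0]
      simp only [Complex.sub_re, Complex.one_re]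
      rw [← neg_sub, rpow_neg hy0.le, div_inv_eq_mul]
    · rw [tendsto_zero_iff_norm_tendsto_zero]
      refine (tendsto_rpow_neg_atTop hpos).congr' ?_
      filter_upwards [Filter.eventually_gt_atTop 1] with y hy
      rw [Complex.norm_cpow_eq_rpow_re_of_pos (one_pos.trans hy)]
      simp
  have hderiv : ∀ y : ℝ, 0 < y → HasDerivAt (
    fun y : ℝ => -((log y : ℂ) * (y : ℂ) ^ (1 - s) / (s - 1) +
      (y : ℂ) ^ (1 - s) / (s - 1) ^ 2)) ((log y : ℂ) * (y : ℂ) ^ (-s)) y := by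
    intro y hy
    have h1 : HasDerivAt (fun y : ℝ => (y : ℂ) ^ (1 - s)) ((1 - s) * (y : ℂ) ^ (1 - s - 1)) y :=
      hasDerivAt_ofReal_cpow_const hy.ne' (by rw [← neg_sub]; exact neg_ne_zero.2 hs0)
    have h2 : HasDerivAt (fun y : ℝ => (log y : ℂ)) ((y⁻¹ : ℝ) : ℂ) y :=
      (hasDerivAt_log hy.ne').ofReal_comp
    convert! (((h2.mul h1).div_const (s - 1)).add (h1.div_const ((s - 1) ^ 2))).neg using 1
    have e1 : (1 - s - 1) = -s := by ring
    have hyc : (y : ℂ) ≠ 0 := by exact_mod_cast hy.ne'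
    have e2 : (y : ℂ) ^ (1 - s) = y * (y : ℂ) ^ (-s) := by
      rw [sub_eq_add_neg, Complex.cpow_add _ _ hyc, Complex.cpow_one]
    rw [e1, e2]
    push_cast
    field_simp
    ring
  rw [integral_Ioi_of_hasDerivAt_of_tendsto (hderiv 1 one_pos).continuousAt.continuousWithinAt
    (fun y hy => hderiv y (one_pos.trans hy)) hint hlim]
  simp

theorem log_weight_bounds {s : ℂ} (hs : 1 < s.re) (ht : 1 ≤ ‖s‖) (n : ℕ) {y : ℝ}
    (hy : y ∈ Set.Icc ((n : ℝ) + 1) (n + 2)) :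
    ‖(y : ℂ) ^ (-s)‖ ≤ (1 + log ((n : ℝ) + 2)) / (n + 1) ∧
    ‖(log y : ℂ) * (y : ℂ) ^ (-s)‖ ≤ (1 + log ((n : ℝ) + 2)) / (n + 1) ∧
    ‖(-s) * (y : ℂ) ^ (-s - 1)‖ ≤ ‖s‖ * (1 + log ((n : ℝ) + 2)) / (n + 1) ^ 2 ∧
    ‖((y⁻¹ : ℝ) : ℂ) * (y : ℂ) ^ (-s) + (log y : ℂ) * ((-s) * (y : ℂ) ^ (-s - 1))‖ ≤
      ‖s‖ * (1 + log ((n : ℝ) + 2)) / (n + 1) ^ 2 := by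
  have hn : (0 : ℝ) ≤ n := Nat.cast_nonneg n
  have hy1 : 1 ≤ y := by linarith [hy.1]
  have hy0 : 0 < y := by linarith
  have hn1 : (0 : ℝ) < n + 1 := by linarith
  have hl0 : 0 ≤ log y := log_nonneg hy1
  have hl : log y ≤ log ((n : ℝ) + 2) := log_le_log hy0 hy.2
  have hinv : y⁻¹ ≤ 1 / ((n : ℝ) + 1) := by
    rw [one_div]; exact inv_anti₀ hn1 hy.1
  have h1 : ‖(y : ℂ) ^ (-s)‖ ≤ 1 / (n + 1) := by
    rw [Complex.norm_cpow_eq_rpow_re_of_pos hy0]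
    refine le_trans ?_ hinv
    rw [← rpow_neg_one]
    exact rpow_le_rpow_of_exponent_le hy1 (by simp; linarith)
  have h2 : ‖(y : ℂ) ^ (-s - 1)‖ ≤ 1 / (n + 1) ^ 2 := by
    rw [Complex.cpow_sub _ _ (by exact_mod_cast hy0.ne'), Complex.cpow_one, norm_div,
      Complex.norm_real, norm_of_nonneg hy0.le, div_eq_mul_inv]
    calc _ ≤ 1 / ((n : ℝ) + 1) * (1 / ((n : ℝ) + 1)) := by gcongr
      _ = _ := by field_simp
  have hlog : ‖(log y : ℂ)‖ = log y := by rw [Complex.norm_real, norm_of_nonneg hl0]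
  have hyn : ‖((y⁻¹ : ℝ) : ℂ)‖ ≤ 1 / ((n : ℝ) + 1) := by
    rw [Complex.norm_real, norm_of_nonneg (inv_nonneg.2 hy0.le)]; exact hinv
  set L := log ((n : ℝ) + 2)
  have hL : 0 ≤ L := hl0.trans hl
  refine ⟨?_, ?_, ?_, ?_⟩
  · exact h1.trans (by gcongr; linarith)
  · rw [norm_mul, hlog]
    calc log y * ‖(y : ℂ) ^ (-s)‖ ≤ (1 + L) * (1 / (n + 1)) := by gcongr; linarith
      _ = _ := by ring
  · rw [norm_mul, norm_neg]
    calc ‖s‖ * ‖(y : ℂ) ^ (-s - 1)‖ ≤ (‖s‖ * (1 + L)) * (1 / (n + 1) ^ 2) := by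
          gcongr; nlinarith
      _ = _ := by ring
  · refine (norm_add_le _ _).trans ?_
    rw [norm_mul, norm_mul, norm_mul, norm_neg, hlog]
    calc _ ≤ 1 / ((n : ℝ) + 1) * (1 / (n + 1)) + L * (‖s‖ * (1 / (n + 1) ^ 2)) := by gcongr
      _ = (1 + L * ‖s‖) / (n + 1) ^ 2 := by field_simp
      _ ≤ _ := by gcongr; nlinarith

theorem norm_zeta_and_deriv_le : ∃ C : ℝ, 1 ≤ C ∧ ∀ s : ℂ, 1 < s.re → s.re ≤ 2 → 1 ≤ |s.im| →
    ‖riemannZeta s‖ ≤ C * |s.im| ^ (1 / 20 : ℝ) ∧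
    ‖deriv riemannZeta s‖ ≤ C * |s.im| ^ (1 / 20 : ℝ) := by
  set B := ∑' n : ℕ, (1 + log ((n : ℝ) + 2)) / ((n : ℝ) + 1) ^ (1 + 1 / 20 : ℝ) with hB
  have hc : ∀ n : ℕ, 0 ≤ 1 + log ((n : ℝ) + 2) := fun n => by
    have : 0 ≤ log ((n : ℝ) + 2) := log_nonneg (by linarith [(Nat.cast_nonneg n : (0 : ℝ) ≤ n)])
    linarith
  have hB0 : 0 ≤ B := tsum_nonneg fun n => div_nonneg (hc n) (by positivity)
  refine ⟨1 + 6 * B, by linarith, fun s hs hs2 ht => ?_⟩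
  have hst : |s.im| ≤ ‖s‖ := Complex.abs_im_le_norm s
  have hs1 : 1 ≤ ‖s‖ := ht.trans hst
  have hs3 : ‖s‖ ≤ 3 * |s.im| := by
    have := Complex.norm_le_abs_re_add_abs_im s
    rw [abs_of_pos (show 0 < s.re by linarith)] at this
    linarith
  have hsm : 1 ≤ ‖s - 1‖ := ht.trans (by simpa using Complex.abs_im_le_norm (s - 1))
  have hpow : 2 * ‖s‖ ^ (1 / 20 : ℝ) * B ≤ 6 * B * |s.im| ^ (1 / 20 : ℝ) := by
    have : ‖s‖ ^ (1 / 20 : ℝ) ≤ 3 * |s.im| ^ (1 / 20 : ℝ) := by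
      calc ‖s‖ ^ (1 / 20 : ℝ) ≤ (3 * |s.im|) ^ (1 / 20 : ℝ) := by gcongr
        _ = 3 ^ (1 / 20 : ℝ) * |s.im| ^ (1 / 20 : ℝ) := mul_rpow (by norm_num) (by positivity)
        _ ≤ 3 ^ (1 : ℝ) * |s.im| ^ (1 / 20 : ℝ) := by gcongr <;> norm_num
        _ = _ := by rw [rpow_one]
    nlinarith
  have h1t : 1 ≤ |s.im| ^ (1 / 20 : ℝ) := one_le_rpow ht (by norm_num)
  have hsne : s ≠ 1 := fun h => by rw [h] at hs; simp at hs
  have hd1 : ∀ y : ℝ, 1 ≤ y → HasDerivAt (fun y : ℝ => (y : ℂ) ^ (-s))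
      (-s * (y : ℂ) ^ (-s - 1)) y := fun y hy =>
    hasDerivAt_ofReal_cpow_const (by linarith) (by
      rw [neg_ne_zero]; intro h; rw [h] at hs1; simp at hs1; linarith)
  constructor
  · have hz : riemannZeta s = ∑' n : ℕ, ((((n : ℝ) + 1 : ℝ)) : ℂ) ^ (-s) := by
      rw [zeta_eq_tsum_one_div_nat_add_one_cpow hs]
      refine tsum_congr fun n => ?_
      rw [Complex.cpow_neg, one_div]; push_cast; rfl
    have := norm_tsum_sub_integral_le (f := fun y : ℝ => (y : ℂ) ^ (-s))
      (f' := fun y => -s * (y : ℂ) ^ (-s - 1)) (T := ‖s‖) (θ := 1 / 20) (by norm_num) (by norm_num)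
      (norm_nonneg s) hc hd1 (fun n y hy => (log_weight_bounds hs hs1 n hy).1)
      (fun n y hy => (log_weight_bounds hs hs1 n hy).2.2.1) ?_
      (integrableOn_Ioi_cpow_of_lt (by simpa using hs) one_pos) summable_log_weight
    · rw [integral_Ioi_cpow_of_lt (by simpa using hs) one_pos, ← hz, ← hB] at this
      have h2 : ‖-((1 : ℝ) : ℂ) ^ (-s + 1) / (-s + 1)‖ ≤ 1 := by
        rw [norm_div, show -s + 1 = -(s - 1) by ring, norm_neg (s - 1)]
        simp only [Complex.ofReal_one, Complex.one_cpow, norm_neg, norm_one]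
        exact div_le_one_of_le₀ hsm (norm_nonneg _)
      nlinarith
    · have := (summable_nat_add_iff 1).2 (Complex.summable_one_div_nat_cpow.2 hs)
      refine this.congr fun n => ?_
      rw [Complex.cpow_neg, one_div]; push_cast; rfl
  · have hab : LSeries.abscissaOfAbsConv 1 < (s.re : EReal) := by
      rw [LSeries.abscissaOfAbsConv_one]; exact_mod_cast hs
    have hz0 : deriv riemannZeta s = -LSeries (LSeries.logMul 1) s := by
      rw [← LSeries_deriv hab]
      apply Filter.EventuallyEq.deriv_eq
      filter_upwards [(isOpen_lt continuous_const Complex.continuous_re).mem_nhds hs] with z hz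
      exact (LSeries_one_eq_riemannZeta hz).symm
    have hsum : LSeriesSummable (LSeries.logMul 1) s := LSeriesSummable_logMul_of_lt_re hab
    have hterm : ∀ n : ℕ, LSeries.term (LSeries.logMul 1) s (n + 1) =
        (log ((n : ℝ) + 1) : ℂ) * ((((n : ℝ) + 1 : ℝ)) : ℂ) ^ (-s) := fun n => by
      rw [LSeries.term_of_ne_zero (by omega), LSeries.logMul, Complex.cpow_neg, div_eq_mul_inv]
      simp only [Pi.one_apply, mul_one]
      rw [← Complex.natCast_log]
      push_cast; rfl
    have hz : LSeries (LSeries.logMul 1) s = ∑' n : ℕ, (log ((n : ℝ) + 1) : ℂ) *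
        ((((n : ℝ) + 1 : ℝ)) : ℂ) ^ (-s) := by
      rw [LSeries, hsum.tsum_eq_zero_add, LSeries.term_zero, zero_add]
      exact tsum_congr hterm
    have := norm_tsum_sub_integral_le (f := fun y : ℝ => (log y : ℂ) * (y : ℂ) ^ (-s))
      (f' := fun y => ((y⁻¹ : ℝ) : ℂ) * (y : ℂ) ^ (-s) +
        (log y : ℂ) * ((-s) * (y : ℂ) ^ (-s - 1))) (T := ‖s‖) (θ := 1 / 20)
      (by norm_num) (by norm_num)
      (norm_nonneg s) hc (fun y hy => ((hasDerivAt_log (by linarith)).ofReal_comp).mul (hd1 y hy))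
      (fun n y hy => (log_weight_bounds hs hs1 n hy).2.1)
      (fun n y hy => (log_weight_bounds hs hs1 n hy).2.2.2) ?_
      (integral_log_mul_cpow hs).1 summable_log_weight
    · rw [(integral_log_mul_cpow hs).2, ← hz, ← hB] at this
      rw [hz0, norm_neg]
      have h2 : ‖1 / (s - 1) ^ 2‖ ≤ 1 := by
        rw [norm_div, norm_pow, norm_one]
        exact div_le_one_of_le₀ (one_le_pow₀ hsm) (by positivity)
      nlinarith
    · exact ((summable_nat_add_iff 1).2 hsum).congr fun n => (hterm n)

theorem zeta_three_four_one {x : ℝ} (hx : 0 < x) (t : ℝ) :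
    1 ≤ ‖riemannZeta (1 + x)‖ ^ 3 * ‖riemannZeta (1 + x + Complex.I * t)‖ ^ 4 *
      ‖riemannZeta (1 + x + 2 * Complex.I * t)‖ := by
  have := DirichletCharacter.norm_LFunction_product_ge_one (1 : DirichletCharacter ℂ 1) hx t
  rw [DirichletCharacter.LFunction_modOne_eq, DirichletCharacter.LFunction_modOne_eq,
    show DirichletCharacter.LFunctionTrivChar 1 = riemannZeta from
      DirichletCharacter.LFunction_modOne_eq] at this
  rwa [norm_mul, norm_mul, norm_pow, norm_pow] at this

theorem one_le_mul_norm_zeta : ∃ C : ℝ, 1 ≤ C ∧ ∀ s : ℂ, 1 < s.re → s.re ≤ 2 → 1 ≤ |s.im| →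
    1 ≤ C * |s.im| ^ (1 / 5 : ℝ) * ‖riemannZeta s‖ := by
  obtain ⟨C, hC1, hC⟩ := norm_zeta_and_deriv_le
  obtain ⟨B, hB⟩ := (isCompact_Icc (a := (0 : ℝ)) (b := 1)).exists_bound_of_continuousOn
    (f := fun x : ℝ => riemannZeta₁ (1 + x))
    (differentiable_riemannZeta₁.continuous.comp (by fun_prop)).continuousOn
  have hB1 : 1 ≤ B := by simpa using hB 0 (by simp)
  have hBz : ∀ x : ℝ, 0 < x → x ≤ 1 → ‖riemannZeta (1 + x)‖ ≤ B / x := fun x hx hx1 => by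
    have := hB x ⟨hx.le, hx1⟩
    rw [riemannZeta_eq_inv_sub_mul (by simpa using hx.ne'), norm_mul, div_eq_inv_mul]
    gcongr
    simp [abs_of_pos hx]
  refine ⟨16 * B ^ 3 * (2 * C) ^ 4, ?_, fun s hs hs2 ht => ?_⟩
  · have h1 : 1 ≤ B ^ 3 := one_le_pow₀ hB1
    have h2 : 1 ≤ (2 * C) ^ 4 := one_le_pow₀ (by linarith)
    nlinarith
  set t := s.im with ht_def
  set x := s.re - 1 with hx_def
  have hx0 : 0 < x := by simp only [hx_def]; linarith
  have hx1 : x ≤ 1 := by simp only [hx_def]; linarith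
  have hsx : s = 1 + x + Complex.I * t := by
    apply Complex.ext <;> simp [hx_def, ht_def]
  set a := |t| ^ (1 / 20 : ℝ) with ha
  have ha1 : 1 ≤ a := one_le_rpow ht (by norm_num)
  have ha4 : |t| ^ (1 / 5 : ℝ) = a ^ 4 := by
    rw [ha, ← rpow_natCast, ← rpow_mul (abs_nonneg _)]; norm_num
  set A := 2 * C * a with hA
  have hA1 : 1 ≤ A := by nlinarith
  set η := 1 / (16 * B ^ 3 * A ^ 5) with hη
  have hD : 1 ≤ B ^ 3 * A ^ 5 := by
    have h1 : 1 ≤ B ^ 3 := one_le_pow₀ hB1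
    have h2 : 1 ≤ A ^ 5 := one_le_pow₀ hA1
    nlinarith
  have hη0 : 0 < η := by positivity
  have hη1 : η ≤ 1 := by
    rw [hη, div_le_one (by positivity)]; nlinarith
  have hηA : 16 * B ^ 3 * A ^ 5 * η = 1 := by rw [hη]; field_simp
  have hbig : ∀ y : ℝ, η ≤ y → y ≤ 1 → 2 * A * η ≤ ‖riemannZeta (1 + y + Complex.I * t)‖ := by
    intro y hy hy1
    have hy0 : 0 < y := hη0.trans_le hy
    have h341 := zeta_three_four_one hy0 t
    have h2 : ‖riemannZeta (1 + y + 2 * Complex.I * t)‖ ≤ A := by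
      refine ((hC _ (by simp; linarith) (by simp; linarith)
        (by simp [abs_mul]; linarith)).1).trans ?_
      simp only [Complex.add_im, Complex.one_im, Complex.ofReal_im, Complex.mul_im, Complex.mul_re,
        Complex.re_ofNat, Complex.I_re, mul_zero, Complex.im_ofNat, Complex.I_im,
        sub_self, Complex.ofReal_re, mul_one, add_zero, zero_add, abs_mul]
      rw [mul_rpow (by positivity) (by positivity), ← ha, hA]
      have : |(2 : ℝ)| ^ (1 / 20 : ℝ) ≤ 2 ^ (1 : ℝ) := by
        rw [abs_two]; exact rpow_le_rpow_of_exponent_le (by norm_num) (by norm_num)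
      rw [rpow_one] at this
      have : |(2 : ℝ)| ^ (1 / 20 : ℝ) * a ≤ 2 * a := by gcongr
      nlinarith
    set z := ‖riemannZeta (1 + y + Complex.I * t)‖
    have hz : 0 ≤ z := norm_nonneg _
    have h3 : 1 ≤ (B / η) ^ 3 * z ^ 4 * A := by
      refine h341.trans ?_
      gcongr
      exact (hBz y hy0 hy1).trans (by gcongr)
    have h4 : (2 * A * η) ^ 4 ≤ z ^ 4 := by
      have e : (B / η) ^ 3 * z ^ 4 * A = B ^ 3 * A * z ^ 4 / η ^ 3 := by ring
      rw [e, le_div_iff₀ (by positivity), one_mul] at h3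
      have e2 : (2 * A * η) ^ 4 * (B ^ 3 * A) = η ^ 3 * (16 * B ^ 3 * A ^ 5 * η) := by ring
      rw [hηA, mul_one] at e2
      have : (2 * A * η) ^ 4 * (B ^ 3 * A) ≤ z ^ 4 * (B ^ 3 * A) := by rw [e2]; linarith
      exact le_of_mul_le_mul_right this (by positivity)
    exact le_of_pow_le_pow_left₀ (by norm_num) hz h4
  have hmain : A * η ≤ ‖riemannZeta s‖ := by
    rcases le_total η x with h | h
    · have := hbig x h hx1
      rw [← hsx] at this
      nlinarith [mul_pos (show 0 < A by linarith) hη0]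
    · have hb := hbig η le_rfl hη1
      have hder : ∀ z ∈ {z : ℂ | 1 < z.re ∧ z.re ≤ 2 ∧ z.im = t},
          HasDerivWithinAt riemannZeta (deriv riemannZeta z)
            {z : ℂ | 1 < z.re ∧ z.re ≤ 2 ∧ z.im = t} z := fun z hz =>
        (differentiableAt_riemannZeta (fun h => by
          have := hz.1; rw [h] at this; simp at this)).hasDerivAt.hasDerivWithinAt
      have hconv : Convex ℝ {z : ℂ | 1 < z.re ∧ z.re ≤ 2 ∧ z.im = t} := by
        intro z hz w hw p q hp hq hpq
        simp only [Set.mem_ofPred_eq] at hz hw ⊢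
        simp only [Complex.add_re, Complex.add_im, Complex.real_smul, Complex.mul_re,
          Complex.mul_im, Complex.ofReal_re, Complex.ofReal_im, zero_mul, sub_zero, add_zero]
        obtain rfl : q = 1 - p := by linarith
        refine ⟨?_, ?_, ?_⟩
        · rcases hp.eq_or_lt with h0 | h0
          · rw [← h0]; linarith [hw.1]
          · nlinarith [mul_lt_mul_of_pos_left hz.1 h0, mul_le_mul_of_nonneg_left hw.1.le hq]
        · nlinarith
        · rw [hz.2.2, hw.2.2]; ring
      have := hconv.norm_image_sub_le_of_norm_hasDerivWithin_le (C := A) hder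
        (fun z hz => ((hC z hz.1 hz.2.1 (by rw [hz.2.2]; exact ht)).2).trans
          (by rw [hz.2.2]; nlinarith)) (x := s) (y := 1 + η + Complex.I * t)
        ⟨hs, hs2, rfl⟩ ⟨by simp; linarith, by simp; linarith, by simp⟩
      have e : (1 : ℂ) + η + Complex.I * t - s = ((η - x : ℝ) : ℂ) := by
        rw [hsx]; push_cast; ring
      rw [e, Complex.norm_real, norm_of_nonneg (by linarith)] at this
      have h5 := norm_sub_norm_le (riemannZeta (1 + η + Complex.I * t)) (riemannZeta s)
      have : A * (η - x) ≤ A * η := by gcongr; linarith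
      linarith
  have e : 16 * B ^ 3 * (2 * C) ^ 4 * |t| ^ (1 / 5 : ℝ) = 16 * B ^ 3 * A ^ 4 := by
    rw [ha4, hA]; ring
  rw [e]
  calc 1 = 16 * B ^ 3 * A ^ 4 * (A * η) := by rw [← hηA]; ring
    _ ≤ _ := by gcongr

theorem riemannZeta₁_eq_mul {s : ℂ} (hs : s ≠ 1) : riemannZeta₁ s = (s - 1) * riemannZeta s := by
  rw [riemannZeta_eq_inv_sub_mul hs, mul_inv_cancel_left₀ (sub_ne_zero.2 hs)]

theorem riemannZeta₁_ne_zero {s : ℂ} (hs : 1 ≤ s.re) : riemannZeta₁ s ≠ 0 := by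
  by_cases h : s = 1
  · simp [h]
  · rw [riemannZeta₁_eq_mul h]
    exact mul_ne_zero (sub_ne_zero.2 h) (riemannZeta_ne_zero_of_one_le_re hs)

theorem norm_deriv_div_sq_le : ∃ K : ℝ, 0 < K ∧ ∀ σ t : ℝ, 0 < σ → σ ≤ 1 →
    ‖deriv riemannZeta₁ (1 + (σ + t * Complex.I)) / riemannZeta₁ (1 + (σ + t * Complex.I)) ^ 2‖ ≤
      K * (1 + |t|) ^ (-(11 / 20) : ℝ) := by
  obtain ⟨C, hC1, hC⟩ := norm_zeta_and_deriv_le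
  obtain ⟨B, hB1, hB⟩ := one_le_mul_norm_zeta
  obtain ⟨K, hK⟩ := (isCompact_Icc (a := (0 : ℝ)) (b := 1)).prod (isCompact_Icc (a := (-1 : ℝ))
    (b := 1)) |>.exists_bound_of_continuousOn
    (f := fun x : ℝ × ℝ => deriv riemannZeta₁ (1 + (x.1 + x.2 * Complex.I)) /
      riemannZeta₁ (1 + (x.1 + x.2 * Complex.I)) ^ 2) (by
      refine ContinuousOn.div ?_ ?_ ?_
      · exact (differentiable_riemannZeta₁.deriv.continuous.comp (by fun_prop)).continuousOn
      · exact ((differentiable_riemannZeta₁.continuous.comp (by fun_prop)).pow 2).continuousOn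
      · intro x hx
        exact pow_ne_zero 2 (riemannZeta₁_ne_zero (by simpa using hx.1.1)))
  have hK0 : 0 ≤ K := (norm_nonneg _).trans (hK (0, 0) (by simp))
  refine ⟨2 * K + 4 * C * B ^ 2, by positivity, fun σ t hσ hσ1 => ?_⟩
  have hp : 0 < (1 + |t|) ^ (-(11 / 20) : ℝ) := by positivity
  rcases le_total |t| 1 with ht | ht
  · have h1 := hK (σ, t) ⟨⟨hσ.le, hσ1⟩, abs_le.1 ht⟩
    have h2 : (1 / 2 : ℝ) ≤ (1 + |t|) ^ (-(11 / 20) : ℝ) := by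
      calc (1 / 2 : ℝ) = 2 ^ (-1 : ℝ) := by rw [rpow_neg_one]; norm_num
        _ ≤ 2 ^ (-(11 / 20) : ℝ) := rpow_le_rpow_of_exponent_le (by norm_num) (by norm_num)
        _ ≤ _ := rpow_le_rpow_of_nonpos (by positivity) (by linarith) (by norm_num)
    refine h1.trans ?_
    have : 0 ≤ 4 * C * B ^ 2 * (1 + |t|) ^ (-(11 / 20) : ℝ) := by positivity
    nlinarith
  · set w : ℂ := 1 + (σ + t * Complex.I) with hw
    have hre : w.re = 1 + σ := by simp [hw]
    have him : w.im = t := by simp [hw]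
    have hw1 : w ≠ 1 := fun h => by rw [h] at hre; simp at hre; linarith
    have ht0 : 0 < |t| := by linarith
    obtain ⟨hz1, hz2⟩ := hC w (by linarith) (by linarith) (by rwa [him])
    have hz3 := hB w (by linarith) (by linarith) (by rwa [him])
    rw [him] at hz1 hz2 hz3
    have hd : deriv riemannZeta₁ w = riemannZeta w + (w - 1) * deriv riemannZeta w := by
      have : riemannZeta₁ =ᶠ[nhds w] fun s => (s - 1) * riemannZeta s := by
        filter_upwards [isOpen_compl_singleton.mem_nhds hw1] with s hs
        exact riemannZeta₁_eq_mul hs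
      rw [this.deriv_eq, deriv_fun_mul (by fun_prop) (differentiableAt_riemannZeta hw1)]
      simp
    rw [hd, riemannZeta₁_eq_mul hw1, norm_div, norm_pow, norm_mul]
    set b := ‖w - 1‖ with hb
    have hbt : |t| ≤ b := by
      have := Complex.abs_im_le_norm (w - 1)
      simpa [him] using this
    have hb1 : 1 ≤ b := ht.trans hbt
    set z := ‖riemannZeta w‖
    have hz0 : 0 < z := by
      rcases (norm_nonneg (riemannZeta w)).eq_or_lt with h | h
      · exfalso; simp only [z, ← h, mul_zero] at hz3; linarith
      · exact h
    set a := |t| ^ (1 / 20 : ℝ)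
    have hnum : ‖riemannZeta w + (w - 1) * deriv riemannZeta w‖ ≤ 2 * b * (C * a) := by
      refine (norm_add_le _ _).trans ?_
      rw [norm_mul]
      have : 0 ≤ C * a := by positivity
      nlinarith [mul_le_mul_of_nonneg_left hz2 (show 0 ≤ b by linarith)]
    have h4 : (1 + |t|) ^ (-(11 / 20) : ℝ) * 2 ≥ |t| ^ (-(11 / 20) : ℝ) := by
      have h5 : (2 * |t|) ^ (-(11 / 20) : ℝ) ≤ (1 + |t|) ^ (-(11 / 20) : ℝ) :=
        rpow_le_rpow_of_nonpos (by linarith) (by linarith) (by norm_num)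
      rw [mul_rpow (by norm_num) ht0.le] at h5
      have h6 : (1 / 2 : ℝ) ≤ 2 ^ (-(11 / 20) : ℝ) := by
        calc (1 / 2 : ℝ) = 2 ^ (-1 : ℝ) := by rw [rpow_neg_one]; norm_num
          _ ≤ _ := rpow_le_rpow_of_exponent_le (by norm_num) (by norm_num)
      have : 0 < |t| ^ (-(11 / 20) : ℝ) := by positivity
      nlinarith
    have h7 : a * (|t| ^ (1 / 5 : ℝ)) ^ 2 / |t| = |t| ^ (-(11 / 20) : ℝ) := by
      simp only [a]
      rw [← rpow_natCast (|t| ^ (1 / 5 : ℝ)), ← rpow_mul ht0.le, ← rpow_add ht0]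
      nth_rewrite 2 [← rpow_one |t|]
      rw [← rpow_sub ht0]
      norm_num
    calc _ ≤ 2 * b * (C * a) / (b * z) ^ 2 := by gcongr
      _ ≤ 2 * b * (C * a) / (b * z) ^ 2 * (B * |t| ^ (1 / 5 : ℝ) * z) ^ 2 :=
          le_mul_of_one_le_right (by positivity) (one_le_pow₀ hz3)
      _ = 2 * C * B ^ 2 * (a * (|t| ^ (1 / 5 : ℝ)) ^ 2 / b) := by field_simp
      _ ≤ 2 * C * B ^ 2 * (a * (|t| ^ (1 / 5 : ℝ)) ^ 2 / |t|) := by gcongr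
      _ ≤ 2 * C * B ^ 2 * ((1 + |t|) ^ (-(11 / 20) : ℝ) * 2) := by rw [h7]; gcongr
      _ ≤ _ := by
        have : 0 ≤ 2 * K * (1 + |t|) ^ (-(11 / 20) : ℝ) := by positivity
        nlinarith

/-- The summatory function `∑_{n ≤ e^u} μ(n)/n`. -/
noncomputable def moebiusSum (u : ℝ) : ℝ :=
  ∑ n ∈ Finset.Icc 1 ⌊exp u⌋₊, (ArithmeticFunction.moebius n : ℝ) / n

theorem moebiusSum_of_neg {u : ℝ} (hu : u < 0) : moebiusSum u = 0 := by
  have : ⌊exp u⌋₊ = 0 := Nat.floor_eq_zero.2 (exp_lt_one_iff.2 hu)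
  simp [moebiusSum, this]

theorem abs_sum_moebius_div_le (N : ℕ) :
    |∑ n ∈ Finset.Icc 1 N, (ArithmeticFunction.moebius n : ℝ) / n| ≤ 1 := by
  rcases N.eq_zero_or_pos with rfl | hN
  · simp
  have hN' : (0 : ℝ) < N := by exact_mod_cast hN
  have h1 : ∑ n ∈ Finset.Icc 1 N, (ArithmeticFunction.moebius n : ℝ) * ((N / n : ℕ) : ℝ) = 1 := by
    have := ArithmeticFunction.sum_Ioc_mul_zeta_eq_sum ArithmeticFunction.moebius N
    rw [ArithmeticFunction.moebius_mul_coe_zeta] at this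
    have h2 : ∑ n ∈ Finset.Ioc 0 N, (1 : ArithmeticFunction ℤ) n = 1 := by
      rw [Finset.sum_eq_single 1]
      · simp
      · intro b _ hb; exact ArithmeticFunction.one_apply_ne hb
      · intro h; exact absurd (Finset.mem_Ioc.2 ⟨one_pos, hN⟩) h
    rw [h2] at this
    rw [show Finset.Icc 1 N = Finset.Ioc 0 N from rfl]
    have h4 := congrArg (Int.cast : ℤ → ℝ) this
    simp only [Int.cast_sum, Int.cast_mul, Int.cast_one, Int.cast_natCast] at h4
    exact h4.symm
  have h3 : |N * (∑ n ∈ Finset.Icc 1 N, (ArithmeticFunction.moebius n : ℝ) / n) - 1| ≤ N - 1 := by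
    nth_rewrite 1 [← h1]
    rw [Finset.mul_sum, ← Finset.sum_sub_distrib]
    have hmem : 1 ∈ Finset.Icc 1 N := Finset.mem_Icc.2 ⟨le_rfl, hN⟩
    rw [← Finset.add_sum_erase _ _ hmem]
    simp only [ArithmeticFunction.moebius_apply_one, Int.cast_one, Nat.cast_one, div_one, mul_one,
      Nat.div_one, one_mul, sub_self, zero_add]
    refine (Finset.abs_sum_le_sum_abs _ _).trans ?_
    have hc : ((Finset.Icc 1 N).erase 1).card = N - 1 := by
      rw [Finset.card_erase_of_mem hmem]; simp
    have : ((N : ℝ) - 1) = ∑ n ∈ (Finset.Icc 1 N).erase 1, (1 : ℝ) := by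
      rw [Finset.sum_const, hc, nsmul_eq_mul, mul_one, Nat.cast_sub hN, Nat.cast_one]
    rw [this]
    refine Finset.sum_le_sum fun n hn => ?_
    have hn1 : 1 ≤ n := (Finset.mem_Icc.1 (Finset.mem_of_mem_erase hn)).1
    have hn0 : (0 : ℝ) < n := by exact_mod_cast hn1
    have e : (N : ℝ) * ((ArithmeticFunction.moebius n : ℝ) / n) -
        (ArithmeticFunction.moebius n : ℝ) * ((N / n : ℕ) : ℝ) =
        (ArithmeticFunction.moebius n : ℝ) * (N / n - ((N / n : ℕ) : ℝ)) := by ring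
    rw [e, abs_mul]
    have hμ : |(ArithmeticFunction.moebius n : ℝ)| ≤ 1 := by
      exact_mod_cast ArithmeticFunction.abs_moebius_le_one (n := n)
    have hfr : |(N : ℝ) / n - ((N / n : ℕ) : ℝ)| ≤ 1 := by
      rw [← Nat.floor_div_eq_div (K := ℝ), abs_le]
      have hd : (0 : ℝ) ≤ N / n := by positivity
      constructor <;> linarith [Nat.floor_le hd, Nat.lt_floor_add_one ((N : ℝ) / n)]
    nlinarith [abs_nonneg ((ArithmeticFunction.moebius n : ℝ)),
      abs_nonneg ((N : ℝ) / n - ((N / n : ℕ) : ℝ))]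
  rw [abs_le] at h3 ⊢
  constructor
  · nlinarith
  · nlinarith

theorem abs_moebiusSum_le (u : ℝ) : |moebiusSum u| ≤ 1 := abs_sum_moebius_div_le _

theorem measurable_moebiusSum : Measurable moebiusSum := by
  have : Measurable fun N : ℕ => ∑ n ∈ Finset.Icc 1 N, (ArithmeticFunction.moebius n : ℝ) / n :=
    measurable_from_top
  exact this.comp (Nat.measurable_floor.comp measurable_exp)

theorem norm_moebiusSum_mul_exp_le (σ u : ℝ) (s : ℂ) (hs : s.re = σ) :
    ‖(moebiusSum u : ℂ) * Complex.exp (-s * u)‖ ≤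
      Set.indicator (Set.Ici 0) (fun u => exp (-σ * u)) u := by
  by_cases hu : 0 ≤ u
  · rw [Set.indicator_of_mem (Set.mem_Ici.2 hu), norm_mul, Complex.norm_real, Complex.norm_exp]
    have : (-s * u).re = -σ * u := by simp [hs]
    rw [this]
    exact mul_le_of_le_one_left (exp_pos _).le (abs_moebiusSum_le u)
  · rw [moebiusSum_of_neg (not_le.1 hu), Set.indicator_of_notMem (by simpa using hu)]
    simp

theorem integrable_moebiusSum_mul_exp {s : ℂ} (hs : 0 < s.re) :
    Integrable fun u : ℝ => (moebiusSum u : ℂ) * Complex.exp (-s * u) := by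
  have h1 : Integrable (Set.indicator (Set.Ici 0) (fun u : ℝ => exp (-s.re * u))) := by
    rw [integrable_indicator_iff measurableSet_Ici, integrableOn_Ici_iff_integrableOn_Ioi]
    exact integrableOn_exp_mul_Ioi (by linarith) 0
  refine h1.mono' ?_ (.of_forall fun u => norm_moebiusSum_mul_exp_le s.re u s rfl)
  refine (Measurable.mul ?_ ?_).aestronglyMeasurable
  · exact Complex.measurable_ofReal.comp measurable_moebiusSum
  · fun_prop

theorem integral_moebiusSum_mul_exp {s : ℂ} (hs : 0 < s.re) :
    ∫ u : ℝ, (moebiusSum u : ℂ) * Complex.exp (-s * u) = 1 / riemannZeta₁ (1 + s) := by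
  set f : ℕ → ℂ := fun n => (ArithmeticFunction.moebius n : ℂ) / n with hf
  have hs0 : s ≠ 0 := fun h => by rw [h] at hs; simp at hs
  have hterm : ∀ n, LSeries.term f s n =
      LSeries.term (fun n => (ArithmeticFunction.moebius n : ℂ)) (1 + s) n := by
    intro n
    rcases eq_or_ne n 0 with rfl | hn
    · simp
    · rw [LSeries.term_of_ne_zero hn, LSeries.term_of_ne_zero hn, hf,
        Complex.cpow_add _ _ (by exact_mod_cast hn), Complex.cpow_one, div_div]
  have hre : 1 < (1 + s).re := by simpa using hs
  have hsum : LSeriesSummable f s := by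
    have := (ArithmeticFunction.LSeriesSummable_moebius_iff (s := 1 + s)).2 hre
    exact this.congr fun n => (hterm n).symm
  have hL : LSeries f s * riemannZeta (1 + s) = 1 := by
    have : LSeries f s = LSeries (fun n => (ArithmeticFunction.moebius n : ℂ)) (1 + s) :=
      tsum_congr hterm
    rw [this, ← ArithmeticFunction.LSeries_zeta_eq_riemannZeta hre, mul_comm]
    exact ArithmeticFunction.LSeries_zeta_mul_Lseries_moebius hre
  have hO : (fun n : ℕ => ∑ k ∈ Finset.Icc 1 n, f k) =O[Filter.atTop]
    fun n : ℕ => (n : ℝ) ^ (0 : ℝ) := by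
    refine Asymptotics.IsBigO.of_bound 1 (.of_forall fun n => ?_)
    have := abs_sum_moebius_div_le n
    have e : ∑ k ∈ Finset.Icc 1 n, f k =
        ((∑ n ∈ Finset.Icc 1 n, (ArithmeticFunction.moebius n : ℝ) / n : ℝ) : ℂ) := by
      simp [hf]
    rw [e, Complex.norm_real]
    simpa using this
  have key := LSeries_eq_mul_integral f le_rfl hs hsum hO
  have hsub : ∫ (t : ℝ) in Set.Ioi 1, (∑ k ∈ Finset.Icc 1 ⌊t⌋₊, f k) * (t : ℂ) ^ (-(s + 1)) =
      ∫ u in Set.Ioi (0 : ℝ), (moebiusSum u : ℂ) * Complex.exp (-s * u) := by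
    have himg : Real.exp '' Set.Ioi 0 = Set.Ioi 1 := by
      ext y; constructor
      · rintro ⟨x, hx, rfl⟩; exact one_lt_exp_iff.2 hx
      · intro hy; exact ⟨log y, log_pos hy, exp_log (one_pos.trans hy)⟩
    rw [← himg, integral_image_eq_integral_abs_deriv_smul measurableSet_Ioi
      (fun x _ => (hasDerivAt_exp x).hasDerivWithinAt) exp_injective.injOn]
    refine setIntegral_congr_fun measurableSet_Ioi fun u _ => ?_
    have e1 : ((exp u : ℝ) : ℂ) ^ (-(s + 1)) = Complex.exp (-s * u) * Complex.exp (-u) := by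
      rw [Complex.cpow_def_of_ne_zero (by exact_mod_cast (exp_pos u).ne'), ← Complex.ofReal_log
        (exp_pos u).le, log_exp, ← Complex.exp_add]
      ring_nf
    have e2 : (exp u : ℂ) * Complex.exp (-u) = 1 := by
      rw [Complex.ofReal_exp, ← Complex.exp_add]; simp
    have e3 : ∑ k ∈ Finset.Icc 1 ⌊exp u⌋₊, f k = (moebiusSum u : ℂ) := by
      simp [hf, moebiusSum]
    rw [abs_of_pos (exp_pos u), e1, e3, Complex.real_smul]
    linear_combination (moebiusSum u : ℂ) * Complex.exp (-s * u) * e2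
  have hfull : ∫ u : ℝ, (moebiusSum u : ℂ) * Complex.exp (-s * u) =
      ∫ u in Set.Ioi (0 : ℝ), (moebiusSum u : ℂ) * Complex.exp (-s * u) := by
    rw [← integral_Ici_eq_integral_Ioi]
    refine (setIntegral_eq_integral_of_forall_compl_eq_zero fun u hu => ?_).symm
    rw [moebiusSum_of_neg (by simpa using hu)]; simp
  rw [hfull, ← hsub, riemannZeta₁_eq_mul (by simpa using hs0)]
  rw [key] at hL
  rw [add_sub_cancel_left]
  exact eq_one_div_of_mul_eq_one_left (by linear_combination hL)

section

open FourierTransform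

theorem mul_exp_neg_le {σ : ℝ} (hσ : 0 < σ) (x : ℝ) :
    x * exp (-σ * x) ≤ 2 / σ * exp (-(σ / 2) * x) := by
  have h1 : σ / 2 * x ≤ exp (σ / 2 * x) :=
    (by linarith : _ ≤ σ / 2 * x + 1).trans (add_one_le_exp _)
  have e : exp (-σ * x) * exp (σ / 2 * x) = exp (-(σ / 2) * x) := by
    rw [← exp_add]; ring_nf
  rw [← e]
  have h2 : x ≤ 2 / σ * exp (σ / 2 * x) := by
    rw [div_mul_eq_mul_div, le_div_iff₀ hσ]; linarith
  calc x * exp (-σ * x) ≤ 2 / σ * exp (σ / 2 * x) * exp (-σ * x) := by gcongr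
    _ = _ := by ring

/-- The function whose Fourier transform is the derivative of `1 / ((s - 1) ζ(s))` on a vertical
line. -/
noncomputable def dampedMoebius (σ : ℝ) (u : ℝ) : ℂ :=
  (-2 * π * Complex.I * u) • ((moebiusSum u : ℂ) * Complex.exp (-(σ : ℂ) * u))

theorem measurable_dampedMoebius (σ : ℝ) : Measurable (dampedMoebius σ) := by
  have h : Measurable fun u => (moebiusSum u : ℂ) :=
    Complex.measurable_ofReal.comp measurable_moebiusSum
  unfold dampedMoebius
  fun_prop

theorem norm_dampedMoebius_le {σ : ℝ} (hσ : 0 < σ) (u : ℝ) :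
    ‖dampedMoebius σ u‖ ≤
      Set.indicator (Set.Ici 0) (fun u => 2 * π * (2 / σ) * exp (-(σ / 2) * u)) u := by
  have h := norm_moebiusSum_mul_exp_le σ u σ (by simp)
  rw [dampedMoebius, norm_smul]
  have e : ‖(-2 * π * Complex.I * u : ℂ)‖ = 2 * π * |u| := by
    simp [abs_of_pos pi_pos]
  rw [e]
  by_cases hu : 0 ≤ u
  · rw [Set.indicator_of_mem (Set.mem_Ici.2 hu)] at h ⊢
    rw [abs_of_nonneg hu]
    calc _ ≤ 2 * π * u * exp (-σ * u) := by gcongr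
      _ = 2 * π * (u * exp (-σ * u)) := by ring
      _ ≤ 2 * π * (2 / σ * exp (-(σ / 2) * u)) := by gcongr ?_ * ?_; exact mul_exp_neg_le hσ u
      _ = _ := by ring
  · rw [Set.indicator_of_notMem (by simpa using hu)] at h ⊢
    have : ‖(moebiusSum u : ℂ) * Complex.exp (-(σ : ℂ) * u)‖ = 0 := le_antisymm h (norm_nonneg _)
    rw [this, mul_zero]

theorem integrable_dampedMoebius {σ : ℝ} (hσ : 0 < σ) : Integrable (dampedMoebius σ) := by
  have h1 : Integrable (Set.indicator (Set.Ici 0)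
      (fun u : ℝ => 2 * π * (2 / σ) * exp (-(σ / 2) * u))) := by
    rw [integrable_indicator_iff measurableSet_Ici, integrableOn_Ici_iff_integrableOn_Ioi]
    exact (integrableOn_exp_mul_Ioi (by linarith) 0).const_mul _
  exact h1.mono' (measurable_dampedMoebius σ).aestronglyMeasurable
    (.of_forall (norm_dampedMoebius_le hσ))

theorem memLp_dampedMoebius {σ : ℝ} (hσ : 0 < σ) : MemLp (dampedMoebius σ) 2 := by
  rw [memLp_two_iff_integrable_sq_norm (measurable_dampedMoebius σ).aestronglyMeasurable]
  refine ((integrable_dampedMoebius hσ).norm.const_mul (2 * π * (2 / σ))).mono'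
    ((measurable_dampedMoebius σ).norm.pow_const 2).aestronglyMeasurable (.of_forall fun u => ?_)
  have h : ‖dampedMoebius σ u‖ ≤ 2 * π * (2 / σ) := by
    refine (norm_dampedMoebius_le hσ u).trans ?_
    refine Set.indicator_le' (g := fun _ => 2 * π * (2 / σ)) (fun u hu => ?_)
      (fun u _ => by positivity) u
    have hu : (0 : ℝ) ≤ u := hu
    refine mul_le_of_le_one_right (by positivity) (exp_le_one_iff.2 ?_)
    nlinarith
  rw [norm_pow, norm_norm, sq]
  gcongr

theorem fourier_dampedMoebius {σ : ℝ} (hσ : 0 < σ) (w : ℝ) :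
    𝓕 (dampedMoebius σ) w = -2 * π * Complex.I *
      (deriv riemannZeta₁ (1 + (σ + ((2 * π * w : ℝ) : ℂ) * Complex.I)) /
        riemannZeta₁ (1 + (σ + ((2 * π * w : ℝ) : ℂ) * Complex.I)) ^ 2) := by
  set f : ℝ → ℂ := fun u => (moebiusSum u : ℂ) * Complex.exp (-(σ : ℂ) * u) with hf
  have hfi : Integrable f := integrable_moebiusSum_mul_exp (s := σ) (by simpa using hσ)
  have hxf : Integrable fun x : ℝ => x • f x := by
    have h := ((integrable_dampedMoebius hσ).norm.const_mul (1 / (2 * π)))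
    refine h.mono' ?_ (.of_forall fun u => ?_)
    · exact (measurable_id.smul ((Complex.measurable_ofReal.comp measurable_moebiusSum).mul
        (by fun_prop))).aestronglyMeasurable
    · rw [dampedMoebius, norm_smul, norm_smul]
      have e : ‖(-2 * π * Complex.I * u : ℂ)‖ = 2 * π * |u| := by
        simp [abs_of_pos pi_pos]
      rw [e, Real.norm_eq_abs]
      have := pi_pos
      apply le_of_eq
      simp only [hf]
      field_simp
  have hF : 𝓕 f = fun w : ℝ => 1 / riemannZeta₁ (1 + (σ + ((2 * π * w : ℝ) : ℂ) * Complex.I)) := by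
    ext w
    rw [← integral_moebiusSum_mul_exp (by simpa using hσ), Real.fourier_eq']
    congr 1
    ext u
    simp only [hf, smul_eq_mul]
    rw [mul_left_comm, ← Complex.exp_add]
    congr 2
    simp only [RCLike.inner_apply, conj_trivial]
    push_cast
    ring
  have h1 := Real.hasDerivAt_fourier hfi hxf w
  have hre : (1 : ℝ) ≤ (1 + (σ + ((2 * π * w : ℝ) : ℂ) * Complex.I)).re := by
    simp; linarith
  have hne := riemannZeta₁_ne_zero hre
  have h2 : HasDerivAt (fun w : ℝ => 1 / riemannZeta₁ (1 + (σ + ((2 * π * w : ℝ) : ℂ) * Complex.I)))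
      (-2 * π * Complex.I *
      (deriv riemannZeta₁ (1 + (σ + ((2 * π * w : ℝ) : ℂ) * Complex.I)) /
        riemannZeta₁ (1 + (σ + ((2 * π * w : ℝ) : ℂ) * Complex.I)) ^ 2)) w := by
    have hin : HasDerivAt (fun w : ℝ => (1 + (σ + ((2 * π * w : ℝ) : ℂ) * Complex.I)))
        (((2 * π * 1 : ℝ) : ℂ) * Complex.I) w :=
      (((((hasDerivAt_id w).const_mul (2 * π)).ofReal_comp).mul_const Complex.I).const_add
        (σ : ℂ)).const_add 1
    have hz := (differentiable_riemannZeta₁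
      (1 + (σ + ((2 * π * w : ℝ) : ℂ) * Complex.I))).hasDerivAt
    have hcomp := hz.comp w hin
    have := hcomp.fun_inv hne
    convert! this using 1
    · ext w; simp [one_div]
    · simp only [Function.comp_apply]; push_cast; ring
  rw [hF] at h1
  exact h1.unique h2

theorem exists_eLpNorm_dampedMoebius_le : ∃ B : ENNReal, B < ⊤ ∧ ∀ σ : ℝ, 0 < σ → σ ≤ 1 →
    eLpNorm (dampedMoebius σ) 2 ≤ B := by
  obtain ⟨K, hK0, hK⟩ := norm_deriv_div_sq_le
  refine ⟨eLpNorm (fun w : ℝ => 2 * π * (K * (1 + ‖w‖) ^ (-(11 / 20) : ℝ))) 2, ?_,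
    fun σ h0 h1 => ?_⟩
  · refine (MemLp.const_mul ?_ _).eLpNorm_lt_top
    refine MemLp.const_mul ?_ _
    rw [memLp_two_iff_integrable_sq]
    · have : Integrable fun w : ℝ => (1 + ‖w‖) ^ (-(11 / 10) : ℝ) :=
        integrable_one_add_norm (by norm_num)
      refine this.congr (.of_forall fun w => ?_)
      simp only
      rw [← rpow_natCast, ← rpow_mul (by positivity)]; norm_num
    · refine Continuous.aestronglyMeasurable ?_
      refine Continuous.rpow_const (by fun_prop) fun w => Or.inl (by positivity)
  · rw [← eLpNorm_fourier_eq (integrable_dampedMoebius h0) (memLp_dampedMoebius h0)]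
    refine eLpNorm_mono_real fun w => ?_
    rw [fourier_dampedMoebius h0, norm_mul]
    have e : ‖(-2 * π * Complex.I : ℂ)‖ = 2 * π := by simp [abs_of_pos pi_pos]
    rw [e]
    have := hK σ (2 * π * w) h0 h1
    gcongr 2 * π * ?_
    refine this.trans ?_
    gcongr K * ?_
    refine rpow_le_rpow_of_nonpos (by positivity) ?_ (by norm_num)
    rw [abs_mul, abs_of_pos (by positivity), norm_eq_abs]
    have : |w| ≤ 2 * π * |w| := le_mul_of_one_le_left (abs_nonneg _) (by linarith [pi_gt_three])
    linarith

theorem integrable_sq_mul_moebiusSum : Integrable fun u : ℝ => (u * moebiusSum u) ^ 2 := by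
  obtain ⟨B, hB, h⟩ := exists_eLpNorm_dampedMoebius_le
  have hlim : ∀ u, Filter.Tendsto (fun n : ℕ => dampedMoebius (1 / ((n : ℝ) + 1)) u) Filter.atTop
      (nhds (dampedMoebius 0 u)) := by
    intro u
    have hc : Continuous fun σ : ℝ => dampedMoebius σ u := by
      unfold dampedMoebius; fun_prop
    exact (hc.tendsto 0).comp tendsto_one_div_add_atTop_nhds_zero_nat
  have h1 : eLpNorm (dampedMoebius 0) 2 ≤ B := by
    refine (Lp.eLpNorm_lim_le_liminf_eLpNorm (fun n =>
      (measurable_dampedMoebius _).aestronglyMeasurable) _ (.of_forall hlim)).trans ?_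
    refine Filter.liminf_le_of_le (by isBoundedDefault) fun b hb => ?_
    obtain ⟨n, hn⟩ := hb.exists
    refine hn.trans (h _ (by positivity) ?_)
    rw [div_le_one (by positivity)]
    linarith [(Nat.cast_nonneg n : (0 : ℝ) ≤ n)]
  have h2 : MemLp (dampedMoebius 0) 2 :=
    ⟨(measurable_dampedMoebius 0).aestronglyMeasurable, h1.trans_lt hB⟩
  rw [memLp_two_iff_integrable_sq_norm h2.1] at h2
  refine (h2.const_mul (1 / (2 * π) ^ 2)).congr (.of_forall fun u => ?_)
  have e : ‖dampedMoebius 0 u‖ = 2 * π * |u| * |moebiusSum u| := by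
    simp [dampedMoebius, abs_of_pos pi_pos]
  simp only
  rw [e]
  have := pi_pos
  field_simp
  rw [sq_abs, sq_abs]

/-- `∑_{n ≤ x} μ(n)/n` is absolutely integrable against a small power of `log x`. -/
theorem integrable_moebiusSum_weight :
    Integrable fun v : ℝ => |moebiusSum v| * (1 + |v|) ^ (1 / 4 : ℝ) := by
  have h1 : Integrable fun v : ℝ => (1 + ‖v‖) ^ (-(3 / 2) : ℝ) :=
    integrable_one_add_norm (by norm_num)
  have h2 : Integrable (Set.indicator (Set.Icc (0 : ℝ) 1) fun _ => (4 : ℝ)) := by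
    rw [integrable_indicator_iff measurableSet_Icc]
    exact integrableOn_const (by simp)
  refine ((integrable_sq_mul_moebiusSum.const_mul 4).add (h2.add h1)).mono' ?_
    (.of_forall fun v => ?_)
  · exact (measurable_moebiusSum.abs.mul (by fun_prop)).aestronglyMeasurable
  · simp only [Pi.add_apply]
    have hp : (0 : ℝ) < 1 + |v| := by positivity
    rw [norm_of_nonneg (by positivity), norm_eq_abs]
    set a := |moebiusSum v| * (1 + |v|) with ha
    set b := (1 + |v|) ^ (-(3 / 4) : ℝ) with hb
    have e1 : |moebiusSum v| * (1 + |v|) ^ (1 / 4 : ℝ) = a * b := by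
      rw [ha, hb, mul_assoc]
      nth_rewrite 2 [← rpow_one (1 + |v|)]
      rw [← rpow_add hp]; norm_num
    have e2 : (1 + |v|) ^ (-(3 / 2) : ℝ) = b ^ 2 := by
      rw [hb, ← rpow_natCast, ← rpow_mul hp.le]; norm_num
    rw [e1, e2]
    have h3 : a ^ 2 ≤ 4 * (v * moebiusSum v) ^ 2 +
        Set.indicator (Set.Icc (0 : ℝ) 1) (fun _ => (4 : ℝ)) v := by
      have hm := abs_moebiusSum_le v
      have hm2 : moebiusSum v ^ 2 ≤ 1 := by rw [← sq_abs]; exact pow_le_one₀ (abs_nonneg _) hm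
      have ea : a ^ 2 = moebiusSum v ^ 2 * (1 + |v|) ^ 2 := by rw [ha, mul_pow, sq_abs]
      have ev : (v * moebiusSum v) ^ 2 = moebiusSum v ^ 2 * |v| ^ 2 := by rw [mul_pow, sq_abs]; ring
      rw [ea, ev]
      rcases lt_or_ge v 0 with hv | hv
      · rw [moebiusSum_of_neg hv]
        simp only [ne_eq, OfNat.ofNat_ne_zero, not_false_eq_true, zero_pow, zero_mul, mul_zero,
          zero_add]
        exact Set.indicator_nonneg (fun _ _ => by norm_num) v
      · rw [abs_of_nonneg hv]
        rcases le_total v 1 with h1 | h1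
        · rw [Set.indicator_of_mem (Set.mem_Icc.2 ⟨hv, h1⟩)]
          have : (1 + v) ^ 2 ≤ 4 := by nlinarith
          nlinarith [sq_nonneg (moebiusSum v), mul_nonneg (sq_nonneg (moebiusSum v)) (sq_nonneg v)]
        · have h0 : 0 ≤ Set.indicator (Set.Icc (0 : ℝ) 1) (fun _ => (4 : ℝ)) v :=
            Set.indicator_nonneg (fun _ _ => by norm_num) v
          have : (1 + v) ^ 2 ≤ 4 * v ^ 2 := by nlinarith
          nlinarith [sq_nonneg (moebiusSum v),
            mul_le_mul_of_nonneg_left this (sq_nonneg (moebiusSum v))]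
    nlinarith [sq_nonneg (a - b)]

theorem integrable_moebiusSum : Integrable moebiusSum := by
  refine integrable_moebiusSum_weight.mono' measurable_moebiusSum.aestronglyMeasurable
    (.of_forall fun v => ?_)
  exact le_mul_of_one_le_right (abs_nonneg _)
    (one_le_rpow (by linarith [abs_nonneg v]) (by norm_num))

theorem integral_moebiusSum : ∫ v, moebiusSum v = 1 := by
  have h1 : Filter.Tendsto (fun n : ℕ => ∫ u : ℝ, (moebiusSum u : ℂ) *
      Complex.exp (-((1 / ((n : ℝ) + 1) : ℝ) : ℂ) * u)) Filter.atTop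
      (nhds (∫ u : ℝ, (moebiusSum u : ℂ))) := by
    refine tendsto_integral_of_dominated_convergence (fun u => |moebiusSum u|) (fun n => ?_)
      integrable_moebiusSum.abs (fun n => .of_forall fun u => ?_) (.of_forall fun u => ?_)
    · exact ((Complex.measurable_ofReal.comp measurable_moebiusSum).mul
        (by fun_prop)).aestronglyMeasurable
    · rcases lt_or_ge u 0 with hu | hu
      · simp [moebiusSum_of_neg hu]
      · rw [norm_mul, Complex.norm_real, Complex.norm_exp, norm_eq_abs]
        refine mul_le_of_le_one_right (abs_nonneg _) (exp_le_one_iff.2 ?_)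
        rw [← Complex.ofReal_neg, ← Complex.ofReal_mul, Complex.ofReal_re]
        have : 0 ≤ 1 / ((n : ℝ) + 1) := by positivity
        nlinarith
    · have hc : Continuous fun σ : ℝ => (moebiusSum u : ℂ) * Complex.exp (-(σ : ℂ) * u) := by
        fun_prop
      have := (hc.tendsto 0).comp (tendsto_one_div_add_atTop_nhds_zero_nat (𝕜 := ℝ))
      simpa [Function.comp_def] using this
  have h2 : Filter.Tendsto (fun n : ℕ => ∫ u : ℝ, (moebiusSum u : ℂ) *
      Complex.exp (-((1 / ((n : ℝ) + 1) : ℝ) : ℂ) * u)) Filter.atTop (nhds 1) := by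
    have hc : ContinuousAt (fun σ : ℝ => 1 / riemannZeta₁ (1 + σ)) 0 := by
      refine ContinuousAt.div continuousAt_const ?_ (by simp)
      exact (differentiable_riemannZeta₁.continuous.comp (by fun_prop)).continuousAt
    have := hc.tendsto.comp (tendsto_one_div_add_atTop_nhds_zero_nat (𝕜 := ℝ))
    simp only [Complex.ofReal_zero, add_zero, riemannZeta₁_one, div_one] at this
    refine this.congr fun n => ?_
    rw [integral_moebiusSum_mul_exp (by rw [Complex.ofReal_re]; positivity)]
    rfl
  have h3 := tendsto_nhds_unique h1 h2
  rw [integral_complex_ofReal] at h3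
  exact_mod_cast h3

end

/-- The truncated power `u₊ ^ j / j!`. -/
noncomputable def truncPow (j : ℕ) (u : ℝ) : ℝ := if 0 ≤ u then u ^ j / j.factorial else 0

theorem truncPow_of_nonneg (j : ℕ) {u : ℝ} (hu : 0 ≤ u) : truncPow j u = u ^ j / j.factorial :=
  if_pos hu

theorem truncPow_of_neg (j : ℕ) {u : ℝ} (hu : u < 0) : truncPow j u = 0 := if_neg hu.not_ge

theorem truncPow_nonneg (j : ℕ) (u : ℝ) : 0 ≤ truncPow j u := by
  unfold truncPow; split_ifs <;> positivity

theorem truncPow_mono (j : ℕ) : Monotone (truncPow j) := by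
  intro u w h
  rcases lt_or_ge u 0 with hu | hu
  · rw [truncPow_of_neg j hu]; exact truncPow_nonneg j w
  · rw [truncPow_of_nonneg j hu, truncPow_of_nonneg j (hu.trans h)]; gcongr

theorem measurable_truncPow (j : ℕ) : Measurable (truncPow j) :=
  Measurable.ite measurableSet_Ici (by fun_prop) measurable_const

theorem pow_succ_sub_le {a b : ℝ} (ha : 0 ≤ a) (hab : a ≤ b) (j : ℕ) :
    (b - a) * ((j + 1) * a ^ j) ≤ b ^ (j + 1) - a ^ (j + 1) ∧
      b ^ (j + 1) - a ^ (j + 1) ≤ (b - a) * ((j + 1) * b ^ j) := by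
  have hs := Commute.geom_sum₂_mul (Commute.all b a) (j + 1)
  have hb : 0 ≤ b := ha.trans hab
  have h1 : ∀ i ∈ Finset.range (j + 1), b ^ i * a ^ (j + 1 - 1 - i) ≤ b ^ j := fun i hi => by
    have : i ≤ j := by simpa [Nat.lt_succ_iff] using hi
    calc b ^ i * a ^ (j + 1 - 1 - i) ≤ b ^ i * b ^ (j + 1 - 1 - i) := by gcongr
      _ = b ^ j := by rw [← pow_add]; congr 1; omega
  have h2 : ∀ i ∈ Finset.range (j + 1), a ^ j ≤ b ^ i * a ^ (j + 1 - 1 - i) := fun i hi => by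
    have : i ≤ j := by simpa [Nat.lt_succ_iff] using hi
    calc a ^ j = a ^ i * a ^ (j + 1 - 1 - i) := by rw [← pow_add]; congr 1; omega
      _ ≤ b ^ i * a ^ (j + 1 - 1 - i) := by gcongr
  have h3 := Finset.sum_le_card_nsmul _ _ _ h1
  have h4 := Finset.card_nsmul_le_sum _ _ _ h2
  rw [Finset.card_range, nsmul_eq_mul] at h3 h4
  push_cast at h3 h4
  rw [← hs, mul_comm (b - a), mul_comm (b - a)]
  exact ⟨mul_le_mul_of_nonneg_right h4 (by linarith), mul_le_mul_of_nonneg_right h3 (by linarith)⟩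

theorem truncPow_succ_sub {a b : ℝ} (hab : a ≤ b) (j : ℕ) :
    (b - a) * truncPow j a ≤ truncPow (j + 1) b - truncPow (j + 1) a ∧
      truncPow (j + 1) b - truncPow (j + 1) a ≤ (b - a) * truncPow j b := by
  have hf : ((j + 1).factorial : ℝ) = (j + 1) * j.factorial := by
    rw [Nat.factorial_succ]; push_cast; ring
  have hj : (0 : ℝ) < j.factorial := by positivity
  have hj1 : (0 : ℝ) < (j + 1 : ℝ) := by positivity
  rcases lt_or_ge a 0 with ha | ha
  · rw [truncPow_of_neg j ha, truncPow_of_neg _ ha, mul_zero, sub_zero]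
    refine ⟨truncPow_nonneg _ _, ?_⟩
    rcases lt_or_ge b 0 with hb | hb
    · rw [truncPow_of_neg j hb, truncPow_of_neg _ hb, mul_zero]
    · rw [truncPow_of_nonneg j hb, truncPow_of_nonneg _ hb, hf, pow_succ']
      have h1 : b * b ^ j / ((j + 1) * j.factorial) ≤ b * b ^ j / (1 * j.factorial) := by
        gcongr
        linarith [(Nat.cast_nonneg j : (0 : ℝ) ≤ j)]
      have h2 : b * b ^ j / (1 * j.factorial) ≤ (b - a) * (b ^ j / j.factorial) := by
        rw [one_mul, mul_div_assoc]
        gcongr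
        linarith
      exact h1.trans h2
  · have hb := ha.trans hab
    obtain ⟨h1, h2⟩ := pow_succ_sub_le ha hab j
    rw [truncPow_of_nonneg j ha, truncPow_of_nonneg _ ha, truncPow_of_nonneg j hb,
      truncPow_of_nonneg _ hb, hf, ← sub_div, ← mul_div_assoc, ← mul_div_assoc,
      div_le_div_iff₀ hj (by positivity), div_le_div_iff₀ (by positivity) hj]
    constructor
    · nlinarith [mul_le_mul_of_nonneg_right h1 hj.le]
    · nlinarith [mul_le_mul_of_nonneg_right h2 hj.le]

/-- Functions supported on `[0, ∞)`, measurable and bounded on left half-lines. -/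
structure Causal (f : ℝ → ℝ) : Prop where
  measurable : Measurable f
  of_neg : ∀ x < 0, f x = 0
  bounded : ∀ u, ∃ B, ∀ x ≤ u, |f x| ≤ B

theorem causal_truncPow (j : ℕ) : Causal (truncPow j) where
  measurable := measurable_truncPow j
  of_neg := fun _ hx => truncPow_of_neg j hx
  bounded := fun u => ⟨truncPow j u, fun x hx => by
    rw [abs_of_nonneg (truncPow_nonneg j x)]; exact truncPow_mono j hx⟩

theorem Causal.shift {f : ℝ → ℝ} (hf : Causal f) {a : ℝ} (ha : 0 ≤ a) :
    Causal fun u => f (u - a) where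
  measurable := hf.measurable.comp (by fun_prop)
  of_neg := fun x hx => hf.of_neg _ (by linarith)
  bounded := fun u => by
    obtain ⟨B, hB⟩ := hf.bounded u
    exact ⟨B, fun x hx => hB _ (by linarith)⟩

theorem Causal.sum {ι : Type*} (s : Finset ι) (c : ι → ℝ) {f : ι → ℝ → ℝ}
    (hf : ∀ i ∈ s, Causal (f i)) : Causal fun u => ∑ i ∈ s, c i * f i u where
  measurable := Finset.measurable_fun_sum _ fun i hi => (hf i hi).measurable.const_mul _
  of_neg := fun x hx => Finset.sum_eq_zero fun i hi => by rw [(hf i hi).of_neg x hx, mul_zero]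
  bounded := fun u => by
    have : ∀ i, ∃ B, i ∈ s → ∀ x ≤ u, |f i x| ≤ B := fun i => by
      by_cases hi : i ∈ s
      · obtain ⟨B, hB⟩ := (hf i hi).bounded u
        exact ⟨B, fun _ => hB⟩
      · exact ⟨0, fun h => absurd h hi⟩
    choose B hB using this
    refine ⟨∑ i ∈ s, |c i| * B i, fun x hx => (Finset.abs_sum_le_sum_abs _ _).trans ?_⟩
    refine Finset.sum_le_sum fun i hi => ?_
    rw [abs_mul]
    exact mul_le_mul_of_nonneg_left (hB i hi x hx) (abs_nonneg _)

/-- Convolution with `moebiusSum`. -/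
noncomputable def moebiusConv (f : ℝ → ℝ) (u : ℝ) : ℝ := ∫ v, moebiusSum v * f (u - v)

theorem Causal.norm_le {f : ℝ → ℝ} {B u x v : ℝ} (hB : ∀ x ≤ u, |f x| ≤ B) (hx : x ≤ u) :
    ‖moebiusSum v * f (x - v)‖ ≤ B * |moebiusSum v| := by
  rw [norm_mul, norm_eq_abs, norm_eq_abs, mul_comm]
  rcases lt_or_ge v 0 with hv | hv
  · simp [moebiusSum_of_neg hv]
  · gcongr
    exact hB _ (by linarith)

theorem Causal.integrable {f : ℝ → ℝ} (hf : Causal f) (u : ℝ) :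
    Integrable fun v => moebiusSum v * f (u - v) := by
  obtain ⟨B, hB⟩ := hf.bounded u
  refine (integrable_moebiusSum.abs.const_mul B).mono' ?_
    (.of_forall fun v => Causal.norm_le hB le_rfl)
  exact (measurable_moebiusSum.mul (hf.measurable.comp (by fun_prop))).aestronglyMeasurable

theorem Causal.moebiusConv {f : ℝ → ℝ} (hf : Causal f) : Causal (moebiusConv f) where
  measurable := by
    have : Measurable (Function.uncurry fun u v : ℝ => moebiusSum v * f (u - v)) :=
      (measurable_moebiusSum.comp measurable_snd).mul (hf.measurable.comp (by fun_prop))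
    exact this.stronglyMeasurable.integral_prod_right.measurable
  of_neg := fun x hx => by
    unfold GPY.moebiusConv
    rw [integral_eq_zero_of_ae (.of_forall fun v => ?_)]
    rcases lt_or_ge v 0 with hv | hv
    · simp [moebiusSum_of_neg hv]
    · simp [hf.of_neg (x - v) (by linarith)]
  bounded := fun u => by
    obtain ⟨B, hB⟩ := hf.bounded u
    refine ⟨∫ v, B * |moebiusSum v|, fun x hx => ?_⟩
    rw [← norm_eq_abs]
    exact norm_integral_le_of_norm_le (integrable_moebiusSum.abs.const_mul B)
      (.of_forall fun v => Causal.norm_le hB hx)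

theorem moebiusConv_sum_shift {ι : Type*} (s : Finset ι) (c a : ι → ℝ)
    {f : ι → ℝ → ℝ} (hf : ∀ i ∈ s, Causal (f i)) (u : ℝ) :
    moebiusConv (fun u => ∑ i ∈ s, c i * f i (u - a i)) u =
      ∑ i ∈ s, c i * moebiusConv (f i) (u - a i) := by
  unfold moebiusConv
  simp only [Finset.mul_sum, ← integral_const_mul]
  rw [integral_finsetSum]
  · refine Finset.sum_congr rfl fun i _ => integral_congr_ae (.of_forall fun v => ?_)
    simp only
    rw [show u - v - a i = u - a i - v by ring]; ring
  · intro i hi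
    refine (((hf i hi).integrable (u - a i)).const_mul (c i)).congr (.of_forall fun v => ?_)
    simp only
    rw [show u - v - a i = u - a i - v by ring]; ring

/-- The operator `f ↦ ∑_{n ≤ R} μ(n)/n f(u - log n)`. -/
noncomputable def moebiusOp (R : ℝ) (f : ℝ → ℝ) (u : ℝ) : ℝ :=
  ∑ n ∈ Finset.Icc 1 ⌊R⌋₊, (ArithmeticFunction.moebius n : ℝ) / n * f (u - log n)

theorem log_nonneg_of_mem {N n : ℕ} (hn : n ∈ Finset.Icc 1 N) : 0 ≤ log (n : ℝ) :=
  log_nonneg (by exact_mod_cast (Finset.mem_Icc.1 hn).1)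

theorem Causal.moebiusOp {f : ℝ → ℝ} (hf : Causal f) (R : ℝ) : Causal (moebiusOp R f) :=
  Causal.sum _ _ fun _ hn => hf.shift (log_nonneg_of_mem hn)

theorem integral_indicator_truncPow (j : ℕ) (a u : ℝ) :
    ∫ v, Set.indicator (Set.Ici a) (fun v => truncPow j (u - v)) v = truncPow (j + 1) (u - a) := by
  have hf : ((j + 1).factorial : ℝ) = (j + 1) * j.factorial := by
    rw [Nat.factorial_succ]; push_cast; ring
  have e : Set.indicator (Set.Ici a) (fun v => truncPow j (u - v)) =
      Set.indicator (Set.Icc a u) (fun v => (u - v) ^ j / j.factorial) := by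
    ext v
    by_cases h1 : a ≤ v
    · rw [Set.indicator_of_mem (Set.mem_Ici.2 h1)]
      by_cases h2 : v ≤ u
      · rw [Set.indicator_of_mem (Set.mem_Icc.2 ⟨h1, h2⟩), truncPow_of_nonneg _ (by linarith)]
      · rw [Set.indicator_of_notMem (fun h => h2 h.2), truncPow_of_neg _ (by linarith)]
    · rw [Set.indicator_of_notMem (by simpa using h1), Set.indicator_of_notMem (fun h => h1 h.1)]
  rw [e, integral_indicator measurableSet_Icc]
  rcases lt_or_ge u a with h | h
  · rw [Set.Icc_eq_empty (by linarith), truncPow_of_neg _ (by linarith)]; simp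
  · rw [integral_Icc_eq_integral_Ioc, ← intervalIntegral.integral_of_le h,
      intervalIntegral.integral_comp_sub_left (fun x => x ^ j / (j.factorial : ℝ)),
      intervalIntegral.integral_div, integral_pow, truncPow_of_nonneg _ (by linarith), hf]
    simp
    field_simp

theorem integrable_indicator_truncPow (j : ℕ) (a u : ℝ) :
    Integrable (Set.indicator (Set.Ici a) (fun v => truncPow j (u - v))) := by
  have h : Integrable (Set.indicator (Set.Icc a u) fun _ => truncPow j (u - a)) := by
    rw [integrable_indicator_iff measurableSet_Icc]
    exact integrableOn_const (by simp)
  refine h.mono' ?_ (.of_forall fun v => ?_)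
  · exact (((measurable_truncPow j).comp (by fun_prop)).indicator
      measurableSet_Ici).aestronglyMeasurable
  · by_cases h1 : a ≤ v
    · rw [Set.indicator_of_mem (Set.mem_Ici.2 h1), norm_of_nonneg (truncPow_nonneg _ _)]
      by_cases h2 : v ≤ u
      · rw [Set.indicator_of_mem (Set.mem_Icc.2 ⟨h1, h2⟩)]
        exact truncPow_mono j (by linarith)
      · rw [Set.indicator_of_notMem (fun h => h2 h.2), truncPow_of_neg _ (by linarith)]
    · rw [Set.indicator_of_notMem (by simpa using h1), Set.indicator_of_notMem (fun h => h1 h.1)]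
      simp

theorem moebiusOp_truncPow_succ {R u : ℝ} (hR : 0 < R) (hu : u ≤ log R) (j : ℕ) :
    moebiusOp R (truncPow (j + 1)) u = moebiusConv (truncPow j) u := by
  unfold moebiusOp moebiusConv
  simp only [← integral_indicator_truncPow, ← integral_const_mul]
  rw [← integral_finsetSum _ fun n _ => (integrable_indicator_truncPow j _ u).const_mul _]
  refine integral_congr_ae (.of_forall fun v => ?_)
  simp only
  rcases lt_or_ge u v with huv | huv
  · rw [truncPow_of_neg _ (by linarith), mul_zero]
    refine Finset.sum_eq_zero fun n _ => ?_
    rw [Set.indicator_apply, truncPow_of_neg _ (by linarith)]; simp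
  · rw [moebiusSum, Finset.sum_mul]
    symm
    refine Finset.sum_subset_zero_on_sdiff ?_ ?_ ?_
    · refine Finset.Icc_subset_Icc_right (Nat.floor_mono ?_)
      rw [← exp_log hR]; exact exp_le_exp.2 (huv.trans hu)
    · intro n hn
      rw [Finset.mem_sdiff, Finset.mem_Icc, Finset.mem_Icc] at hn
      rw [Set.indicator_of_notMem, mul_zero]
      intro hv
      have hn0 : (0 : ℝ) < n := by exact_mod_cast hn.1.1
      exact hn.2 ⟨hn.1.1, Nat.le_floor (by rw [← exp_log hn0]; exact exp_le_exp.2 hv)⟩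
    · intro n hn
      rw [Finset.mem_Icc] at hn
      have hn0 : (0 : ℝ) < n := by exact_mod_cast hn.1
      rw [Set.indicator_of_mem]
      rw [Set.mem_Ici, log_le_iff_le_exp hn0]
      exact (Nat.le_floor_iff (exp_pos v).le).1 hn.2

theorem moebiusOp_congr {R U : ℝ} {f g : ℝ → ℝ} (h : ∀ u ≤ U, f u = g u) :
    ∀ u ≤ U, moebiusOp R f u = moebiusOp R g u := fun u hu =>
  Finset.sum_congr rfl fun n hn => by
    rw [h _ (by linarith [log_nonneg_of_mem hn])]

theorem moebiusConv_congr {U : ℝ} {f g : ℝ → ℝ} (h : ∀ u ≤ U, f u = g u) :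
    ∀ u ≤ U, moebiusConv f u = moebiusConv g u := fun u hu =>
  integral_congr_ae (.of_forall fun v => by
    rcases lt_or_ge v 0 with hv | hv
    · simp [moebiusSum_of_neg hv]
    · simp only; rw [h _ (by linarith)])

theorem moebiusConv_moebiusOp {f : ℝ → ℝ} (hf : Causal f) (R : ℝ) :
    moebiusConv (moebiusOp R f) = moebiusOp R (moebiusConv f) := by
  ext u
  exact moebiusConv_sum_shift (Finset.Icc 1 ⌊R⌋₊)
    (fun n : ℕ => (ArithmeticFunction.moebius n : ℝ) / n) (fun n => log (n : ℝ))
    (f := fun _ => f) (fun _ _ => hf) u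

theorem moebiusConv_moebiusOp_iterate {f : ℝ → ℝ} (hf : Causal f) (R : ℝ) (k : ℕ) :
    moebiusConv ((moebiusOp R)^[k] f) = (moebiusOp R)^[k] (moebiusConv f) := by
  induction k generalizing f with
  | zero => rfl
  | succ k ih =>
    rw [Function.iterate_succ_apply, ih (hf.moebiusOp R), moebiusConv_moebiusOp hf,
      Function.iterate_succ_apply]

theorem moebiusOp_iterate_congr {R U : ℝ} (k : ℕ) {f g : ℝ → ℝ} (h : ∀ u ≤ U, f u = g u) :
    ∀ u ≤ U, (moebiusOp R)^[k] f u = (moebiusOp R)^[k] g u := by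
  induction k generalizing f g with
  | zero => exact h
  | succ k ih => exact ih (moebiusOp_congr h)

/-- Each application of the Möbius operator to a truncated power lowers the degree and introduces a
convolution with `moebiusSum`. -/
theorem moebiusOp_iterate_truncPow {R : ℝ} (hR : 0 < R) (k l : ℕ) :
    ∀ u ≤ log R, (moebiusOp R)^[k] (truncPow (k + l)) u = moebiusConv^[k] (truncPow l) u := by
  induction k with
  | zero => simp
  | succ k ih =>
    intro u hu
    rw [Function.iterate_succ_apply, Function.iterate_succ_apply',
      show k + 1 + l = k + l + 1 by ring,
      moebiusOp_iterate_congr k (fun u hu => moebiusOp_truncPow_succ hR hu (k + l)) u hu,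
      ← moebiusConv_moebiusOp_iterate (causal_truncPow _)]
    exact moebiusConv_congr ih u hu

/-- The operator `f ↦ ∑_{d ≤ R} 1/d f(u - log d)`. -/
noncomputable def zetaOp (R : ℝ) (f : ℝ → ℝ) (u : ℝ) : ℝ :=
  ∑ d ∈ Finset.Icc 1 ⌊R⌋₊, 1 / (d : ℝ) * f (u - log d)

/-- The operator `zetaOp` acting diagonally on functions of two variables. -/
noncomputable def zetaOp₂ (R : ℝ) (F : ℝ → ℝ → ℝ) (u w : ℝ) : ℝ :=
  ∑ d ∈ Finset.Icc 1 ⌊R⌋₊, 1 / (d : ℝ) * F (u - log d) (w - log d)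

theorem le_sum_truncPow (j N : ℕ) (u : ℝ) :
    truncPow (j + 1) u - truncPow (j + 1) (u - log (N + 1 : ℕ)) ≤
      ∑ d ∈ Finset.Icc 1 N, 1 / (d : ℝ) * truncPow j (u - log d) := by
  induction N with
  | zero => simp
  | succ N ih =>
    rw [Finset.sum_Icc_succ_top (by omega)]
    have hN : (0 : ℝ) < (N + 1 : ℕ) := by positivity
    have hlog : log (N + 1 + 1 : ℕ) - log (N + 1 : ℕ) ≤ 1 / (N + 1 : ℕ) := by
      rw [← log_div (by positivity) hN.ne']
      refine (log_le_sub_one_of_pos (by positivity)).trans (le_of_eq ?_)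
      push_cast at hN ⊢
      field_simp
      ring
    have hmono : log (N + 1 : ℕ) ≤ log (N + 1 + 1 : ℕ) :=
      log_le_log hN (by push_cast; linarith)
    have h := (truncPow_succ_sub (a := u - log (N + 1 + 1 : ℕ)) (b := u - log (N + 1 : ℕ))
      (by linarith) j).2
    have h2 : (u - log (N + 1 : ℕ) - (u - log (N + 1 + 1 : ℕ))) * truncPow j (u - log (N + 1 : ℕ)) ≤
        1 / (N + 1 : ℕ) * truncPow j (u - log (N + 1 : ℕ)) :=
      mul_le_mul_of_nonneg_right (by linarith) (truncPow_nonneg _ _)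
    linarith

theorem sum_truncPow_le (j N : ℕ) (u : ℝ) :
    ∑ d ∈ Finset.Icc 1 (N + 1), 1 / (d : ℝ) * truncPow j (u - log d) ≤
      truncPow j u + truncPow (j + 1) u - truncPow (j + 1) (u - log (N + 1 : ℕ)) := by
  induction N with
  | zero => simp
  | succ N ih =>
    rw [Finset.sum_Icc_succ_top (by omega)]
    have hN : (0 : ℝ) < (N + 1 : ℕ) := by positivity
    have hlog : 1 / (N + 1 + 1 : ℕ) ≤ log (N + 1 + 1 : ℕ) - log (N + 1 : ℕ) := by
      rw [← log_div (by positivity) hN.ne']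
      refine (le_of_eq ?_).trans (one_sub_inv_le_log_of_pos (by positivity))
      push_cast at hN ⊢
      field_simp
      ring
    have hmono : log (N + 1 : ℕ) ≤ log (N + 1 + 1 : ℕ) :=
      log_le_log hN (by push_cast; linarith)
    have h := (truncPow_succ_sub (a := u - log (N + 1 + 1 : ℕ)) (b := u - log (N + 1 : ℕ))
      (by linarith) j).1
    have h2 : 1 / (N + 1 + 1 : ℕ) * truncPow j (u - log (N + 1 + 1 : ℕ)) ≤
        (u - log (N + 1 : ℕ) - (u - log (N + 1 + 1 : ℕ))) *
          truncPow j (u - log (N + 1 + 1 : ℕ)) :=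
      mul_le_mul_of_nonneg_right (by linarith) (truncPow_nonneg _ _)
    linarith

theorem zetaOp_truncPow_bounds {R u : ℝ} (hR : 1 ≤ R) (hu : u ≤ log R) (j : ℕ) :
    truncPow (j + 1) u ≤ zetaOp R (truncPow j) u ∧
      zetaOp R (truncPow j) u ≤ truncPow j u + truncPow (j + 1) u := by
  constructor
  · have h := le_sum_truncPow j ⌊R⌋₊ u
    have hlog : log R < log (⌊R⌋₊ + 1 : ℕ) :=
      log_lt_log (by linarith) (by push_cast; exact Nat.lt_floor_add_one R)
    rwa [truncPow_of_neg (j + 1) (u := u - log (⌊R⌋₊ + 1 : ℕ)) (by linarith), sub_zero] at h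
  · obtain ⟨N, hN⟩ : ∃ N, ⌊R⌋₊ = N + 1 :=
      Nat.exists_eq_succ_of_ne_zero (Nat.floor_pos.2 hR).ne'
    have h := sum_truncPow_le j N u
    rw [← hN] at h
    exact h.trans (by linarith [truncPow_nonneg (j + 1) (u - log (⌊R⌋₊ : ℕ))])

theorem zetaOp_mono {R U : ℝ} {f g : ℝ → ℝ} (h : ∀ u ≤ U, f u ≤ g u) :
    ∀ u ≤ U, zetaOp R f u ≤ zetaOp R g u := fun u hu =>
  Finset.sum_le_sum fun d hd =>
    mul_le_mul_of_nonneg_left (h _ (by linarith [log_nonneg_of_mem hd])) (by positivity)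

theorem zetaOp_iterate_mono {R U : ℝ} (r : ℕ) {f g : ℝ → ℝ} (h : ∀ u ≤ U, f u ≤ g u) :
    ∀ u ≤ U, (zetaOp R)^[r] f u ≤ (zetaOp R)^[r] g u := by
  induction r generalizing f g with
  | zero => exact h
  | succ r ih => exact ih (zetaOp_mono h)

theorem zetaOp_iterate_add (R : ℝ) (r : ℕ) (f g : ℝ → ℝ) :
    (zetaOp R)^[r] (f + g) = (zetaOp R)^[r] f + (zetaOp R)^[r] g := by
  induction r generalizing f g with
  | zero => rfl
  | succ r ih =>
    rw [Function.iterate_succ_apply, Function.iterate_succ_apply, Function.iterate_succ_apply, ← ih]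
    congr 1
    ext u
    simp [zetaOp, mul_add, Finset.sum_add_distrib]

theorem zetaOp_iterate_const_mul (R c : ℝ) (r : ℕ) (f : ℝ → ℝ) :
    (zetaOp R)^[r] (fun u => c * f u) = fun u => c * (zetaOp R)^[r] f u := by
  induction r generalizing f with
  | zero => rfl
  | succ r ih =>
    rw [Function.iterate_succ_apply, Function.iterate_succ_apply, ← ih]
    congr 1
    ext u
    simp only [zetaOp, Finset.mul_sum]
    exact Finset.sum_congr rfl fun _ _ => by ring

theorem le_zetaOp_iterate {R : ℝ} (hR : 1 ≤ R) (r j : ℕ) :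
    ∀ u ≤ log R, truncPow (j + r) u ≤ (zetaOp R)^[r] (truncPow j) u := by
  induction r generalizing j with
  | zero => exact fun _ _ => le_rfl
  | succ r ih =>
    intro u hu
    rw [show j + (r + 1) = j + 1 + r by ring]
    exact (ih (j + 1) u hu).trans
      (zetaOp_iterate_mono r (fun u hu => (zetaOp_truncPow_bounds hR hu j).1) u hu)

theorem truncPow_le_one_add_pow (j : ℕ) {u : ℝ} (hu : 0 ≤ u) : truncPow j u ≤ (1 + u) ^ j := by
  rw [truncPow_of_nonneg j hu]
  have : (1 : ℝ) ≤ j.factorial := by exact_mod_cast Nat.one_le_iff_ne_zero.2 j.factorial_ne_zero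
  calc u ^ j / j.factorial ≤ u ^ j := div_le_self (by positivity) this
    _ ≤ (1 + u) ^ j := by gcongr; linarith

theorem zetaOp_iterate_le {R : ℝ} (hR : 1 ≤ R) (r j : ℕ) :
    ∀ u, 0 ≤ u → u ≤ log R → (zetaOp R)^[r] (truncPow j) u ≤
      truncPow (j + r) u + (2 ^ r - 1) * (1 + u) ^ (j + r - 1) := by
  induction r generalizing j with
  | zero => simp
  | succ r ih =>
    intro u hu0 hu
    have h1 : (zetaOp R)^[r + 1] (truncPow j) u ≤
        (zetaOp R)^[r] (truncPow j + truncPow (j + 1)) u :=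
      zetaOp_iterate_mono r (fun u hu => (zetaOp_truncPow_bounds hR hu j).2) u hu
    rw [zetaOp_iterate_add, Pi.add_apply] at h1
    have h2 := ih j u hu0 hu
    have h3 := ih (j + 1) u hu0 hu
    have h4 : (1 + u) ^ (j + r - 1) ≤ (1 + u) ^ (j + r) :=
      pow_le_pow_right₀ (by linarith) (by omega)
    have h5 := truncPow_le_one_add_pow (j + r) hu0
    have h6 : (1 : ℝ) ≤ 2 ^ r := one_le_pow₀ (by norm_num)
    have h7 := mul_le_mul_of_nonneg_left h4 (by linarith : (0 : ℝ) ≤ 2 ^ r - 1)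
    rw [show j + 1 + r - 1 = j + r by omega, show j + 1 + r = j + (r + 1) by ring] at h3
    rw [show j + (r + 1) - 1 = j + r by omega, pow_succ]
    linarith

theorem zetaOp₂_iterate_diag (R : ℝ) (r : ℕ) (F : ℝ → ℝ → ℝ) (u : ℝ) :
    (zetaOp₂ R)^[r] F u u = (zetaOp R)^[r] (fun u => F u u) u := by
  induction r generalizing F with
  | zero => rfl
  | succ r ih => exact ih _

theorem zetaOp₂_iterate_mono (R : ℝ) (r : ℕ) {F : ℝ → ℝ → ℝ}
    (hF : ∀ u u' w w', u ≤ u' → w ≤ w' → F u w ≤ F u' w') :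
    ∀ u u' w w', u ≤ u' → w ≤ w' → (zetaOp₂ R)^[r] F u w ≤ (zetaOp₂ R)^[r] F u' w' := by
  induction r generalizing F with
  | zero => exact hF
  | succ r ih =>
    exact ih fun u u' w w' hu hw => Finset.sum_le_sum fun d _ =>
      mul_le_mul_of_nonneg_left (hF _ _ _ _ (by linarith) (by linarith)) (by positivity)

theorem zetaOp₂_iterate_congr {R U : ℝ} (r : ℕ) {F G : ℝ → ℝ → ℝ}
    (h : ∀ u ≤ U, ∀ w ≤ U, F u w = G u w) :
    ∀ u ≤ U, ∀ w ≤ U, (zetaOp₂ R)^[r] F u w = (zetaOp₂ R)^[r] G u w := by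
  induction r generalizing F G with
  | zero => exact h
  | succ r ih =>
    exact ih fun u hu w hw => Finset.sum_congr rfl fun d hd => by
      have := log_nonneg_of_mem hd
      rw [h _ (by linarith) _ (by linarith)]

theorem zetaOp₂_iterate_swap (R : ℝ) (r : ℕ) (F : ℝ → ℝ → ℝ) (u w : ℝ) :
    (zetaOp₂ R)^[r] (fun u w => F w u) u w = (zetaOp₂ R)^[r] F w u := by
  induction r generalizing F with
  | zero => rfl
  | succ r ih => exact ih _

/-- Convolution with `moebiusSum` in the first of two variables. -/
noncomputable def moebiusConv₁ (F : ℝ → ℝ → ℝ) (u w : ℝ) : ℝ := moebiusConv (fun u => F u w) u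

theorem causal_zetaOp₂ {R : ℝ} {F : ℝ → ℝ → ℝ} (hF : ∀ w, Causal fun u => F u w) (w : ℝ) :
    Causal fun u => zetaOp₂ R F u w :=
  Causal.sum _ _ fun d hd => (hF (w - log d)).shift (log_nonneg_of_mem hd)

theorem causal_zetaOp₂_iterate {R : ℝ} (r : ℕ) {F : ℝ → ℝ → ℝ} (hF : ∀ w, Causal fun u => F u w) :
    ∀ w, Causal fun u => (zetaOp₂ R)^[r] F u w := by
  induction r generalizing F with
  | zero => exact hF
  | succ r ih => exact ih (causal_zetaOp₂ hF)

theorem moebiusConv₁_zetaOp₂ {R : ℝ} {F : ℝ → ℝ → ℝ} (hF : ∀ w, Causal fun u => F u w) :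
    moebiusConv₁ (zetaOp₂ R F) = zetaOp₂ R (moebiusConv₁ F) := by
  ext u w
  exact moebiusConv_sum_shift (Finset.Icc 1 ⌊R⌋₊) (fun d : ℕ => 1 / (d : ℝ)) (fun d => log (d : ℝ))
    (f := fun d u => F u (w - log d)) (fun d _ => hF _) u

theorem moebiusConv₁_zetaOp₂_iterate {R : ℝ} (r : ℕ) {F : ℝ → ℝ → ℝ}
    (hF : ∀ w, Causal fun u => F u w) :
    moebiusConv₁ ((zetaOp₂ R)^[r] F) = (zetaOp₂ R)^[r] (moebiusConv₁ F) := by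
  induction r generalizing F with
  | zero => rfl
  | succ r ih =>
    rw [Function.iterate_succ_apply, ih (causal_zetaOp₂ hF), moebiusConv₁_zetaOp₂ hF,
      Function.iterate_succ_apply]

theorem moebiusConv₁_mul (f g : ℝ → ℝ) :
    moebiusConv₁ (fun u w => f u * g w) = fun u w => moebiusConv f u * g w := by
  ext u w
  simp only [moebiusConv₁, moebiusConv, ← mul_assoc, integral_mul_const]

theorem Causal.mul_const {f : ℝ → ℝ} (hf : Causal f) (c : ℝ) : Causal fun u => f u * c := by
  simpa [mul_comm] using Causal.sum ({()} : Finset Unit) (fun _ => c) (f := fun _ => f)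
    (fun _ _ => hf)

/-- `F` is close to the constant `L` to the left of `(U, U)`, with a slowly growing error. -/
def NearConst (U L E : ℝ) (F : ℝ → ℝ → ℝ) : Prop :=
  ∀ v w, 0 ≤ v → 0 ≤ w →
    |F (U - v) (U - w) - L| ≤ E * ((1 + v) ^ (1 / 4 : ℝ) * (1 + w) ^ (1 / 4 : ℝ))

theorem NearConst.swap {U L E : ℝ} {F : ℝ → ℝ → ℝ} (h : NearConst U L E F) :
    NearConst U L E fun u w => F w u := fun v w hv hw => by
  rw [mul_comm ((1 + v) ^ _)]; exact h w v hw hv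

/-- The weighted mass of `moebiusSum`. -/
noncomputable def moebiusMass : ℝ := ∫ v, |moebiusSum v| * (1 + |v|) ^ (1 / 4 : ℝ)

theorem NearConst.moebiusConv₁ {U L E : ℝ} {F : ℝ → ℝ → ℝ} (hE : 0 ≤ E)
    (hF : ∀ w, Causal fun u => F u w) (h : NearConst U L E F) :
    NearConst U L (E * moebiusMass) (moebiusConv₁ F) := fun v w hv hw => by
  have hi := (hF (U - w)).integrable (U - v)
  have e : GPY.moebiusConv₁ F (U - v) (U - w) - L =
      ∫ x, (moebiusSum x * F (U - v - x) (U - w) - moebiusSum x * L) := by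
    rw [integral_sub hi (integrable_moebiusSum.mul_const L), integral_mul_const,
      integral_moebiusSum,
      one_mul]
    rfl
  rw [e, ← norm_eq_abs]
  have e2 : E * moebiusMass * ((1 + v) ^ (1 / 4 : ℝ) * (1 + w) ^ (1 / 4 : ℝ)) =
      ∫ x, (|moebiusSum x| * (1 + |x|) ^ (1 / 4 : ℝ)) *
        (E * ((1 + v) ^ (1 / 4 : ℝ) * (1 + w) ^ (1 / 4 : ℝ))) := by
    rw [integral_mul_const, moebiusMass]; ring
  rw [e2]
  refine norm_integral_le_of_norm_le (integrable_moebiusSum_weight.mul_const _)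
    (.of_forall fun x => ?_)
  rw [← mul_sub, norm_mul, norm_eq_abs, norm_eq_abs, mul_assoc]
  rcases lt_or_ge x 0 with hx | hx
  · simp [moebiusSum_of_neg hx]
  · refine mul_le_mul_of_nonneg_left ?_ (abs_nonneg _)
    have h1 := h (v + x) w (by linarith) hw
    rw [show U - (v + x) = U - v - x by ring] at h1
    refine h1.trans ?_
    have h2 : (1 + (v + x)) ^ (1 / 4 : ℝ) ≤ (1 + |x|) ^ (1 / 4 : ℝ) * (1 + v) ^ (1 / 4 : ℝ) := by
      rw [← mul_rpow (by positivity) (by linarith), abs_of_nonneg hx]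
      exact rpow_le_rpow (by linarith) (by nlinarith) (by norm_num)
    calc E * ((1 + (v + x)) ^ (1 / 4 : ℝ) * (1 + w) ^ (1 / 4 : ℝ))
        ≤ E * (((1 + |x|) ^ (1 / 4 : ℝ) * (1 + v) ^ (1 / 4 : ℝ)) * (1 + w) ^ (1 / 4 : ℝ)) := by
          gcongr
      _ = _ := by ring

theorem moebiusMass_nonneg : 0 ≤ moebiusMass := integral_nonneg fun _ => by positivity

theorem NearConst.iterate_moebiusConv {R U L E : ℝ} {r : ℕ} {f g : ℝ → ℝ} (hE : 0 ≤ E)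
    (hf : Causal f) (k : ℕ) (h : NearConst U L E ((zetaOp₂ R)^[r] fun u w => f u * g w)) :
    NearConst U L (E * moebiusMass ^ k)
      ((zetaOp₂ R)^[r] fun u w => GPY.moebiusConv^[k] f u * g w) := by
  induction k generalizing f E with
  | zero => simpa using h
  | succ k ih =>
    rw [pow_succ', ← mul_assoc]
    refine ih (mul_nonneg hE moebiusMass_nonneg) hf.moebiusConv ?_
    rw [← moebiusConv₁_mul, ← moebiusConv₁_zetaOp₂_iterate r fun w => hf.mul_const _]
    exact h.moebiusConv₁ hE (causal_zetaOp₂_iterate r fun w => hf.mul_const _)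

theorem truncPow_mul_truncPow (a b : ℕ) (u : ℝ) :
    truncPow a u * truncPow b u = (a + b).choose a * truncPow (a + b) u := by
  rcases lt_or_ge u 0 with hu | hu
  · simp [truncPow_of_neg _ hu]
  · have h : ((a + b).choose a : ℝ) * a.factorial * b.factorial = (a + b).factorial := by
      rw [Nat.choose_symm_add]
      exact_mod_cast Nat.add_choose_mul_factorial_mul_factorial a b
    simp only [truncPow_of_nonneg _ hu]
    rw [pow_add, ← h]
    have ha : (a.factorial : ℝ) ≠ 0 := by positivity
    have hb : (b.factorial : ℝ) ≠ 0 := by positivity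
    have hc : ((a + b).choose a : ℝ) ≠ 0 := by
      exact_mod_cast (Nat.choose_pos (Nat.le_add_right a b)).ne'
    field_simp

theorem pow_sub_truncPow_le {U x : ℝ} (hU : 0 ≤ U) (hx : 0 ≤ x) (n : ℕ) :
    U ^ n / n.factorial - truncPow n (U - x) ≤
      (n + 1) * ((1 + x) ^ (1 / 4 : ℝ) * (1 + U) ^ (n - 1 / 4 : ℝ)) := by
  have hfac : (1 : ℝ) ≤ n.factorial := by
    exact_mod_cast Nat.one_le_iff_ne_zero.2 n.factorial_ne_zero
  have hsplit : (1 + U) ^ (1 / 4 : ℝ) * (1 + U) ^ (n - 1 / 4 : ℝ) = (1 + U) ^ n := by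
    rw [← rpow_add (by linarith), ← rpow_natCast]; congr 1; ring
  rcases le_or_gt x U with hxU | hxU
  · rw [truncPow_of_nonneg _ (by linarith), ← sub_div]
    rcases n with _ | n
    · simp only [pow_zero, sub_self, zero_div]; positivity
    · have h1 := (pow_succ_sub_le (a := U - x) (b := U) (by linarith) (by linarith) n).2
      have h0 : 0 ≤ U ^ (n + 1) - (U - x) ^ (n + 1) :=
        sub_nonneg.2 (pow_le_pow_left₀ (by linarith) (by linarith) _)
      have h2 : x ≤ (1 + x) ^ (1 / 4 : ℝ) * (1 + U) ^ (3 / 4 : ℝ) := by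
        calc x ≤ 1 + x := by linarith
          _ = (1 + x) ^ (1 / 4 : ℝ) * (1 + x) ^ (3 / 4 : ℝ) := by
            rw [← rpow_add (by linarith)]; norm_num
          _ ≤ _ := by gcongr
      have h3 : U ^ n ≤ (1 + U) ^ n := by gcongr; linarith
      have h4 : (1 + U) ^ (3 / 4 : ℝ) * (1 + U) ^ n = (1 + U) ^ ((n + 1 : ℕ) - 1 / 4 : ℝ) := by
        rw [← rpow_natCast (1 + U) n, ← rpow_add (by linarith)]; congr 1; push_cast; ring
      calc (U ^ (n + 1) - (U - x) ^ (n + 1)) / (n + 1).factorial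
          ≤ U ^ (n + 1) - (U - x) ^ (n + 1) := div_le_self h0 hfac
        _ ≤ x * ((n + 1) * U ^ n) := by linarith
        _ ≤ ((1 + x) ^ (1 / 4 : ℝ) * (1 + U) ^ (3 / 4 : ℝ)) * ((n + 1) * (1 + U) ^ n) := by gcongr
        _ = (n + 1) * ((1 + x) ^ (1 / 4 : ℝ) * ((1 + U) ^ (3 / 4 : ℝ) * (1 + U) ^ n)) := by ring
        _ ≤ _ := by
          rw [h4]; push_cast
          have : 0 ≤ (1 + x) ^ (1 / 4 : ℝ) * (1 + U) ^ ((n + 1 : ℝ) - 1 / 4) := by positivity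
          nlinarith
  · have h1 : (1 + U) ^ (1 / 4 : ℝ) ≤ (1 + x) ^ (1 / 4 : ℝ) := by gcongr
    calc U ^ n / n.factorial - truncPow n (U - x) ≤ U ^ n / n.factorial := by
          linarith [truncPow_nonneg n (U - x)]
      _ ≤ U ^ n := div_le_self (by positivity) hfac
      _ ≤ (1 + U) ^ n := by gcongr; linarith
      _ = (1 + U) ^ (1 / 4 : ℝ) * (1 + U) ^ (n - 1 / 4 : ℝ) := hsplit.symm
      _ ≤ (1 + x) ^ (1 / 4 : ℝ) * (1 + U) ^ (n - 1 / 4 : ℝ) := by gcongr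
      _ ≤ _ := by
        have : 0 ≤ (1 + x) ^ (1 / 4 : ℝ) * (1 + U) ^ (n - 1 / 4 : ℝ) := by positivity
        nlinarith [(Nat.cast_nonneg n : (0 : ℝ) ≤ n)]

theorem nearConst_truncPow {R : ℝ} (hR : 1 ≤ R) (r a b : ℕ) :
    NearConst (log R) ((a + b).choose a * (log R ^ (r + a + b) / (r + a + b).factorial))
      ((a + b).choose a * (2 ^ r + (r + a + b : ℕ) + 1) *
        (1 + log R) ^ ((r + a + b : ℕ) - 1 / 4 : ℝ))
      ((zetaOp₂ R)^[r] fun u w => truncPow a u * truncPow b w) := by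
  intro v w hv hw
  have hU : 0 ≤ log R := log_nonneg hR
  set U := log R
  have hcomm : r + a + b = a + b + r := by ring
  set n := r + a + b with hn
  set c : ℝ := ((a + b).choose a : ℝ) with hc
  have hc0 : 0 ≤ c := by positivity
  have hdiag : ∀ u, (zetaOp₂ R)^[r] (fun u w => truncPow a u * truncPow b w) u u =
      c * (zetaOp R)^[r] (truncPow (a + b)) u := fun u => by
    rw [zetaOp₂_iterate_diag]
    simp only [truncPow_mul_truncPow]
    rw [zetaOp_iterate_const_mul]
  have hmono := zetaOp₂_iterate_mono R r (F := fun u w => truncPow a u * truncPow b w)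
    fun u u' w w' hu hw => mul_le_mul (truncPow_mono a hu) (truncPow_mono b hw)
      (truncPow_nonneg _ _) (truncPow_nonneg _ _)
  have hx : 0 ≤ max v w := hv.trans (le_max_left _ _)
  have hlow := hmono (U - max v w) (U - v) (U - max v w) (U - w)
    (by linarith [le_max_left v w]) (by linarith [le_max_right v w])
  have hup := hmono (U - v) U (U - w) U (by linarith) (by linarith)
  rw [hdiag] at hlow hup
  have h1 := le_zetaOp_iterate hR r (a + b) (U - max v w) (by linarith)
  have h2 := zetaOp_iterate_le hR r (a + b) U hU le_rfl
  rw [← hcomm] at h1 h2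
  rw [truncPow_of_nonneg _ hU] at h2
  have h3 := pow_sub_truncPow_le hU hx n
  set W := (1 + v) ^ (1 / 4 : ℝ) * (1 + w) ^ (1 / 4 : ℝ) with hW
  have hW1 : 1 ≤ W := by
    rw [hW, ← mul_rpow (by linarith) (by linarith)]
    exact one_le_rpow (by nlinarith) (by norm_num)
  have hxW : (1 + max v w) ^ (1 / 4 : ℝ) ≤ W := by
    rw [hW, ← mul_rpow (by linarith) (by linarith)]
    refine rpow_le_rpow (by linarith) ?_ (by norm_num)
    rcases max_cases v w with h | h <;> rw [h.1] <;> nlinarith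
  set T := (1 + U) ^ (n - 1 / 4 : ℝ) with hT
  have hT0 : 0 ≤ T := by positivity
  have hr1 : (1 : ℝ) ≤ 2 ^ r := one_le_pow₀ (by norm_num)
  have h4 : (2 ^ r - 1 : ℝ) * (1 + U) ^ (n - 1) ≤ 2 ^ r * T := by
    rcases Nat.eq_zero_or_pos n with h0 | h0
    · have : r = 0 := by omega
      rw [this]; simp only [pow_zero, sub_self, zero_mul, one_mul]; exact hT0
    · have h5 : (1 + U) ^ (n - 1) ≤ T := by
        rw [hT, ← rpow_natCast, Nat.cast_sub h0]
        exact rpow_le_rpow_of_exponent_le (by linarith) (by push_cast; linarith)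
      nlinarith [pow_nonneg (by linarith : 0 ≤ 1 + U) (n - 1)]
  have h6 : (n + 1) * ((1 + max v w) ^ (1 / 4 : ℝ) * T) ≤ (n + 1) * (W * T) := by gcongr
  have hTW : T ≤ W * T := le_mul_of_one_le_left hT0 hW1
  have hn0 : (0 : ℝ) ≤ n := Nat.cast_nonneg n
  rw [abs_le]
  constructor
  · have h7 : U ^ n / n.factorial - (zetaOp R)^[r] (truncPow (a + b)) (U - max v w) ≤
        (2 ^ r + n + 1) * (W * T) := by nlinarith [mul_nonneg (zero_le_one.trans hW1) hT0]
    have h8 := mul_le_mul_of_nonneg_left h7 hc0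
    have h9 : c * (2 ^ r + ↑n + 1) * T * W = c * ((2 ^ r + ↑n + 1) * (W * T)) := by ring
    linarith
  · have h7 : (zetaOp R)^[r] (truncPow (a + b)) U - U ^ n / n.factorial ≤
        (2 ^ r + n + 1) * (W * T) := by nlinarith [mul_nonneg (zero_le_one.trans hW1) hT0]
    have h8 := mul_le_mul_of_nonneg_left h7 hc0
    have h9 : c * (2 ^ r + ↑n + 1) * T * W = c * ((2 ^ r + ↑n + 1) * (W * T)) := by ring
    linarith

/-- The correlation of two Möbius-smoothed truncated powers is nearly constant near `log R`. -/
theorem nearConst_moebiusOp {R : ℝ} (hR : 1 ≤ R) (r k₁ k₂ l₁ l₂ : ℕ) :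
    NearConst (log R) ((l₁ + l₂).choose l₁ * (log R ^ (r + l₁ + l₂) / (r + l₁ + l₂).factorial))
      ((l₁ + l₂).choose l₁ * (2 ^ r + (r + l₁ + l₂ : ℕ) + 1) *
        (1 + log R) ^ ((r + l₁ + l₂ : ℕ) - 1 / 4 : ℝ) * moebiusMass ^ k₁ * moebiusMass ^ k₂)
      ((zetaOp₂ R)^[r] fun u w =>
        (moebiusOp R)^[k₁] (truncPow (k₁ + l₁)) u * (moebiusOp R)^[k₂] (truncPow (k₂ + l₂)) w) := by
  have hU : 0 ≤ log R := log_nonneg hR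
  have hm := moebiusMass_nonneg
  have h1 := (nearConst_truncPow hR r l₁ l₂).iterate_moebiusConv (by positivity)
    (causal_truncPow l₁) k₁
  have h2 := h1.swap
  have e : (fun u w => (zetaOp₂ R)^[r]
      (fun u w => moebiusConv^[k₁] (truncPow l₁) u * truncPow l₂ w) w u) =
      (zetaOp₂ R)^[r] (fun u w => truncPow l₂ u * moebiusConv^[k₁] (truncPow l₁) w) := by
    ext u w
    rw [← zetaOp₂_iterate_swap]
    simp only [mul_comm]
  rw [e] at h2
  have h3 := h2.iterate_moebiusConv (by positivity) (causal_truncPow l₂) k₂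
  intro v w hv hw
  have h4 := h3 w v hw hv
  rw [mul_comm ((1 + w) ^ _)] at h4
  convert! h4 using 3
  rw [zetaOp₂_iterate_congr (U := log R) r (G := fun u w =>
    moebiusConv^[k₁] (truncPow l₁) u * moebiusConv^[k₂] (truncPow l₂) w) ?_ _ (by linarith) _
      (by linarith), ← zetaOp₂_iterate_swap]
  · simp only [mul_comm]
  · intro u hu w hw
    rw [moebiusOp_iterate_truncPow (by linarith) k₁ l₁ u hu,
      moebiusOp_iterate_truncPow (by linarith) k₂ l₂ w hw]

/-- Formal real combinations of pairs of positive integers under componentwise multiplication. -/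
abbrev PairAlg := MonoidAlgebra ℝ (ℕ+ × ℕ+)

namespace PairAlg

/-- Evaluation of a formal combination against a function. -/
noncomputable def pair (g : ℕ+ × ℕ+ → ℝ) (x : PairAlg) : ℝ := x.coeff.sum fun s c => c * g s

theorem pair_single (g : ℕ+ × ℕ+ → ℝ) (s : ℕ+ × ℕ+) (c : ℝ) :
    pair g (MonoidAlgebra.single s c) = c * g s :=
  Finsupp.sum_single_index (by simp)

theorem pair_add (g : ℕ+ × ℕ+ → ℝ) (x y : PairAlg) : pair g (x + y) = pair g x + pair g y :=
  Finsupp.sum_add_index' (by simp) (by intros; ring)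

theorem pair_zero (g : ℕ+ × ℕ+ → ℝ) : pair g 0 = 0 := by simp [pair]

/-- `pair` as an additive homomorphism. -/
noncomputable def pairHom (g : ℕ+ × ℕ+ → ℝ) : PairAlg →+ ℝ where
  toFun := pair g
  map_zero' := pair_zero g
  map_add' := pair_add g

theorem pair_sum {ι : Type*} (g : ℕ+ × ℕ+ → ℝ) (s : Finset ι) (x : ι → PairAlg) :
    pair g (∑ i ∈ s, x i) = ∑ i ∈ s, pair g (x i) := map_sum (pairHom g) x s

theorem pair_sub (g : ℕ+ × ℕ+ → ℝ) (x y : PairAlg) : pair g (x - y) = pair g x - pair g y :=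
  map_sub (pairHom g) x y

theorem pair_mul_single (g : ℕ+ × ℕ+ → ℝ) (x : PairAlg) (s : ℕ+ × ℕ+) (c : ℝ) :
    pair g (x * MonoidAlgebra.single s c) = c * pair (fun t => g (t * s)) x := by
  induction x using MonoidAlgebra.induction_linear with
  | zero => simp [pair_zero]
  | add x y hx hy => rw [add_mul, pair_add, pair_add, hx, hy, mul_add]
  | single t a => rw [MonoidAlgebra.single_mul_single, pair_single, pair_single]; ring

theorem pair_congr {g g' : ℕ+ × ℕ+ → ℝ} (h : ∀ s, g s = g' s) (x : PairAlg) :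
    pair g x = pair g' x := by rw [funext h]

theorem pair_fun_sum {ι : Type*} (s : Finset ι) (c : ι → ℝ) (g : ι → ℕ+ × ℕ+ → ℝ) (x : PairAlg) :
    pair (fun t => ∑ i ∈ s, c i * g i t) x = ∑ i ∈ s, c i * pair (g i) x := by
  simp only [pair, Finsupp.sum, Finset.mul_sum]
  rw [Finset.sum_comm]
  exact Finset.sum_congr rfl fun _ _ => Finset.sum_congr rfl fun _ _ => by ring

/-- The sum of the coefficients. -/
noncomputable def aug : PairAlg →ₐ[ℝ] ℝ := MonoidAlgebra.lift ℝ ℝ (ℕ+ × ℕ+) 1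

theorem aug_single (s : ℕ+ × ℕ+) (c : ℝ) : aug (MonoidAlgebra.single s c) = c := by
  simp [aug, MonoidAlgebra.lift_single]

theorem aug_apply (x : PairAlg) : aug x = x.coeff.sum fun _ c => c := by
  simp [aug, MonoidAlgebra.lift_apply]

/-- A submultiplicative weight of logarithmic size. -/
noncomputable def weight (s : ℕ+ × ℕ+) : ℝ :=
  (1 + log (s.1 : ℕ)) ^ (1 / 4 : ℝ) * (1 + log (s.2 : ℕ)) ^ (1 / 4 : ℝ)

theorem log_pnat_nonneg (n : ℕ+) : 0 ≤ log (n : ℕ) := log_natCast_nonneg _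

theorem weight_nonneg (s : ℕ+ × ℕ+) : 0 ≤ weight s := by
  have h1 := log_pnat_nonneg s.1
  have h2 := log_pnat_nonneg s.2
  unfold weight; positivity

theorem weight_one : weight 1 = 1 := by simp [weight]

theorem one_add_log_mul_rpow_le (m n : ℕ+) :
    (1 + log ((m * n : ℕ+) : ℕ)) ^ (1 / 4 : ℝ) ≤
      (1 + log (m : ℕ)) ^ (1 / 4 : ℝ) * (1 + log (n : ℕ)) ^ (1 / 4 : ℝ) := by
  have h1 := log_pnat_nonneg m
  have h2 := log_pnat_nonneg n
  rw [← mul_rpow (by linarith) (by linarith), PNat.mul_coe, Nat.cast_mul,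
    log_mul (by simp) (by simp)]
  exact rpow_le_rpow (by linarith) (by nlinarith) (by norm_num)

theorem weight_mul_le (s t : ℕ+ × ℕ+) : weight (s * t) ≤ weight s * weight t := by
  have h1 := one_add_log_mul_rpow_le s.1 t.1
  have h2 := one_add_log_mul_rpow_le s.2 t.2
  have h3 := log_pnat_nonneg (s.1 * t.1)
  have h4 := log_pnat_nonneg (s.2 * t.2)
  have h5 := log_pnat_nonneg s.1
  have h6 := log_pnat_nonneg t.1
  calc weight (s * t) ≤ ((1 + log (s.1 : ℕ)) ^ (1 / 4 : ℝ) * (1 + log (t.1 : ℕ)) ^ (1 / 4 : ℝ)) *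
        ((1 + log (s.2 : ℕ)) ^ (1 / 4 : ℝ) * (1 + log (t.2 : ℕ)) ^ (1 / 4 : ℝ)) :=
      mul_le_mul h1 h2 (by rw [Prod.snd_mul]; positivity) (by positivity)
    _ = _ := by unfold weight; ring

/-- The weighted `ℓ¹` norm. -/
noncomputable def nrm (x : PairAlg) : ℝ := x.coeff.sum fun s c => |c| * weight s

theorem nrm_nonneg (x : PairAlg) : 0 ≤ nrm x :=
  Finset.sum_nonneg fun s _ => mul_nonneg (abs_nonneg _) (weight_nonneg s)

theorem nrm_single (s : ℕ+ × ℕ+) (c : ℝ) : nrm (MonoidAlgebra.single s c) = |c| * weight s :=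
  Finsupp.sum_single_index (by simp)

theorem nrm_zero : nrm 0 = 0 := by simp [nrm]

theorem nrm_one : nrm 1 = 1 := by
  rw [MonoidAlgebra.one_def, nrm_single, weight_one]; simp

theorem nrm_add_le (x y : PairAlg) : nrm (x + y) ≤ nrm x + nrm y := by
  classical
  have h : ∀ z : PairAlg, z.coeff.support ⊆ x.coeff.support ∪ y.coeff.support →
      nrm z = ∑ s ∈ x.coeff.support ∪ y.coeff.support, |z.coeff s| * weight s := fun z hz =>
    Finsupp.sum_of_support_subset _ hz _ (by simp)
  rw [h (x + y) Finsupp.support_add, h x Finset.subset_union_left, h y Finset.subset_union_right,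
    ← Finset.sum_add_distrib]
  refine Finset.sum_le_sum fun s _ => ?_
  rw [← add_mul]
  exact mul_le_mul_of_nonneg_right (abs_add_le _ _) (weight_nonneg s)

theorem nrm_sum_le {ι : Type*} (s : Finset ι) (x : ι → PairAlg) :
    nrm (∑ i ∈ s, x i) ≤ ∑ i ∈ s, nrm (x i) :=
  Finset.le_sum_of_subadditive nrm nrm_zero.le nrm_add_le s x

theorem nrm_mul_le (x y : PairAlg) : nrm (x * y) ≤ nrm x * nrm y := by
  have e : x * y = ∑ s ∈ x.coeff.support, ∑ t ∈ y.coeff.support,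
      MonoidAlgebra.single (s * t) (x.coeff s * y.coeff t) := by
    conv_lhs => rw [← MonoidAlgebra.sum_coeff_single x, ← MonoidAlgebra.sum_coeff_single y]
    simp only [Finsupp.sum, Finset.sum_mul_sum, MonoidAlgebra.single_mul_single]
  rw [e]
  refine (nrm_sum_le _ _).trans ?_
  rw [nrm, nrm, Finsupp.sum, Finsupp.sum, Finset.sum_mul_sum]
  refine Finset.sum_le_sum fun s _ => (nrm_sum_le _ _).trans (Finset.sum_le_sum fun t _ => ?_)
  rw [nrm_single, abs_mul]
  calc _ ≤ |x.coeff s| * |y.coeff t| * (weight s * weight t) :=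
        mul_le_mul_of_nonneg_left (weight_mul_le s t) (by positivity)
    _ = _ := by ring

theorem nrm_neg (x : PairAlg) : nrm (-x) = nrm x := by
  simp [nrm, Finsupp.sum]

theorem nrm_sub_le (x y : PairAlg) : nrm (x - y) ≤ nrm x + nrm y := by
  rw [sub_eq_add_neg, ← nrm_neg y]; exact nrm_add_le _ _

theorem nrm_smul (c : ℝ) (x : PairAlg) : nrm (c • x) ≤ |c| * nrm x := by
  have : c • x = MonoidAlgebra.single 1 c * x := by
    rw [← smul_one_mul, MonoidAlgebra.one_def, MonoidAlgebra.smul_single, smul_eq_mul, mul_one]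
  rw [this]
  refine (nrm_mul_le _ _).trans (le_of_eq ?_)
  rw [nrm_single, weight_one, mul_one]

theorem nrm_pow_le (x : PairAlg) (n : ℕ) : nrm (x ^ n) ≤ nrm x ^ n := by
  induction n with
  | zero => simp [nrm_one]
  | succ n ih =>
    rw [pow_succ, pow_succ]
    exact (nrm_mul_le _ _).trans (mul_le_mul_of_nonneg_right ih (nrm_nonneg x))

theorem nrm_prod_le {ι : Type*} (s : Finset ι) (x : ι → PairAlg) :
    nrm (∏ i ∈ s, x i) ≤ ∏ i ∈ s, nrm (x i) := by
  classical
  induction s using Finset.induction_on with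
  | empty => simp [nrm_one]
  | insert i s hi ih =>
    rw [Finset.prod_insert hi, Finset.prod_insert hi]
    exact (nrm_mul_le _ _).trans (mul_le_mul_of_nonneg_left ih (nrm_nonneg _))

theorem abs_pair_sub_le {g : ℕ+ × ℕ+ → ℝ} {L E : ℝ} (h : ∀ s, |g s - L| ≤ E * weight s)
    (x : PairAlg) : |pair g x - aug x * L| ≤ E * nrm x := by
  rw [aug_apply, pair, nrm, Finsupp.sum, Finsupp.sum, Finsupp.sum, Finset.sum_mul, Finset.mul_sum,
    ← Finset.sum_sub_distrib]
  refine (Finset.abs_sum_le_sum_abs _ _).trans (Finset.sum_le_sum fun s _ => ?_)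
  rw [← mul_sub, abs_mul]
  calc _ ≤ |x.coeff s| * (E * weight s) := mul_le_mul_of_nonneg_left (h s) (abs_nonneg _)
    _ = _ := by ring

/-- The ideal generated by the pairs with a component exceeding `R`. -/
noncomputable def tailIdeal (R : ℝ) : Ideal PairAlg :=
  Ideal.span {x | ∃ s : ℕ+ × ℕ+, (R < (s.1 : ℕ) ∨ R < (s.2 : ℕ)) ∧ x = MonoidAlgebra.single s 1}

/-- Functions vanishing at the pairs with a component exceeding `R`. -/
def Truncated (R : ℝ) (g : ℕ+ × ℕ+ → ℝ) : Prop :=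
  ∀ s : ℕ+ × ℕ+, (R < (s.1 : ℕ) ∨ R < (s.2 : ℕ)) → g s = 0

theorem pair_eq_zero_of_mem {R : ℝ} {g : ℕ+ × ℕ+ → ℝ} (hg : Truncated R g) {x : PairAlg}
    (hx : x ∈ tailIdeal R) : pair g x = 0 := by
  suffices h : ∀ a, pair g (a * x) = 0 by simpa using h 1
  induction hx using Submodule.span_induction with
  | mem x hx =>
    obtain ⟨s, hs, rfl⟩ := hx
    intro a
    rw [pair_mul_single, pair_congr (g' := fun _ => 0)]
    · simp [pair]
    · refine fun t => hg _ (hs.imp (fun h => h.trans_le ?_) fun h => h.trans_le ?_)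
      · exact_mod_cast Nat.le_mul_of_pos_left _ t.1.pos
      · exact_mod_cast Nat.le_mul_of_pos_left _ t.2.pos
  | zero => simp [pair_zero]
  | add x y _ _ hx hy => intro a; rw [mul_add, pair_add, hx, hy, add_zero]
  | smul b x _ hx => intro a; rw [smul_eq_mul, ← mul_assoc]; exact hx _

/-- Reduction modulo `tailIdeal R`. -/
noncomputable abbrev red (R : ℝ) : PairAlg →+* PairAlg ⧸ tailIdeal R :=
  Ideal.Quotient.mk (tailIdeal R)

theorem pair_eq_of_red_eq {R : ℝ} {g : ℕ+ × ℕ+ → ℝ} (hg : Truncated R g) {x y : PairAlg}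
    (h : red R x = red R y) : pair g x = pair g y := by
  rw [← sub_eq_zero, ← pair_sub]
  exact pair_eq_zero_of_mem hg (Ideal.Quotient.eq.1 h)

theorem red_single_eq_zero {R : ℝ} {s : ℕ+ × ℕ+} (hs : R < (s.1 : ℕ) ∨ R < (s.2 : ℕ)) (c : ℝ) :
    red R (MonoidAlgebra.single s c) = 0 := by
  rw [Ideal.Quotient.eq_zero_iff_mem]
  have : (MonoidAlgebra.single s c : PairAlg) =
      MonoidAlgebra.single 1 c * MonoidAlgebra.single s 1 := by
    rw [MonoidAlgebra.single_mul_single, one_mul, mul_one]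
  rw [this]
  exact Ideal.mul_mem_left _ _ (Ideal.subset_span ⟨s, hs, rfl⟩)

/-- The element `[φ n] / n`. -/
noncomputable def emb (φ : ℕ+ →* ℕ+ × ℕ+) (n : ℕ) : PairAlg :=
  MonoidAlgebra.single (φ n.toPNat') (n : ℝ)⁻¹

theorem emb_zero (φ : ℕ+ →* ℕ+ × ℕ+) : emb φ 0 = 0 := by simp [emb]

theorem emb_one (φ : ℕ+ →* ℕ+ × ℕ+) : emb φ 1 = 1 := by
  have : Nat.toPNat' 1 = 1 := rfl
  simp [emb, MonoidAlgebra.one_def, this]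

theorem emb_mul (φ : ℕ+ →* ℕ+ × ℕ+) (m n : ℕ) : emb φ (m * n) = emb φ m * emb φ n := by
  rcases Nat.eq_zero_or_pos m with rfl | hm
  · simp [emb_zero]
  rcases Nat.eq_zero_or_pos n with rfl | hn
  · simp [emb_zero]
  have : (m * n).toPNat' = m.toPNat' * n.toPNat' := by
    apply PNat.eq
    rw [PNat.mul_coe, Nat.toPNat'_coe, Nat.toPNat'_coe, Nat.toPNat'_coe, if_pos hm, if_pos hn,
      if_pos (Nat.mul_pos hm hn)]
  rw [emb, emb, emb, MonoidAlgebra.single_mul_single, this, map_mul, Nat.cast_mul, mul_inv]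

theorem emb_pow (φ : ℕ+ →* ℕ+ × ℕ+) (m k : ℕ) : emb φ (m ^ k) = emb φ m ^ k := by
  induction k with
  | zero => simp [emb_one]
  | succ k ih => rw [pow_succ, pow_succ, emb_mul, ih]

theorem aug_emb (φ : ℕ+ →* ℕ+ × ℕ+) (n : ℕ) : aug (emb φ n) = (n : ℝ)⁻¹ := aug_single _ _

/-- Maps increasing at least one of the components. -/
def Expanding (φ : ℕ+ →* ℕ+ × ℕ+) : Prop := ∀ n, n ≤ (φ n).1 ∨ n ≤ (φ n).2

theorem red_emb_eq_zero {φ : ℕ+ →* ℕ+ × ℕ+} (hφ : Expanding φ) {R : ℝ} {n : ℕ} (hR : 0 ≤ R)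
    (hn : R < n) : red R (emb φ n) = 0 := by
  have hn0 : 0 < n := by exact_mod_cast hR.trans_lt hn
  refine red_single_eq_zero ((hφ n.toPNat').imp (fun h => hn.trans_le ?_)
    fun h => hn.trans_le ?_) _ <;>
  · have h2 := PNat.coe_le_coe _ _ |>.2 h
    rw [Nat.toPNat'_coe, if_pos hn0] at h2
    exact_mod_cast h2

/-- `emb φ` as an arithmetic function. -/
noncomputable def embFun (φ : ℕ+ →* ℕ+ × ℕ+) : ArithmeticFunction PairAlg := ⟨emb φ, emb_zero φ⟩

theorem isMultiplicative_embFun (φ : ℕ+ →* ℕ+ × ℕ+) : (embFun φ).IsMultiplicative :=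
  ⟨emb_one φ, fun _ => emb_mul φ _ _⟩

theorem primeFactors_prod_eq {P : Finset ℕ} (hP : ∀ p ∈ P, p.Prime) :
    (∏ p ∈ P, p).primeFactors = P := Nat.primeFactors_prod hP

theorem squarefree_prod_primes {P : Finset ℕ} (hP : ∀ p ∈ P, p.Prime) :
    Squarefree (∏ p ∈ P, p) := by
  refine Finset.squarefree_prod_of_pairwise_isCoprime (fun p hp q hq hpq => ?_)
    fun p hp => (hP p hp).squarefree
  exact Nat.coprime_iff_isRelPrime.1 ((Nat.coprime_primes (hP p hp) (hP q hq)).2 hpq)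

theorem prod_one_sub_emb (φ : ℕ+ →* ℕ+ × ℕ+) {P : Finset ℕ} (hP : ∀ p ∈ P, p.Prime) :
    ∏ p ∈ P, (1 - emb φ p) =
      ∑ d ∈ (∏ p ∈ P, p).divisors, (ArithmeticFunction.moebius d : PairAlg) * emb φ d := by
  have h := (isMultiplicative_embFun φ).prodPrimeFactors_one_sub_of_squarefree _
    (squarefree_prod_primes hP)
  rwa [primeFactors_prod_eq hP] at h

/-- The truncated Möbius sum `∑_{n ≤ R} μ(n) [φ n] / n`. -/
noncomputable def moebiusElt (R : ℝ) (φ : ℕ+ →* ℕ+ × ℕ+) : PairAlg :=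
  ∑ n ∈ Finset.Icc 1 ⌊R⌋₊, (ArithmeticFunction.moebius n : PairAlg) * emb φ n

/-- The truncated sum `∑_{n ≤ R} [φ n] / n`. -/
noncomputable def zetaElt (R : ℝ) (φ : ℕ+ →* ℕ+ × ℕ+) : PairAlg :=
  ∑ n ∈ Finset.Icc 1 ⌊R⌋₊, emb φ n

theorem dvd_prod_of_squarefree {P : Finset ℕ} {n : ℕ} (hn : Squarefree n)
    (h : ∀ p, p.Prime → p ∣ n → p ∈ P) : n ∣ ∏ p ∈ P, p := by
  rw [← Nat.prod_primeFactors_of_squarefree hn]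
  exact Finset.prod_dvd_prod_of_subset _ _ _ fun p hp =>
    h p (Nat.prime_of_mem_primeFactors hp) (Nat.dvd_of_mem_primeFactors hp)

theorem red_prod_one_sub_emb {φ : ℕ+ →* ℕ+ × ℕ+} (hφ : Expanding φ) {R : ℝ} (hR : 0 ≤ R)
    {P : Finset ℕ} (hP : ∀ p ∈ P, p.Prime) (hPR : ∀ p : ℕ, p.Prime → (p : ℝ) ≤ R → p ∈ P) :
    red R (∏ p ∈ P, (1 - emb φ p)) = red R (moebiusElt R φ) := by
  have hq : ∏ p ∈ P, p ≠ 0 := (squarefree_prod_primes hP).ne_zero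
  rw [prod_one_sub_emb φ hP, moebiusElt, map_sum, map_sum]
  have hboth : ∀ s : Finset ℕ, (∀ n ∈ s, n ∉ (∏ p ∈ P, p).divisors ∩ Finset.Icc 1 ⌊R⌋₊ →
      red R ((ArithmeticFunction.moebius n : PairAlg) * emb φ n) = 0) →
      (∏ p ∈ P, p).divisors ∩ Finset.Icc 1 ⌊R⌋₊ ⊆ s →
      ∑ n ∈ s, red R ((ArithmeticFunction.moebius n : PairAlg) * emb φ n) =
        ∑ n ∈ (∏ p ∈ P, p).divisors ∩ Finset.Icc 1 ⌊R⌋₊,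
          red R ((ArithmeticFunction.moebius n : PairAlg) * emb φ n) :=
    fun s h hs => (Finset.sum_subset hs h).symm
  rw [hboth _ ?_ Finset.inter_subset_left, hboth _ ?_ Finset.inter_subset_right]
  · intro n hn hn2
    have hn1 := (Finset.mem_Icc.1 hn)
    by_cases hsq : Squarefree n
    · refine absurd (Finset.mem_inter.2 ⟨Nat.mem_divisors.2
        ⟨dvd_prod_of_squarefree hsq fun p hp hpn => hPR p hp ?_, hq⟩, hn⟩) hn2
      exact (Nat.cast_le.2 (Nat.le_of_dvd hn1.1 hpn)).trans ((Nat.le_floor_iff hR).1 hn1.2)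
    · rw [ArithmeticFunction.moebius_eq_zero_of_not_squarefree hsq]; simp
  · intro n hn hn2
    rw [Finset.mem_inter, Finset.mem_Icc] at hn2
    rw [map_mul, red_emb_eq_zero hφ hR, mul_zero]
    by_contra h
    exact hn2 ⟨hn, Nat.pos_of_mem_divisors hn, Nat.le_floor (not_lt.1 h)⟩

theorem embFun_mul_pmul_moebius (φ : ℕ+ →* ℕ+ × ℕ+) :
    embFun φ * (ArithmeticFunction.pmul (ArithmeticFunction.moebius : ArithmeticFunction PairAlg)
      (embFun φ)) = 1 := by
  ext1 n
  have h := congrArg (fun f : ArithmeticFunction ℤ => ((f n : ℤ) : PairAlg))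
    ArithmeticFunction.coe_zeta_mul_moebius
  simp only [ArithmeticFunction.coe_zeta_mul_apply] at h
  rw [ArithmeticFunction.mul_apply]
  have e : ∀ x ∈ n.divisorsAntidiagonal, embFun φ x.1 *
      ArithmeticFunction.pmul (ArithmeticFunction.moebius : ArithmeticFunction PairAlg)
        (embFun φ) x.2 = emb φ n * (ArithmeticFunction.moebius x.2 : PairAlg) := fun x hx => by
    rw [ArithmeticFunction.pmul_apply, ArithmeticFunction.intCoe_apply,
      ← (Nat.mem_divisorsAntidiagonal.1 hx).1, emb_mul]
    change emb φ x.1 * (_ * emb φ x.2) = _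
    ring
  rw [Finset.sum_congr rfl e, ← Finset.mul_sum,
    Nat.sum_divisorsAntidiagonal' fun _ b => (ArithmeticFunction.moebius b : PairAlg),
    ← Int.cast_sum, h]
  by_cases hn : n = 1
  · subst hn; simp [emb_one]
  · simp [ArithmeticFunction.one_apply_ne hn]

theorem red_zetaElt_mul_moebiusElt {φ : ℕ+ →* ℕ+ × ℕ+} (hφ : Expanding φ) {R : ℝ} (hR : 1 ≤ R) :
    red R (zetaElt R φ) * red R (moebiusElt R φ) = 1 := by
  have h := ArithmeticFunction.sum_Ioc_mul_eq_sum_prod_filter (embFun φ)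
    (ArithmeticFunction.pmul (ArithmeticFunction.moebius : ArithmeticFunction PairAlg)
      (embFun φ)) ⌊R⌋₊
  rw [embFun_mul_pmul_moebius] at h
  have h1 : ∑ n ∈ Finset.Ioc 0 ⌊R⌋₊, (1 : ArithmeticFunction PairAlg) n = 1 := by
    rw [Finset.sum_eq_single 1]
    · simp
    · intro n _ hn; exact ArithmeticFunction.one_apply_ne hn
    · intro h; exact absurd (Finset.mem_Ioc.2 ⟨one_pos, Nat.floor_pos.2 hR⟩) h
  rw [h1] at h
  rw [← map_mul, zetaElt, moebiusElt, Finset.sum_mul_sum, ← Finset.sum_product', ← map_one (red R),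
    h, map_sum, map_sum]
  symm
  have hI : Finset.Ioc 0 ⌊R⌋₊ = Finset.Icc 1 ⌊R⌋₊ := rfl
  rw [hI]
  refine Finset.sum_subset (Finset.filter_subset _ _) fun x hx hx2 => ?_
  rw [Finset.mem_filter, not_and] at hx2
  have hlt : R < (x.1 * x.2 : ℕ) := (Nat.floor_lt (by linarith)).1 (not_le.1 (hx2 hx))
  rw [ArithmeticFunction.pmul_apply, ArithmeticFunction.intCoe_apply]
  change red R (emb φ x.1 * (_ * emb φ x.2)) = 0
  rw [mul_left_comm, ← emb_mul, map_mul, red_emb_eq_zero hφ (by linarith) hlt, mul_zero]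

theorem nrm_natCast_mul_le (k : ℕ) (x : PairAlg) : nrm ((k : PairAlg) * x) ≤ k * nrm x := by
  rw [← nsmul_eq_mul, ← Nat.cast_smul_eq_nsmul ℝ]
  exact (nrm_smul _ _).trans_eq (by rw [abs_of_nonneg (Nat.cast_nonneg k)])

theorem nrm_smul_le_mul {c B t : ℝ} {x : PairAlg} (hc : 0 ≤ c) (hB : c ≤ B) (hx : nrm x ≤ t) :
    nrm (c • x) ≤ B * t := by
  refine (nrm_smul c x).trans ?_
  rw [abs_of_nonneg hc]
  exact mul_le_mul hB hx (nrm_nonneg x) (hc.trans hB)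

theorem nrm_mul_le_of_le {x y : PairAlg} {a b : ℝ} (hx : nrm x ≤ a) (hy : nrm y ≤ b) :
    nrm (x * y) ≤ a * b :=
  (nrm_mul_le x y).trans (mul_le_mul hx hy (nrm_nonneg y) ((nrm_nonneg x).trans hx))

theorem nrm_add_le_of_le {x y : PairAlg} {a b : ℝ} (hx : nrm x ≤ a) (hy : nrm y ≤ b) :
    nrm (x + y) ≤ a + b := (nrm_add_le x y).trans (add_le_add hx hy)

theorem nrm_sub_le_of_le {x y : PairAlg} {a b : ℝ} (hx : nrm x ≤ a) (hy : nrm y ≤ b) :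
    nrm (x - y) ≤ a + b := (nrm_sub_le x y).trans (add_le_add hx hy)

theorem nrm_one_sub_pow_le {x : PairAlg} (hx : nrm x ≤ 1) {r M : ℕ} (hr : r ≤ M) :
    nrm ((1 - x) ^ r) ≤ 2 ^ M := by
  have h : nrm (1 - x) ≤ 2 := (nrm_sub_le_of_le nrm_one.le hx).trans (by norm_num)
  calc _ ≤ nrm (1 - x) ^ r := nrm_pow_le _ _
    _ ≤ 2 ^ r := pow_le_pow_left₀ (nrm_nonneg _) h r
    _ ≤ _ := pow_le_pow_right₀ (by norm_num) hr

theorem nrm_one_sub_pow_sub_le {x : PairAlg} {t : ℝ} (hx : nrm x ≤ t) (ht : t ≤ 1) (r : ℕ) :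
    nrm ((1 - x) ^ r - 1 + (r : PairAlg) * x) ≤ 4 ^ r * t ^ 2 := by
  have h0 := (nrm_nonneg x).trans hx
  induction r with
  | zero => simpa [nrm_zero] using sq_nonneg t
  | succ r ih =>
    have e : (1 - x) ^ (r + 1) - 1 + ((r + 1 : ℕ) : PairAlg) * x =
        ((1 - x) ^ r - 1 + (r : PairAlg) * x) * (1 - x) + (r : PairAlg) * (x * x) := by
      push_cast; ring
    have h1 : nrm (1 - x) ≤ 2 := (nrm_sub_le_of_le nrm_one.le hx).trans (by linarith)
    have h2 := (nrm_natCast_mul_le r (x * x)).trans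
      (mul_le_mul_of_nonneg_left (nrm_mul_le_of_le hx hx) (Nat.cast_nonneg r))
    have h3 : (r : ℝ) ≤ 4 ^ r := by exact_mod_cast (Nat.lt_pow_self (by norm_num)).le
    rw [e]
    refine (nrm_add_le_of_le (nrm_mul_le_of_le ih h1) h2).trans ?_
    rw [pow_succ (4 : ℝ) r]
    nlinarith [mul_nonneg (sub_nonneg.2 h3) (sq_nonneg t),
      mul_nonneg (pow_pos (show (0 : ℝ) < 4 by norm_num) r).le (sq_nonneg t)]

/-- The local numerator `1 - v₁ x - v₂ y + w z`. -/
noncomputable def numer (v₁ v₂ w : ℝ) (x y z : PairAlg) : PairAlg :=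
  1 - v₁ • x - v₂ • y + w • z

theorem nrm_remainder₁_le {M k₁ k₂ : ℕ} (h₁ : k₁ ≤ M) (h₂ : k₂ ≤ M) {x y : PairAlg} {t : ℝ}
    (hx : nrm x ≤ t) (hy : nrm y ≤ t) (ht : t ≤ 1) :
    nrm ((1 - x) ^ k₁ * (1 - y) ^ k₂ - 1 + ((k₁ : PairAlg) * x + (k₂ : PairAlg) * y)) ≤
      (M ^ 2 + 8 ^ M + (1 + M) * 4 ^ M) * t ^ 2 := by
  have h0 := (nrm_nonneg x).trans hx
  have hM₁ : (k₁ : ℝ) ≤ M := by exact_mod_cast h₁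
  have hM₂ : (k₂ : ℝ) ≤ M := by exact_mod_cast h₂
  have e : (1 - x) ^ k₁ * (1 - y) ^ k₂ - 1 + ((k₁ : PairAlg) * x + (k₂ : PairAlg) * y) =
      ((k₁ : PairAlg) * x) * ((k₂ : PairAlg) * y) +
        ((1 - x) ^ k₁ - 1 + (k₁ : PairAlg) * x) * (1 - y) ^ k₂ +
        (1 - (k₁ : PairAlg) * x) * ((1 - y) ^ k₂ - 1 + (k₂ : PairAlg) * y) := by ring
  have a1 : nrm ((k₁ : PairAlg) * x) ≤ M * t :=
    (nrm_natCast_mul_le _ _).trans (mul_le_mul hM₁ hx (nrm_nonneg _) (by positivity))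
  have a2 : nrm ((k₂ : PairAlg) * y) ≤ M * t :=
    (nrm_natCast_mul_le _ _).trans (mul_le_mul hM₂ hy (nrm_nonneg _) (by positivity))
  have p1 : (4 : ℝ) ^ k₁ ≤ 4 ^ M := pow_le_pow_right₀ (by norm_num) h₁
  have p2 : (4 : ℝ) ^ k₂ ≤ 4 ^ M := pow_le_pow_right₀ (by norm_num) h₂
  have b1 := (nrm_one_sub_pow_sub_le hx ht k₁).trans (mul_le_mul_of_nonneg_right p1 (sq_nonneg t))
  have b2 := (nrm_one_sub_pow_sub_le hy ht k₂).trans (mul_le_mul_of_nonneg_right p2 (sq_nonneg t))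
  have c1 : nrm (1 - (k₁ : PairAlg) * x) ≤ 1 + M :=
    (nrm_sub_le_of_le nrm_one.le a1).trans (by nlinarith [Nat.cast_nonneg (α := ℝ) M])
  rw [e]
  refine (nrm_add_le_of_le (nrm_add_le_of_le (nrm_mul_le_of_le a1 a2)
    (nrm_mul_le_of_le b1 (nrm_one_sub_pow_le (hy.trans ht) h₂)))
    (nrm_mul_le_of_le c1 b2)).trans (le_of_eq ?_)
  rw [show (8 : ℝ) = 4 * 2 by norm_num, mul_pow]
  ring

theorem nrm_remainder₂_le {M r : ℕ} (hr : r ≤ M) {v₁ v₂ w : ℝ} (hv₁ : 0 ≤ v₁) (hv₁' : v₁ ≤ M)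
    (hv₂ : 0 ≤ v₂) (hv₂' : v₂ ≤ M) (hw : 0 ≤ w) (hw' : w ≤ M) {x y z : PairAlg} {t : ℝ}
    (hx : nrm x ≤ t) (hy : nrm y ≤ t) (hz : nrm z ≤ t) (ht : t ≤ 1) :
    nrm (numer v₁ v₂ w x y z * (1 - z) ^ r - 1 + (v₁ • x + v₂ • y - w • z + (r : PairAlg) * z)) ≤
      (3 * M ^ 2 + (1 + 3 * M) * 4 ^ M) * t ^ 2 := by
  have h0 := (nrm_nonneg x).trans hx
  have hMr : (r : ℝ) ≤ M := by exact_mod_cast hr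
  have e : numer v₁ v₂ w x y z * (1 - z) ^ r - 1 +
        (v₁ • x + v₂ • y - w • z + (r : PairAlg) * z) =
      (v₁ • x + v₂ • y - w • z) * ((r : PairAlg) * z) +
        (1 - (v₁ • x + v₂ • y - w • z)) * ((1 - z) ^ r - 1 + (r : PairAlg) * z) := by
    unfold numer; ring
  have a1 : nrm (v₁ • x + v₂ • y - w • z) ≤ M * t + M * t + M * t :=
    nrm_sub_le_of_le (nrm_add_le_of_le (nrm_smul_le_mul hv₁ hv₁' hx) (nrm_smul_le_mul hv₂ hv₂' hy))
      (nrm_smul_le_mul hw hw' hz)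
  have a2 : nrm ((r : PairAlg) * z) ≤ M * t :=
    (nrm_natCast_mul_le _ _).trans (mul_le_mul hMr hz (nrm_nonneg _) (by positivity))
  have a3 : nrm (1 - (v₁ • x + v₂ • y - w • z)) ≤ 1 + 3 * M :=
    (nrm_sub_le_of_le nrm_one.le a1).trans (by nlinarith [Nat.cast_nonneg (α := ℝ) M])
  have b1 := (nrm_one_sub_pow_sub_le hz ht r).trans (mul_le_mul_of_nonneg_right
    (pow_le_pow_right₀ (by norm_num : (1 : ℝ) ≤ 4) hr) (sq_nonneg t))
  rw [e]
  refine (nrm_add_le_of_le (nrm_mul_le_of_le a1 a2) (nrm_mul_le_of_le a3 b1)).trans (le_of_eq ?_)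
  ring

/-- The deviation of the local numerator from its model. -/
noncomputable def deviation (k₁ k₂ r : ℕ) (v₁ v₂ w : ℝ) (x y z : PairAlg) : PairAlg :=
  numer v₁ v₂ w x y z * (1 - z) ^ r - (1 - x) ^ k₁ * (1 - y) ^ k₂

/-- A constant controlling `deviation`. -/
noncomputable def devConst (M : ℕ) : ℝ :=
  (M ^ 2 + 8 ^ M + (1 + M) * 4 ^ M) + (3 * M ^ 2 + (1 + 3 * M) * 4 ^ M) + 6 * M

theorem devConst_nonneg (M : ℕ) : 0 ≤ devConst M := by unfold devConst; positivity

theorem nrm_deviation_le_sq {M k₁ k₂ r : ℕ} (h₁ : k₁ ≤ M) (h₂ : k₂ ≤ M) (hr : r ≤ M)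
    {x y z : PairAlg} {t : ℝ} (hx : nrm x ≤ t) (hy : nrm y ≤ t) (hz : nrm z ≤ t) (ht : t ≤ 1) :
    nrm (deviation k₁ k₂ r k₁ k₂ r x y z) ≤ devConst M * t ^ 2 := by
  have a := nrm_remainder₁_le h₁ h₂ hx hy ht
  have b := nrm_remainder₂_le hr (Nat.cast_nonneg k₁) (by exact_mod_cast h₁) (Nat.cast_nonneg k₂)
    (by exact_mod_cast h₂) (Nat.cast_nonneg r) (by exact_mod_cast hr) hx hy hz ht
  have e : deviation k₁ k₂ r k₁ k₂ r x y z =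
      (numer k₁ k₂ r x y z * (1 - z) ^ r - 1 +
        ((k₁ : ℝ) • x + (k₂ : ℝ) • y - (r : ℝ) • z + (r : PairAlg) * z)) -
      ((1 - x) ^ k₁ * (1 - y) ^ k₂ - 1 + ((k₁ : PairAlg) * x + (k₂ : PairAlg) * y)) := by
    simp only [Nat.cast_smul_eq_nsmul, nsmul_eq_mul, deviation]; ring
  rw [e]
  refine (nrm_sub_le_of_le b a).trans ?_
  have : 0 ≤ 6 * (M : ℝ) * t ^ 2 := by positivity
  unfold devConst; linarith

theorem nrm_deviation_le {M k₁ k₂ r : ℕ} (h₁ : k₁ ≤ M) (h₂ : k₂ ≤ M) (hr : r ≤ M)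
    {v₁ v₂ w : ℝ} (hv₁ : 0 ≤ v₁) (hv₁' : v₁ ≤ M)
    (hv₂ : 0 ≤ v₂) (hv₂' : v₂ ≤ M) (hw : 0 ≤ w) (hw' : w ≤ M)
    {x y z : PairAlg} {t : ℝ} (hx : nrm x ≤ t) (hy : nrm y ≤ t) (hz : nrm z ≤ t) (ht : t ≤ 1) :
    nrm (deviation k₁ k₂ r v₁ v₂ w x y z) ≤ devConst M * t := by
  have h0 := (nrm_nonneg x).trans hx
  have a := nrm_remainder₁_le h₁ h₂ hx hy ht
  have b := nrm_remainder₂_le hr hv₁ hv₁' hv₂ hv₂' hw hw' hx hy hz ht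
  have lin : ∀ (k : ℕ) (u : PairAlg), k ≤ M → nrm u ≤ t → nrm ((k : PairAlg) * u) ≤ M * t :=
    fun k u hk hu => (nrm_natCast_mul_le _ _).trans
      (mul_le_mul (by exact_mod_cast hk) hu (nrm_nonneg _) (by positivity))
  have e : deviation k₁ k₂ r v₁ v₂ w x y z =
      (numer v₁ v₂ w x y z * (1 - z) ^ r - 1 + (v₁ • x + v₂ • y - w • z + (r : PairAlg) * z)) -
      ((1 - x) ^ k₁ * (1 - y) ^ k₂ - 1 + ((k₁ : PairAlg) * x + (k₂ : PairAlg) * y)) +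
      (((k₁ : PairAlg) * x + (k₂ : PairAlg) * y) -
        (v₁ • x + v₂ • y - w • z + (r : PairAlg) * z)) := by
    unfold deviation; ring
  rw [e]
  refine (nrm_add_le_of_le (nrm_sub_le_of_le b a) (nrm_sub_le_of_le
    (nrm_add_le_of_le (lin _ _ h₁ hx) (lin _ _ h₂ hy)) (nrm_add_le_of_le (nrm_sub_le_of_le
    (nrm_add_le_of_le (nrm_smul_le_mul hv₁ hv₁' hx) (nrm_smul_le_mul hv₂ hv₂' hy))
    (nrm_smul_le_mul hw hw' hz)) (lin _ _ hr hz)))).trans ?_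
  have ht2 : t ^ 2 ≤ t := by nlinarith
  have k1 := mul_le_mul_of_nonneg_left ht2
    (show 0 ≤ (M : ℝ) ^ 2 + 8 ^ M + (1 + M) * 4 ^ M by positivity)
  have k2 := mul_le_mul_of_nonneg_left ht2
    (show 0 ≤ (3 : ℝ) * M ^ 2 + (1 + 3 * M) * 4 ^ M by positivity)
  unfold devConst; linarith

/-- A truncated inverse of `1 - x` with a prescribed last coefficient. -/
noncomputable def geomInv (c : ℝ) (J : ℕ) (x : PairAlg) : PairAlg :=
  ∑ j ∈ Finset.range J, x ^ j + c • x ^ J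

theorem nrm_geomInv_le {c : ℝ} (hc : 0 ≤ c) (hc2 : c ≤ 2) (J : ℕ) {x : PairAlg}
    (hx : nrm x ≤ 3 / 4) : nrm (geomInv c J x) ≤ 6 := by
  have h1 : nrm (∑ j ∈ Finset.range J, x ^ j) ≤ 4 := by
    refine (nrm_sum_le _ _).trans ?_
    calc _ ≤ ∑ j ∈ Finset.range J, (3 / 4 : ℝ) ^ j := Finset.sum_le_sum fun j _ =>
          (nrm_pow_le _ _).trans (pow_le_pow_left₀ (nrm_nonneg _) hx j)
      _ ≤ ∑' j, (3 / 4 : ℝ) ^ j := (summable_geometric_of_lt_one (by norm_num)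
          (by norm_num)).sum_le_tsum _ fun _ _ => by positivity
      _ = 4 := by rw [tsum_geometric_of_lt_one (by norm_num) (by norm_num)]; norm_num
  have h2 : nrm (x ^ J) ≤ 1 := (nrm_pow_le _ _).trans
    (pow_le_one₀ (nrm_nonneg _) (hx.trans (by norm_num)))
  exact (nrm_add_le_of_le h1 (nrm_smul_le_mul hc hc2 h2)).trans (by norm_num)

theorem aug_geomInv {a : ℝ} (ha : a ≠ 1) (J : ℕ) {x : PairAlg} (hx : aug x = a) :
    aug (geomInv (1 - a)⁻¹ J x) = (1 - a)⁻¹ := by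
  have h1 : 1 - a ≠ 0 := sub_ne_zero.2 ha.symm
  have h2 : a - 1 ≠ 0 := sub_ne_zero.2 ha
  simp only [geomInv, map_add, map_sum, map_pow, map_smul, hx, smul_eq_mul]
  rw [geom_sum_eq ha]
  field_simp
  ring

theorem red_one_sub_mul_geomInv {R : ℝ} {J : ℕ} {x : PairAlg} (hx : red R (x ^ J) = 0) (c : ℝ) :
    red R (1 - x) * red R (geomInv c J x) = 1 := by
  have e : (1 - x) * geomInv c J x = 1 - x ^ J + MonoidAlgebra.single 1 c * (1 - x) * x ^ J := by
    have : c • x ^ J = MonoidAlgebra.single 1 c * x ^ J := by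
      rw [← smul_one_mul, MonoidAlgebra.one_def, MonoidAlgebra.smul_single, smul_eq_mul, mul_one]
    rw [geomInv, this, mul_add, mul_neg_geom_sum]; ring
  rw [← map_mul, e, map_add, map_sub, map_mul, hx, map_one]; simp

/-- The local correction factor. -/
noncomputable def corr (J k₁ k₂ r : ℕ) (c v₁ v₂ w : ℝ) (x y z : PairAlg) : PairAlg :=
  1 + deviation k₁ k₂ r v₁ v₂ w x y z * (geomInv c J x ^ k₁ * geomInv c J y ^ k₂)

theorem red_corr {R : ℝ} {J : ℕ} {x y : PairAlg} (hx : red R (x ^ J) = 0) (hy : red R (y ^ J) = 0)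
    (k₁ k₂ r : ℕ) (c v₁ v₂ w : ℝ) (z : PairAlg) :
    red R (numer v₁ v₂ w x y z * (1 - z) ^ r) =
      red R (corr J k₁ k₂ r c v₁ v₂ w x y z * ((1 - x) ^ k₁ * (1 - y) ^ k₂)) := by
  have a : red R (1 - x) ^ k₁ * red R (geomInv c J x) ^ k₁ = 1 := by
    rw [← mul_pow, red_one_sub_mul_geomInv hx, one_pow]
  have b : red R (1 - y) ^ k₂ * red R (geomInv c J y) ^ k₂ = 1 := by
    rw [← mul_pow, red_one_sub_mul_geomInv hy, one_pow]
  have e : numer v₁ v₂ w x y z * (1 - z) ^ r =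
      deviation k₁ k₂ r v₁ v₂ w x y z + (1 - x) ^ k₁ * (1 - y) ^ k₂ := by
    unfold deviation; ring
  rw [e, corr, add_mul, one_mul, map_add, map_add, add_comm]
  congr 1
  simp only [map_mul, map_pow]
  linear_combination (-red R (deviation k₁ k₂ r v₁ v₂ w x y z)) *
    (red R (1 - y) ^ k₂ * red R (geomInv c J y) ^ k₂ * a + b)

theorem aug_corr {a : ℝ} (ha : a ≠ 1) (J : ℕ) {x y z : PairAlg} (hx : aug x = a) (hy : aug y = a)
    (hz : aug z = a) {k₁ k₂ r k : ℕ} (hk : k + r = k₁ + k₂) {v₁ v₂ w v : ℝ}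
    (hv : v + w = v₁ + v₂) :
    aug (corr J k₁ k₂ r (1 - a)⁻¹ v₁ v₂ w x y z) = (1 - v * a) * ((1 - a) ^ k)⁻¹ := by
  have h1 : 1 - a ≠ 0 := sub_ne_zero.2 ha.symm
  simp only [corr, deviation, numer, map_add, map_mul, map_sub, map_pow, map_one, map_smul,
    aug_geomInv ha J hx, aug_geomInv ha J hy, hx, hy, hz, smul_eq_mul]
  have e : (1 - a)⁻¹ ^ k₁ * (1 - a)⁻¹ ^ k₂ = (1 - a)⁻¹ ^ k * (1 - a)⁻¹ ^ r := by
    rw [← pow_add, ← pow_add, hk]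
  have f1 : (1 - a) ^ k₁ * (1 - a) ^ k₂ * ((1 - a)⁻¹ ^ k₁ * (1 - a)⁻¹ ^ k₂) = 1 := by
    rw [← pow_add, ← pow_add, ← mul_pow, mul_inv_cancel₀ h1, one_pow]
  have f2 : (1 - a) ^ r * (1 - a)⁻¹ ^ r = 1 := by
    rw [← mul_pow, mul_inv_cancel₀ h1, one_pow]
  rw [sub_mul, f1, e, ← inv_pow]
  have hw : v = v₁ + v₂ - w := by linarith
  rw [hw]
  linear_combination (1 - v₁ * a - v₂ * a + w * a) * (1 - a)⁻¹ ^ k * f2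

theorem nrm_corr_le {J k₁ k₂ r M : ℕ} (h₁ : k₁ ≤ M) (h₂ : k₂ ≤ M) {c v₁ v₂ w D : ℝ}
    (hc : 0 ≤ c) (hc2 : c ≤ 2) {x y z : PairAlg} (hx : nrm x ≤ 3 / 4) (hy : nrm y ≤ 3 / 4)
    (hD : nrm (deviation k₁ k₂ r v₁ v₂ w x y z) ≤ D) :
    nrm (corr J k₁ k₂ r c v₁ v₂ w x y z) ≤ 1 + D * 36 ^ M := by
  have h : ∀ (u : PairAlg) (k : ℕ), nrm u ≤ 3 / 4 → k ≤ M → nrm (geomInv c J u ^ k) ≤ 6 ^ M :=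
    fun u k hu hk => ((nrm_pow_le _ _).trans (pow_le_pow_left₀ (nrm_nonneg _)
      (nrm_geomInv_le hc hc2 J hu) k)).trans (pow_le_pow_right₀ (by norm_num) hk)
  refine (nrm_add_le_of_le nrm_one.le (nrm_mul_le_of_le hD
    (nrm_mul_le_of_le (h x k₁ hx h₁) (h y k₂ hy h₂)))).trans_eq ?_
  rw [← mul_pow]; norm_num

/-- The embedding in the first component. -/
abbrev fstHom : ℕ+ →* ℕ+ × ℕ+ := MonoidHom.inl ℕ+ ℕ+

/-- The embedding in the second component. -/
abbrev sndHom : ℕ+ →* ℕ+ × ℕ+ := MonoidHom.inr ℕ+ ℕ+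

/-- The diagonal embedding. -/
abbrev diagHom : ℕ+ →* ℕ+ × ℕ+ := (MonoidHom.id ℕ+).prod (MonoidHom.id ℕ+)

theorem expanding_fstHom : Expanding fstHom := fun _ => Or.inl le_rfl

theorem expanding_sndHom : Expanding sndHom := fun _ => Or.inr le_rfl

theorem expanding_diagHom : Expanding diagHom := fun _ => Or.inl le_rfl

/-- The local variables and factors of a two-dimensional sieve problem at `p`. -/
noncomputable def numerAt (v₁ v₂ w : ℕ → ℝ) (p : ℕ) : PairAlg :=
  numer (v₁ p) (v₂ p) (w p) (emb fstHom p) (emb sndHom p) (emb diagHom p)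

/-- The local correction factor at `p`. -/
noncomputable def corrAt (J k₁ k₂ r : ℕ) (v₁ v₂ w : ℕ → ℝ) (p : ℕ) : PairAlg :=
  corr J k₁ k₂ r (1 - (p : ℝ)⁻¹)⁻¹ (v₁ p) (v₂ p) (w p)
    (emb fstHom p) (emb sndHom p) (emb diagHom p)

theorem red_emb_pow_eq_zero {φ : ℕ+ →* ℕ+ × ℕ+} (hφ : Expanding φ) {R : ℝ} (hR : 0 ≤ R) {J p : ℕ}
    (hJ : R < 2 ^ J) (hp : p.Prime) : red R (emb φ p ^ J) = 0 := by
  rw [← emb_pow]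
  refine red_emb_eq_zero hφ hR (hJ.trans_le ?_)
  push_cast
  exact pow_le_pow_left₀ (by norm_num) (by exact_mod_cast hp.two_le) J

theorem red_prod_numerAt {R : ℝ} (hR : 1 ≤ R) {P : Finset ℕ} (hP : ∀ p ∈ P, p.Prime)
    (hPR : ∀ p : ℕ, p.Prime → (p : ℝ) ≤ R → p ∈ P) {J : ℕ} (hJ : R < 2 ^ J) (k₁ k₂ r : ℕ)
    (v₁ v₂ w : ℕ → ℝ) :
    red R (∏ p ∈ P, numerAt v₁ v₂ w p) = red R ((∏ p ∈ P, corrAt J k₁ k₂ r v₁ v₂ w p) *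
      zetaElt R diagHom ^ r * moebiusElt R sndHom ^ k₂ * moebiusElt R fstHom ^ k₁) := by
  have hR0 : 0 ≤ R := by linarith
  have e1 := red_prod_one_sub_emb expanding_fstHom hR0 hP hPR
  have e2 := red_prod_one_sub_emb expanding_sndHom hR0 hP hPR
  have e3 := red_prod_one_sub_emb expanding_diagHom hR0 hP hPR
  have e4 := red_zetaElt_mul_moebiusElt expanding_diagHom hR
  have key : red R (∏ p ∈ P, numerAt v₁ v₂ w p) * red R (moebiusElt R diagHom) ^ r =
      red R (∏ p ∈ P, corrAt J k₁ k₂ r v₁ v₂ w p) *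
        (red R (moebiusElt R fstHom) ^ k₁ * red R (moebiusElt R sndHom) ^ k₂) := by
    rw [← e1, ← e2, ← e3]
    simp only [map_prod, ← Finset.prod_pow, ← Finset.prod_mul_distrib, ← map_pow, ← map_mul]
    exact Finset.prod_congr rfl fun p hp => red_corr
      (red_emb_pow_eq_zero expanding_fstHom hR0 hJ (hP p hp))
      (red_emb_pow_eq_zero expanding_sndHom hR0 hJ (hP p hp)) k₁ k₂ r _ _ _ _ _
  have e5 : red R (zetaElt R diagHom) ^ r * red R (moebiusElt R diagHom) ^ r = 1 := by
    rw [← mul_pow, e4, one_pow]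
  simp only [map_mul, map_pow] at key ⊢
  linear_combination (red R (zetaElt R diagHom) ^ r) * key -
    red R (∏ p ∈ P, numerAt v₁ v₂ w p) * e5

/-- The function on pairs induced by a function of the logarithms. -/
noncomputable def ofLog (U : ℝ) (F : ℝ → ℝ → ℝ) (s : ℕ+ × ℕ+) : ℝ :=
  F (U - log (s.1 : ℕ)) (U - log (s.2 : ℕ))

theorem pair_mul_emb (g : ℕ+ × ℕ+ → ℝ) (x : PairAlg) (φ : ℕ+ →* ℕ+ × ℕ+) (n : ℕ) :
    pair g (x * emb φ n) = 1 / (n : ℝ) * pair (fun t => g (t * φ n.toPNat')) x := by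
  rw [emb, pair_mul_single, one_div]

theorem pair_intCast_mul (g : ℕ+ × ℕ+ → ℝ) (m : ℤ) (x : PairAlg) :
    pair g ((m : PairAlg) * x) = m * pair g x := by
  rw [← zsmul_eq_mul, ← zsmul_eq_mul]
  exact map_zsmul (pairHom g) m x

theorem pair_mul_moebiusElt (g : ℕ+ × ℕ+ → ℝ) (x : PairAlg) (φ : ℕ+ →* ℕ+ × ℕ+) (R : ℝ) :
    pair g (x * moebiusElt R φ) = pair (fun t => ∑ n ∈ Finset.Icc 1 ⌊R⌋₊,
      (ArithmeticFunction.moebius n : ℝ) / n * g (t * φ n.toPNat')) x := by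
  rw [moebiusElt, Finset.mul_sum, pair_sum, pair_fun_sum]
  refine Finset.sum_congr rfl fun n _ => ?_
  rw [mul_left_comm, pair_intCast_mul, pair_mul_emb]
  ring

theorem pair_mul_zetaElt (g : ℕ+ × ℕ+ → ℝ) (x : PairAlg) (φ : ℕ+ →* ℕ+ × ℕ+) (R : ℝ) :
    pair g (x * zetaElt R φ) = pair (fun t => ∑ n ∈ Finset.Icc 1 ⌊R⌋₊,
      1 / (n : ℝ) * g (t * φ n.toPNat')) x := by
  rw [zetaElt, Finset.mul_sum, pair_sum, pair_fun_sum]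
  exact Finset.sum_congr rfl fun n _ => pair_mul_emb _ _ _ _

theorem sub_log_mul (U : ℝ) (a : ℕ+) {n N : ℕ} (hn : n ∈ Finset.Icc 1 N) :
    U - log ((a * n.toPNat' : ℕ+) : ℕ) = U - log (a : ℕ) - log n := by
  have h : 0 < n := (Finset.mem_Icc.1 hn).1
  rw [PNat.mul_coe, Nat.cast_mul, Nat.toPNat'_coe, if_pos h, log_mul (by simp)
    (by exact_mod_cast h.ne')]
  ring

theorem pair_ofLog_mul_moebiusElt_fst (U R : ℝ) (f g : ℝ → ℝ) (x : PairAlg) :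
    pair (ofLog U fun u w => f u * g w) (x * moebiusElt R fstHom) =
      pair (ofLog U fun u w => moebiusOp R f u * g w) x := by
  rw [pair_mul_moebiusElt]
  refine pair_congr (fun t => ?_) x
  simp only [ofLog, moebiusOp, Finset.sum_mul]
  refine Finset.sum_congr rfl fun n hn => ?_
  simp only [Prod.fst_mul, Prod.snd_mul, MonoidHom.inl_apply, mul_one, sub_log_mul U t.1 hn]
  ring

theorem pair_ofLog_mul_moebiusElt_snd (U R : ℝ) (f g : ℝ → ℝ) (x : PairAlg) :
    pair (ofLog U fun u w => f u * g w) (x * moebiusElt R sndHom) =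
      pair (ofLog U fun u w => f u * moebiusOp R g w) x := by
  rw [pair_mul_moebiusElt]
  refine pair_congr (fun t => ?_) x
  simp only [ofLog, moebiusOp, Finset.mul_sum]
  refine Finset.sum_congr rfl fun n hn => ?_
  simp only [Prod.fst_mul, Prod.snd_mul, MonoidHom.inr_apply, mul_one, sub_log_mul U t.2 hn]
  ring

theorem pair_ofLog_mul_zetaElt (U R : ℝ) (F : ℝ → ℝ → ℝ) (x : PairAlg) :
    pair (ofLog U F) (x * zetaElt R diagHom) = pair (ofLog U (zetaOp₂ R F)) x := by
  rw [pair_mul_zetaElt]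
  refine pair_congr (fun t => ?_) x
  simp only [ofLog, zetaOp₂]
  refine Finset.sum_congr rfl fun n hn => ?_
  simp only [Prod.fst_mul, Prod.snd_mul, MonoidHom.prod_apply, MonoidHom.id_apply,
    sub_log_mul U t.1 hn, sub_log_mul U t.2 hn]

theorem pair_ofLog_mul_pow_fst (U R : ℝ) (k : ℕ) (f g : ℝ → ℝ) (x : PairAlg) :
    pair (ofLog U fun u w => f u * g w) (x * moebiusElt R fstHom ^ k) =
      pair (ofLog U fun u w => (moebiusOp R)^[k] f u * g w) x := by
  induction k generalizing f with
  | zero => simp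
  | succ k ih => rw [pow_succ, ← mul_assoc, pair_ofLog_mul_moebiusElt_fst, ih]; rfl

theorem pair_ofLog_mul_pow_snd (U R : ℝ) (k : ℕ) (f g : ℝ → ℝ) (x : PairAlg) :
    pair (ofLog U fun u w => f u * g w) (x * moebiusElt R sndHom ^ k) =
      pair (ofLog U fun u w => f u * (moebiusOp R)^[k] g w) x := by
  induction k generalizing g with
  | zero => simp
  | succ k ih => rw [pow_succ, ← mul_assoc, pair_ofLog_mul_moebiusElt_snd, ih]; rfl

theorem pair_ofLog_mul_pow_diag (U R : ℝ) (k : ℕ) (F : ℝ → ℝ → ℝ) (x : PairAlg) :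
    pair (ofLog U F) (x * zetaElt R diagHom ^ k) = pair (ofLog U ((zetaOp₂ R)^[k] F)) x := by
  induction k generalizing F with
  | zero => simp
  | succ k ih => rw [pow_succ, ← mul_assoc, pair_ofLog_mul_zetaElt, ih]; rfl

theorem truncated_ofLog_truncPow {R : ℝ} (hR : 0 < R) (i j : ℕ) :
    Truncated R (ofLog (log R) fun u w => truncPow i u * truncPow j w) := by
  have h : ∀ n : ℕ, R < n → log R - log n < 0 := fun n hn => sub_neg.2 (log_lt_log hR hn)
  rintro s (hs | hs)
  · simp only [ofLog, truncPow_of_neg i (h _ hs), zero_mul]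
  · simp only [ofLog, truncPow_of_neg j (h _ hs), mul_zero]

theorem abs_ofLog_sub_le {U L E : ℝ} {F : ℝ → ℝ → ℝ} (h : NearConst U L E F) (s : ℕ+ × ℕ+) :
    |ofLog U F s - L| ≤ E * weight s :=
  h _ _ (log_pnat_nonneg s.1) (log_pnat_nonneg s.2)

/-- The error constant of the smooth two-dimensional sieve sum. -/
noncomputable def smoothErr (R : ℝ) (k₁ k₂ r l₁ l₂ : ℕ) : ℝ :=
  (l₁ + l₂).choose l₁ * (2 ^ r + (r + l₁ + l₂ : ℕ) + 1) *
    (1 + log R) ^ ((r + l₁ + l₂ : ℕ) - 1 / 4 : ℝ) * moebiusMass ^ k₁ * moebiusMass ^ k₂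

theorem abs_pair_prod_numerAt_sub_le {R : ℝ} (hR : 1 ≤ R) {P : Finset ℕ}
    (hP : ∀ p ∈ P, p.Prime) (hPR : ∀ p : ℕ, p.Prime → (p : ℝ) ≤ R → p ∈ P) {J : ℕ}
    (hJ : R < 2 ^ J) (k₁ k₂ r l₁ l₂ : ℕ) (v₁ v₂ w : ℕ → ℝ) :
    |pair (ofLog (log R) fun u w => truncPow (k₁ + l₁) u * truncPow (k₂ + l₂) w)
        (∏ p ∈ P, numerAt v₁ v₂ w p) - (∏ p ∈ P, aug (corrAt J k₁ k₂ r v₁ v₂ w p)) *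
        ((l₁ + l₂).choose l₁ * (log R ^ (r + l₁ + l₂) / (r + l₁ + l₂).factorial))| ≤
      smoothErr R k₁ k₂ r l₁ l₂ * ∏ p ∈ P, nrm (corrAt J k₁ k₂ r v₁ v₂ w p) := by
  have hE : 0 ≤ smoothErr R k₁ k₂ r l₁ l₂ := by
    have := moebiusMass_nonneg
    have := log_nonneg hR
    unfold smoothErr; positivity
  rw [pair_eq_of_red_eq (truncated_ofLog_truncPow (by linarith) _ _)
    (red_prod_numerAt hR hP hPR hJ k₁ k₂ r v₁ v₂ w), pair_ofLog_mul_pow_fst,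
    pair_ofLog_mul_pow_snd, pair_ofLog_mul_pow_diag, ← map_prod]
  exact (abs_pair_sub_le (abs_ofLog_sub_le (nearConst_moebiusOp hR r k₁ k₂ l₁ l₂)) _).trans
    (mul_le_mul_of_nonneg_left (nrm_prod_le _ _) hE)

/-- The size of the local variables at `p`. -/
noncomputable def localSize (p : ℕ) : ℝ := √(1 + log p) / p

theorem nrm_emb_le_localSize {p : ℕ} (hp : p.Prime) :
    nrm (emb fstHom p) ≤ localSize p ∧ nrm (emb sndHom p) ≤ localSize p ∧
      nrm (emb diagHom p) ≤ localSize p := by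
  have hl : 0 ≤ log p := log_natCast_nonneg p
  have h1 : (1 + log p) ^ (1 / 4 : ℝ) ≤ √(1 + log p) := by
    rw [sqrt_eq_rpow]
    exact rpow_le_rpow_of_exponent_le (by linarith) (by norm_num)
  have h2 : (1 + log p) ^ (1 / 4 : ℝ) * (1 + log p) ^ (1 / 4 : ℝ) = √(1 + log p) := by
    rw [sqrt_eq_rpow, ← rpow_add (by linarith)]; norm_num
  have hp0 : (0 : ℝ) < p := by exact_mod_cast hp.pos
  refine ⟨?_, ?_, ?_⟩ <;>
  · simp only [emb, nrm_single, weight, MonoidHom.inl_apply, MonoidHom.inr_apply,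
      MonoidHom.prod_apply, MonoidHom.id_apply, Nat.toPNat'_coe, if_pos hp.pos, PNat.one_coe,
      Nat.cast_one, log_one, add_zero, one_rpow, one_mul, mul_one, h2]
    rw [abs_of_pos (inv_pos.2 hp0), localSize, div_eq_inv_mul (√(1 + log p))]
    all_goals exact mul_le_mul_of_nonneg_left h1 (inv_pos.2 hp0).le

theorem localSize_sq_le {p : ℕ} (hp : p.Prime) : localSize p ^ 2 ≤ 1 / p := by
  have hp0 : (0 : ℝ) < p := by exact_mod_cast hp.pos
  have hl : 0 ≤ log p := log_natCast_nonneg p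
  rw [localSize, div_pow, sq_sqrt (by linarith), div_le_div_iff₀ (by positivity) hp0]
  have := log_le_sub_one_of_pos hp0
  nlinarith

theorem localSize_nonneg (p : ℕ) : 0 ≤ localSize p := by unfold localSize; positivity

theorem localSize_le {p : ℕ} (hp : p.Prime) : localSize p ≤ 3 / 4 := by
  have h := localSize_sq_le hp
  have h2 : (1 : ℝ) / p ≤ 1 / 2 :=
    one_div_le_one_div_of_le (by norm_num) (by exact_mod_cast hp.two_le)
  nlinarith [localSize_nonneg p]

/-- The constant in the bound for the norms of the local correction factors. -/
noncomputable def corrConst (M : ℕ) : ℝ := devConst M * 36 ^ M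

theorem corrConst_nonneg (M : ℕ) : 0 ≤ corrConst M :=
  mul_nonneg (devConst_nonneg M) (by positivity)

theorem nrm_corrAt_le {J k₁ k₂ r M : ℕ} (h₁ : k₁ ≤ M) (h₂ : k₂ ≤ M) (hr : r ≤ M)
    {v₁ v₂ w : ℕ → ℝ} {p : ℕ} (hp : p.Prime) (hv₁ : 0 ≤ v₁ p) (hv₁' : v₁ p ≤ M)
    (hv₂ : 0 ≤ v₂ p) (hv₂' : v₂ p ≤ M) (hw : 0 ≤ w p) (hw' : w p ≤ M) :
    nrm (corrAt J k₁ k₂ r v₁ v₂ w p) ≤ 1 + corrConst M * localSize p := by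
  obtain ⟨a1, a2, a3⟩ := nrm_emb_le_localSize hp
  have h34 := localSize_le hp
  have hinv : (p : ℝ)⁻¹ ≤ 2⁻¹ := inv_anti₀ (by norm_num) (by exact_mod_cast hp.two_le)
  refine (nrm_corr_le h₁ h₂ (inv_nonneg.2 (by linarith)) ?_ (a1.trans h34) (a2.trans h34)
    (nrm_deviation_le h₁ h₂ hr hv₁ hv₁' hv₂ hv₂' hw hw' a1 a2 a3 (by linarith))).trans_eq ?_
  · rw [inv_le_comm₀ (by linarith) (by norm_num)]; linarith
  · unfold corrConst; ring

theorem nrm_corrAt_le_sq {J k₁ k₂ r M : ℕ} (h₁ : k₁ ≤ M) (h₂ : k₂ ≤ M) (hr : r ≤ M)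
    {v₁ v₂ w : ℕ → ℝ} {p : ℕ} (hp : p.Prime) (hv₁ : v₁ p = k₁) (hv₂ : v₂ p = k₂) (hw : w p = r) :
    nrm (corrAt J k₁ k₂ r v₁ v₂ w p) ≤ 1 + corrConst M * localSize p ^ 2 := by
  obtain ⟨a1, a2, a3⟩ := nrm_emb_le_localSize hp
  have h34 := localSize_le hp
  have hinv : (p : ℝ)⁻¹ ≤ 2⁻¹ := inv_anti₀ (by norm_num) (by exact_mod_cast hp.two_le)
  rw [corrAt, hv₁, hv₂, hw]
  refine (nrm_corr_le h₁ h₂ (inv_nonneg.2 (by linarith)) ?_ (a1.trans h34) (a2.trans h34)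
    (nrm_deviation_le_sq h₁ h₂ hr a1 a2 a3 (by linarith))).trans_eq ?_
  · rw [inv_le_comm₀ (by linarith) (by norm_num)]; linarith
  · unfold corrConst; ring

end PairAlg

theorem sum_primeFactors_log_le {m : ℕ} (hm : m ≠ 0) {S : Finset ℕ}
    (hS : ∀ p ∈ S, p.Prime ∧ p ∣ m) : ∑ p ∈ S, log p ≤ log m := by
  have hd : ∏ p ∈ S, p ∣ m := (Finset.prod_dvd_prod_of_subset _ _ _ fun p hp =>
    Nat.mem_primeFactors.2 ⟨(hS p hp).1, (hS p hp).2, hm⟩).trans (Nat.prod_primeFactors_dvd m)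
  have hpos : 0 < ∏ p ∈ S, p := Finset.prod_pos fun p hp => (hS p hp).1.pos
  rw [← log_prod fun p hp => by exact_mod_cast (hS p hp).1.ne_zero, ← Nat.cast_prod]
  refine log_le_log (by exact_mod_cast hpos) ?_
  exact_mod_cast Nat.le_of_dvd (Nat.pos_of_ne_zero hm) hd

theorem sum_log_div_prime_le {n : ℕ} (hn : 0 < n) :
    ∑ p ∈ (Finset.Ioc 0 n).filter Nat.Prime, log p / p ≤ 2 * log n := by
  have hn0 : (0 : ℝ) < n := by exact_mod_cast hn
  have h1 : ∀ p ∈ (Finset.Ioc 0 n).filter Nat.Prime,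
      (n : ℝ) * (log p / p) ≤ 2 * ∑ m ∈ (Finset.Ioc 0 n).filter (p ∣ ·), log p := by
    intro p hp
    rw [Finset.mem_filter, Finset.mem_Ioc] at hp
    have hp0 : (0 : ℝ) < p := by exact_mod_cast hp.1.1
    rw [Finset.sum_const, Nat.Ioc_filter_dvd_card_eq_div, nsmul_eq_mul]
    have h2 : (n : ℝ) ≤ 2 * ((n / p : ℕ) : ℝ) * p := by
      have a : n < p * (n / p + 1) := Nat.lt_mul_div_succ n hp.1.1
      have b : 1 ≤ n / p := (Nat.one_le_div_iff hp.1.1).2 hp.1.2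
      have : n ≤ 2 * (n / p) * p := by nlinarith
      exact_mod_cast this
    calc (n : ℝ) * (log p / p) = n / p * log p := by ring
      _ ≤ (2 * ((n / p : ℕ) : ℝ)) * log p :=
        mul_le_mul_of_nonneg_right ((div_le_iff₀ hp0).2 h2) (log_natCast_nonneg p)
      _ = _ := by ring
  have h2 : ∑ p ∈ (Finset.Ioc 0 n).filter Nat.Prime, ∑ m ∈ (Finset.Ioc 0 n).filter (p ∣ ·), log p
      ≤ n * log n := by
    calc _ = ∑ m ∈ Finset.Ioc 0 n, ∑ p ∈ ((Finset.Ioc 0 n).filter Nat.Prime).filter (· ∣ m),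
          log (p : ℝ) := Finset.sum_comm' (by simp only [Finset.mem_filter]; tauto)
      _ ≤ ∑ m ∈ Finset.Ioc 0 n, log (n : ℝ) := by
        refine Finset.sum_le_sum fun m hm => ?_
        rw [Finset.mem_Ioc] at hm
        refine (sum_primeFactors_log_le hm.1.ne' fun p hp => ?_).trans
          (log_le_log (by exact_mod_cast hm.1) (by exact_mod_cast hm.2))
        rw [Finset.mem_filter, Finset.mem_filter] at hp
        exact ⟨hp.1.2, hp.2⟩
      _ = _ := by simp
  have h3 := Finset.sum_le_sum h1
  rw [← Finset.mul_sum, ← Finset.mul_sum] at h3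
  refine le_of_mul_le_mul_left (h3.trans ?_) hn0
  linarith

namespace PairAlg

theorem localSize_le_add {η : ℝ} (hη : 0 < η) {p : ℕ} (hp : p.Prime) :
    localSize p ≤ η * (log p / p) + if p ≤ ⌊exp (1 + 2 / η ^ 2)⌋₊ then 1 else 0 := by
  have hp0 : (0 : ℝ) < p := by exact_mod_cast hp.pos
  have hl : 0 ≤ log p := log_natCast_nonneg p
  split_ifs with h
  · have := localSize_le hp
    have : 0 ≤ η * (log p / p) := by positivity
    linarith
  · rw [not_le, Nat.floor_lt (exp_pos _).le] at h
    have h2 : 1 + 2 / η ^ 2 ≤ log p := (le_log_iff_exp_le hp0).2 h.le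
    have h3 : 0 < 2 / η ^ 2 := by positivity
    have h4 : 2 ≤ η ^ 2 * log p := by
      rw [← div_le_iff₀' (by positivity)]; linarith
    rw [add_zero, localSize, ← mul_div_assoc]
    refine div_le_div_of_nonneg_right (sqrt_le_iff.2 ⟨by positivity, ?_⟩) hp0.le
    nlinarith

theorem localSize_le_inv {y : ℝ} (hy : 0 < y) {p : ℕ} (hp : p.Prime) (h : y ^ 2 ≤ p) :
    localSize p ≤ 1 / y := by
  have h1 := localSize_sq_le hp
  have h2 : 1 / (p : ℝ) ≤ (1 / y) ^ 2 := by
    rw [div_pow, one_pow]; exact one_div_le_one_div_of_le (by positivity) h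
  exact (abs_le_of_sq_le_sq' (h1.trans h2) (by positivity)).2

theorem sum_localSize_le {η : ℝ} (hη : 0 < η) {L : ℝ} (hL : 1 ≤ L) {D : ℕ} (hD : D ≠ 0)
    (hDL : log D ≤ L) {S : Finset ℕ} (hS : ∀ p ∈ S, p.Prime ∧ p ∣ D) :
    ∑ p ∈ S, localSize p ≤ 4 * η * log L + (2 * η + ⌊exp (1 + 2 / η ^ 2)⌋₊ + 2) := by
  classical
  have hn1 : 1 ≤ ⌈L ^ 2⌉₊ := Nat.one_le_ceil_iff.2 (by positivity)
  have hlogn : log (⌈L ^ 2⌉₊ : ℕ) ≤ 2 * log L + 1 := by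
    have h1 : (⌈L ^ 2⌉₊ : ℝ) ≤ 2 * L ^ 2 := by
      have := (Nat.ceil_lt_add_one (sq_nonneg L)).le
      nlinarith
    have h2 := log_le_log (by exact_mod_cast hn1) h1
    rw [log_mul (by norm_num) (by positivity), log_pow] at h2
    have := log_le_sub_one_of_pos (show (0 : ℝ) < 2 by norm_num)
    push_cast at h2; linarith
  rw [← Finset.sum_filter_add_sum_filter_not S (· ≤ ⌈L ^ 2⌉₊)]
  have a : ∑ p ∈ S.filter (· ≤ ⌈L ^ 2⌉₊), localSize p ≤
      4 * η * log L + (2 * η + ⌊exp (1 + 2 / η ^ 2)⌋₊) := by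
    have hsub : S.filter (· ≤ ⌈L ^ 2⌉₊) ⊆ (Finset.Ioc 0 ⌈L ^ 2⌉₊).filter Nat.Prime := by
      intro p hp
      rw [Finset.mem_filter] at hp
      rw [Finset.mem_filter, Finset.mem_Ioc]
      exact ⟨⟨(hS p hp.1).1.pos, hp.2⟩, (hS p hp.1).1⟩
    calc _ ≤ ∑ p ∈ (Finset.Ioc 0 ⌈L ^ 2⌉₊).filter Nat.Prime, localSize p :=
          Finset.sum_le_sum_of_subset_of_nonneg hsub fun p _ _ => localSize_nonneg p
      _ ≤ ∑ p ∈ (Finset.Ioc 0 ⌈L ^ 2⌉₊).filter Nat.Prime, (η * (log p / p) +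
          if p ≤ ⌊exp (1 + 2 / η ^ 2)⌋₊ then 1 else 0) :=
        Finset.sum_le_sum fun p hp => localSize_le_add hη (Finset.mem_filter.1 hp).2
      _ ≤ η * (2 * log (⌈L ^ 2⌉₊ : ℕ)) + ⌊exp (1 + 2 / η ^ 2)⌋₊ := by
        rw [Finset.sum_add_distrib, ← Finset.mul_sum]
        refine add_le_add (mul_le_mul_of_nonneg_left (sum_log_div_prime_le hn1) hη.le) ?_
        rw [Finset.sum_boole]
        have : ((Finset.Ioc 0 ⌈L ^ 2⌉₊).filter Nat.Prime).filter
            (· ≤ ⌊exp (1 + 2 / η ^ 2)⌋₊) ⊆ Finset.Ioc 0 ⌊exp (1 + 2 / η ^ 2)⌋₊ := by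
          intro p hp
          simp only [Finset.mem_filter, Finset.mem_Ioc] at hp ⊢
          exact ⟨hp.1.1.1, hp.2⟩
        have := Finset.card_le_card this
        rw [Nat.card_Ioc, Nat.sub_zero] at this
        exact_mod_cast this
      _ ≤ _ := by nlinarith
  have b : ∑ p ∈ S.filter (¬ · ≤ ⌈L ^ 2⌉₊), localSize p ≤ 2 := by
    have hcard : (S.card : ℝ) * log 2 ≤ L := by
      refine le_trans ?_ ((sum_primeFactors_log_le hD hS).trans hDL)
      rw [← nsmul_eq_mul]
      exact Finset.card_nsmul_le_sum _ _ _ fun p hp =>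
        log_le_log (by norm_num) (by exact_mod_cast (hS p hp).1.two_le)
    have hlog2 := log_two_gt_d9
    calc _ ≤ ∑ p ∈ S.filter (¬ · ≤ ⌈L ^ 2⌉₊), 1 / L := Finset.sum_le_sum fun p hp => by
          rw [Finset.mem_filter, not_le] at hp
          exact localSize_le_inv (by linarith) (hS p hp.1).1
            ((Nat.le_ceil _).trans (by exact_mod_cast hp.2.le))
      _ ≤ S.card * (1 / L) := by
        rw [Finset.sum_const, nsmul_eq_mul]
        refine mul_le_mul_of_nonneg_right ?_ (by positivity)
        exact_mod_cast Finset.card_filter_le _ _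
      _ ≤ 2 := by
        rw [mul_one_div, div_le_iff₀ (by linarith)]
        have : (0 : ℝ) ≤ S.card := Nat.cast_nonneg _
        nlinarith
  linarith

theorem localSize_sq_le_rpow {p : ℕ} (hp : 0 < p) :
    localSize p ^ 2 ≤ 3 * (1 / (p : ℝ) ^ (3 / 2 : ℝ)) := by
  have hp0 : (0 : ℝ) < p := by exact_mod_cast hp
  have hp1 : (1 : ℝ) ≤ p := by exact_mod_cast hp
  have hl : 0 ≤ log p := log_natCast_nonneg p
  have h1 : log p ≤ 2 * (p : ℝ) ^ (1 / 2 : ℝ) := by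
    have := log_le_rpow_div hp0.le (show (0 : ℝ) < 1 / 2 by norm_num)
    linarith
  have h2 : 1 ≤ (p : ℝ) ^ (1 / 2 : ℝ) := one_le_rpow hp1 (by norm_num)
  have h3 : (p : ℝ) ^ 2 = p ^ (1 / 2 : ℝ) * p ^ (3 / 2 : ℝ) := by
    rw [← rpow_add hp0]; norm_num
  rw [localSize, div_pow, sq_sqrt (by linarith), h3, mul_one_div,
    div_le_div_iff₀ (by positivity) (by positivity)]
  have h4 : 0 < (p : ℝ) ^ (3 / 2 : ℝ) := by positivity
  nlinarith [mul_le_mul_of_nonneg_right (show 1 + log p ≤ 3 * (p : ℝ) ^ (1 / 2 : ℝ) by linarith)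
    h4.le]

theorem summable_localSize_sq : Summable fun p : ℕ => localSize p ^ 2 := by
  refine Summable.of_nonneg_of_le (fun p => sq_nonneg _) (fun p => ?_)
    ((summable_one_div_nat_rpow.2 (show (1 : ℝ) < 3 / 2 by norm_num)).mul_left 3)
  rcases Nat.eq_zero_or_pos p with rfl | hp
  · simp [localSize]
  · exact localSize_sq_le_rpow hp

/-- Products of local factors deviating from `1` by `localSize p ^ 2`, or by `localSize p` at the
primes dividing `D`, grow slower than any power of `log D`. -/
theorem exists_prod_le (C : ℝ) (hC : 0 ≤ C) : ∃ K : ℝ, ∀ (L : ℝ) (D : ℕ) (P : Finset ℕ)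
    (f : ℕ → ℝ), 1 ≤ L → D ≠ 0 → log D ≤ L → (∀ p ∈ P, p.Prime) → (∀ p ∈ P, 0 ≤ f p) →
    (∀ p ∈ P, f p ≤ 1 + C * localSize p) →
    (∀ p ∈ P, ¬ p ∣ D → f p ≤ 1 + C * localSize p ^ 2) →
    ∏ p ∈ P, f p ≤ K * L ^ (1 / 8 : ℝ) := by
  classical
  set η : ℝ := 1 / (32 * (C + 1)) with hη
  have hη0 : 0 < η := by positivity
  refine ⟨exp (C * (∑' p : ℕ, localSize p ^ 2) +
    C * (2 * η + ⌊exp (1 + 2 / η ^ 2)⌋₊ + 2)), fun L D P f hL hD hDL hP hf0 hf1 hf2 => ?_⟩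
  have h1 : ∀ p ∈ P, f p ≤ exp (C * localSize p ^ 2 + if p ∣ D then C * localSize p else 0) := by
    intro p hp
    have h3 := mul_nonneg hC (sq_nonneg (localSize p))
    split_ifs with h
    · refine (hf1 p hp).trans ((add_comm _ _).trans_le ((add_one_le_exp _).trans
        (exp_le_exp.2 (by linarith))))
    · rw [add_zero]
      exact (hf2 p hp h).trans ((add_comm _ _).trans_le (add_one_le_exp _))
  refine (Finset.prod_le_prod hf0 h1).trans ?_
  rw [← exp_sum, rpow_def_of_pos (by linarith), ← exp_add, exp_le_exp, Finset.sum_add_distrib,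
    ← Finset.mul_sum, ← Finset.sum_filter, ← Finset.mul_sum]
  have a := summable_localSize_sq.sum_le_tsum P fun p _ => sq_nonneg _
  have b := sum_localSize_le hη0 hL hD hDL (S := P.filter (· ∣ D)) fun p hp =>
    ⟨hP p (Finset.mem_filter.1 hp).1, (Finset.mem_filter.1 hp).2⟩
  have a' := mul_le_mul_of_nonneg_left a hC
  have b' := mul_le_mul_of_nonneg_left b hC
  have c : C * (4 * η) ≤ 1 / 8 := by
    rw [hη, ← mul_div_assoc, ← mul_div_assoc, div_le_div_iff₀ (by positivity) (by norm_num)]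
    linarith
  have d := mul_le_mul_of_nonneg_right c (log_nonneg hL)
  linarith

end PairAlg

theorem sum_range_mul_of_coprime {A : Type*} [CommSemiring A] {m n : ℕ} (hm : 0 < m) (hn : 0 < n)
    (co : m.Coprime n) {F G : ℕ → A} (hF : ∀ x, F (x % m) = F x) (hG : ∀ x, G (x % n) = G x) :
    ∑ x ∈ Finset.range (m * n), F x * G x =
      (∑ x ∈ Finset.range m, F x) * ∑ x ∈ Finset.range n, G x := by
  rw [Finset.sum_mul_sum, ← Finset.sum_product']
  refine Finset.sum_bij' (fun x _ => (x % m, x % n))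
    (fun y _ => (Nat.chineseRemainder co y.1 y.2 : ℕ)) ?_ ?_ ?_ ?_ ?_
  · intro x _
    simp [Nat.mod_lt _ hm, Nat.mod_lt _ hn]
  · intro y _
    exact Finset.mem_range.2 (Nat.chineseRemainder_lt_mul co _ _ hm.ne' hn.ne')
  · intro x hx
    rw [Finset.mem_range] at hx
    have h1 := (Nat.chineseRemainder co (x % m) (x % n)).2
    have h2 : (Nat.chineseRemainder co (x % m) (x % n) : ℕ) ≡ x [MOD m * n] :=
      (Nat.modEq_and_modEq_iff_modEq_mul co).1
        ⟨h1.1.trans (Nat.mod_modEq _ _), h1.2.trans (Nat.mod_modEq _ _)⟩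
    exact h2.eq_of_lt_of_lt (Nat.chineseRemainder_lt_mul co _ _ hm.ne' hn.ne') hx
  · rintro ⟨a, b⟩ hy
    rw [Finset.mem_product, Finset.mem_range, Finset.mem_range] at hy
    have h1 := (Nat.chineseRemainder co a b).2
    refine Prod.ext ?_ ?_
    · exact (Nat.ModEq.trans (Nat.mod_modEq _ _) h1.1).eq_of_lt_of_lt (Nat.mod_lt _ hm) hy.1
    · exact (Nat.ModEq.trans (Nat.mod_modEq _ _) h1.2).eq_of_lt_of_lt (Nat.mod_lt _ hn) hy.2
  · intro x _
    rw [hF, hG]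

theorem sum_range_prod_primes {A : Type*} [CommSemiring A] {P : Finset ℕ}
    (hP : ∀ p ∈ P, p.Prime) {f : ℕ → ℕ → A} (hf : ∀ p ∈ P, ∀ x, f p (x % p) = f p x) :
    ∑ x ∈ Finset.range (∏ p ∈ P, p), ∏ p ∈ P, f p x =
      ∏ p ∈ P, ∑ x ∈ Finset.range p, f p x := by
  classical
  induction P using Finset.induction_on with
  | empty => simp
  | insert p P hp ih =>
    have hP' : ∀ q ∈ P, q.Prime := fun q hq => hP q (Finset.mem_insert_of_mem hq)
    have hf' : ∀ q ∈ P, ∀ x, f q (x % q) = f q x := fun q hq => hf q (Finset.mem_insert_of_mem hq)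
    have hpp := hP p (Finset.mem_insert_self p P)
    rw [Finset.prod_insert hp, Finset.prod_insert hp, ← ih hP' hf']
    simp only [Finset.prod_insert hp]
    refine sum_range_mul_of_coprime hpp.pos (Finset.prod_pos fun q hq => (hP' q hq).pos)
      (Nat.Coprime.prod_right fun q hq => (Nat.coprime_primes hpp (hP' q hq)).2 ?_)
      (hf p (Finset.mem_insert_self p P)) fun x => ?_
    · rintro rfl; exact hp hq
    · refine Finset.prod_congr rfl fun q hq => ?_
      rw [← hf' q hq, ← hf' q hq x, Nat.mod_mod_of_dvd _ (Finset.dvd_prod_of_mem _ hq)]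

/-- The number of residues modulo `p` at which the polynomial of `H` vanishes. -/
def rootCount (H : Finset ℕ) (p : ℕ) : ℕ :=
  ((Finset.range p).filter fun x => p ∣ ∏ h ∈ H, (x + h)).card

theorem dvd_prod_add_mod {p : ℕ} (H : Finset ℕ) (x : ℕ) :
    p ∣ ∏ h ∈ H, (x % p + h) ↔ p ∣ ∏ h ∈ H, (x + h) :=
  Nat.ModEq.dvd_iff (Nat.ModEq.prod fun _ _ => (Nat.mod_modEq x p).add_right _) dvd_rfl

theorem rootCount_eq_residCard (H : Finset ℕ) {p : ℕ} (hp : p.Prime) :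
    rootCount H p = residCard H p := by
  have hp0 := hp.pos
  have key : ∀ x h : ℕ, x < p → (p ∣ x + h ↔ (p - h % p) % p = x) := by
    intro x h hx
    have hc := Nat.mod_lt h hp0
    rw [Nat.dvd_iff_mod_eq_zero, Nat.add_mod, Nat.mod_eq_of_lt hx]
    rcases Nat.eq_zero_or_pos (h % p) with h0 | h0
    · rw [h0, Nat.sub_zero, Nat.mod_self, Nat.add_zero, Nat.mod_eq_of_lt hx, eq_comm]
    · rw [Nat.mod_eq_of_lt (show p - h % p < p by omega)]
      constructor
      · intro h1
        have h2 := Nat.div_add_mod (x + h % p) p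
        rw [h1] at h2
        have h3 : (x + h % p) / p < 2 := Nat.div_lt_of_lt_mul (by omega)
        have h4 : (x + h % p) / p = 1 := by
          rcases Nat.lt_or_ge ((x + h % p) / p) 1 with h5 | h5
          · rw [Nat.lt_one_iff.1 h5, mul_zero] at h2; omega
          · omega
        rw [h4] at h2; omega
      · rintro rfl
        rw [Nat.sub_add_cancel hc.le, Nat.mod_self]
  have e : (Finset.range p).filter (fun x => p ∣ ∏ h ∈ H, (x + h)) =
      (H.image (· % p)).image fun c => (p - c) % p := by
    ext x
    simp only [Finset.mem_filter, Finset.mem_range, Finset.mem_image, exists_exists_and_eq_and]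
    constructor
    · rintro ⟨hx, hd⟩
      obtain ⟨h, hh, hd⟩ := (Prime.dvd_finsetProd_iff hp.prime _).1 hd
      exact ⟨h, hh, (key x h hx).1 hd⟩
    · rintro ⟨h, hh, hx⟩
      have hxp : x < p := hx ▸ Nat.mod_lt _ hp0
      exact ⟨hxp, ((key x h hxp).2 hx).trans (Finset.dvd_prod_of_mem _ hh)⟩
  rw [rootCount, e, residCard, Finset.card_image_of_injOn]
  intro a ha b hb hab
  simp only [Finset.coe_image, Set.mem_image] at ha hb
  obtain ⟨a, _, rfl⟩ := ha
  obtain ⟨b, _, rfl⟩ := hb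
  have h1 := Nat.mod_lt a hp0
  have h2 := Nat.mod_lt b hp0
  have h3 : ∀ c, (p - c % p) % p = if c % p = 0 then 0 else p - c % p := fun c => by
    split_ifs with h
    · simp [h]
    · exact Nat.mod_eq_of_lt (by omega)
  simp only [h3] at hab
  split_ifs at hab <;> omega

/-- The number of common roots modulo `p` of the polynomials of `H₁` and `H₂`. -/
def commonRootCount (H₁ H₂ : Finset ℕ) (p : ℕ) : ℕ :=
  ((Finset.range p).filter fun x => p ∣ ∏ h ∈ H₁, (x + h) ∧ p ∣ ∏ h ∈ H₂, (x + h)).card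

theorem rootCount_union_add (H₁ H₂ : Finset ℕ) {p : ℕ} (hp : p.Prime) :
    rootCount (H₁ ∪ H₂) p + commonRootCount H₁ H₂ p = rootCount H₁ p + rootCount H₂ p := by
  classical
  rw [rootCount, rootCount, rootCount, commonRootCount, Finset.filter_and,
    ← Finset.card_union_add_card_inter {x ∈ Finset.range p | p ∣ ∏ h ∈ H₁, (x + h)},
    ← Finset.filter_or]
  congr 3
  ext x
  simp only [Prime.dvd_finsetProd_iff hp.prime, Finset.mem_union]
  grind

theorem rootCount_le_card (H : Finset ℕ) {p : ℕ} (hp : p.Prime) : rootCount H p ≤ H.card :=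
  (rootCount_eq_residCard H hp).trans_le Finset.card_image_le

theorem commonRootCount_le (H₁ H₂ : Finset ℕ) {p : ℕ} (hp : p.Prime) :
    commonRootCount H₁ H₂ p ≤ H₁.card :=
  (Finset.card_le_card fun x => by simp only [Finset.mem_filter]; tauto).trans
    (rootCount_le_card H₁ hp)

/-- The product of the positive differences of elements of `H`. -/
def diffProd (H : Finset ℕ) : ℕ := ∏ a ∈ (H ×ˢ H).filter (fun a => a.1 < a.2), (a.2 - a.1)

theorem diffProd_ne_zero (H : Finset ℕ) : diffProd H ≠ 0 := by
  refine Finset.prod_ne_zero_iff.2 fun a ha => ?_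
  have := (Finset.mem_filter.1 ha).2
  omega

theorem log_diffProd_le {H : Finset ℕ} {h M : ℕ} (hH : H ⊆ Finset.Icc 1 h) (hM : H.card ≤ M) :
    log (diffProd H) ≤ M ^ 2 * log h := by
  rw [diffProd, Nat.cast_prod, log_prod]
  · calc _ ≤ ∑ a ∈ (H ×ˢ H).filter (fun a => a.1 < a.2), log (h : ℝ) := by
          refine Finset.sum_le_sum fun a ha => ?_
          rw [Finset.mem_filter, Finset.mem_product] at ha
          have := Finset.mem_Icc.1 (hH ha.1.2)
          exact log_le_log (by exact_mod_cast Nat.sub_pos_of_lt ha.2)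
            (by exact_mod_cast (Nat.sub_le _ _).trans this.2)
      _ ≤ _ := by
        rw [Finset.sum_const, nsmul_eq_mul]
        refine mul_le_mul_of_nonneg_right ?_ (log_natCast_nonneg h)
        have : ((H ×ˢ H).filter (fun a => a.1 < a.2)).card ≤ M ^ 2 :=
          (Finset.card_filter_le _ _).trans (by rw [Finset.card_product, sq]; gcongr)
        exact_mod_cast this
  · intro a ha
    have := (Finset.mem_filter.1 ha).2
    exact_mod_cast (Nat.sub_pos_of_lt this).ne'

theorem rootCount_eq_card {H H' : Finset ℕ} (hsub : H ⊆ H') {p : ℕ} (hp : p.Prime)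
    (hd : ¬ p ∣ diffProd H') : rootCount H p = H.card := by
  rw [rootCount_eq_residCard H hp, residCard, Finset.card_image_of_injOn]
  have key : ∀ a ∈ H, ∀ b ∈ H, a % p = b % p → ¬ a < b := by
    intro a ha b hb hab hlt
    refine hd (((Nat.modEq_iff_dvd' hlt.le).1 hab).trans (Finset.dvd_prod_of_mem
      (fun a : ℕ × ℕ => a.2 - a.1) (a := (a, b)) ?_))
    exact Finset.mem_filter.2 ⟨Finset.mem_product.2 ⟨hsub ha, hsub hb⟩, hlt⟩
  intro a ha b hb hab
  exact le_antisymm (not_lt.1 (key b hb a ha hab.symm)) (not_lt.1 (key a ha b hb hab))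

theorem lamR_eq_sum {R : ℝ} (hR : 1 ≤ R) {P : Finset ℕ} (hP : ∀ p ∈ P, p.Prime)
    (hPR : ∀ p : ℕ, p.Prime → (p : ℝ) ≤ R → p ∈ P) {n : ℕ} {H : Finset ℕ}
    (hn : ∏ h ∈ H, (n + h) ≠ 0) (a : ℕ) :
    lamR R n H a = ∑ d ∈ (∏ p ∈ P.filter (· ∣ ∏ h ∈ H, (n + h)), p).divisors,
      (ArithmeticFunction.moebius d : ℝ) * truncPow a (log R - log d) := by
  classical
  set D := ∏ h ∈ H, (n + h) with hD
  have hA : ∀ p ∈ P.filter (· ∣ D), p.Prime := fun p hp => hP p (Finset.mem_filter.1 hp).1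
  have hq : ∏ p ∈ P.filter (· ∣ D), p ≠ 0 := (PairAlg.squarefree_prod_primes hA).ne_zero
  have hqD : ∏ p ∈ P.filter (· ∣ D), p ∣ D := (Finset.prod_dvd_prod_of_subset _ _ _ fun p hp =>
    Nat.mem_primeFactors.2 ⟨hA p hp, (Finset.mem_filter.1 hp).2, hn⟩).trans
      (Nat.prod_primeFactors_dvd D)
  have hR0 : 0 < R := by linarith
  rw [lamR, ← hD, Finset.mul_sum]
  have e : ∀ d ∈ D.divisors.filter (fun d : ℕ => (d : ℝ) ≤ R), 1 / (a.factorial : ℝ) *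
      ((ArithmeticFunction.moebius d : ℝ) * log (R / d) ^ a) =
      (ArithmeticFunction.moebius d : ℝ) * truncPow a (log R - log d) := by
    intro d hd
    rw [Finset.mem_filter] at hd
    have hd0 : (0 : ℝ) < d := by exact_mod_cast Nat.pos_of_mem_divisors hd.1
    rw [log_div hR0.ne' hd0.ne', truncPow_of_nonneg _ (sub_nonneg.2 (log_le_log hd0 hd.2))]
    ring
  rw [Finset.sum_congr rfl e]
  refine (Finset.sum_subset_zero_on_sdiff (s₁ := D.divisors.filter (fun d : ℕ => (d : ℝ) ≤ R) ∩
    (∏ p ∈ P.filter (· ∣ D), p).divisors) Finset.inter_subset_left (fun d hd => ?_)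
    fun _ _ => rfl).symm.trans (Finset.sum_subset_zero_on_sdiff Finset.inter_subset_right
      (fun d hd => ?_) fun _ _ => rfl)
  · rw [Finset.mem_sdiff, Finset.mem_inter, Finset.mem_filter] at hd
    by_cases hsq : Squarefree d
    · refine absurd ⟨hd.1, Nat.mem_divisors.2
        ⟨PairAlg.dvd_prod_of_squarefree hsq fun p hp hpd => ?_, hq⟩⟩ hd.2
      have hdpos := Nat.pos_of_mem_divisors hd.1.1
      exact Finset.mem_filter.2 ⟨hPR p hp ((Nat.cast_le.2 (Nat.le_of_dvd hdpos hpd)).trans hd.1.2),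
        hpd.trans (Nat.dvd_of_mem_divisors hd.1.1)⟩
    · rw [ArithmeticFunction.moebius_eq_zero_of_not_squarefree hsq]; simp
  · rw [Finset.mem_sdiff, Finset.mem_inter, Finset.mem_filter] at hd
    rw [truncPow_of_neg, mul_zero]
    by_contra h
    have hd0 : (0 : ℝ) < d := by exact_mod_cast Nat.pos_of_mem_divisors hd.1
    exact hd.2 ⟨⟨Nat.mem_divisors.2 ⟨(Nat.dvd_of_mem_divisors hd.1).trans hqD, hn⟩,
      (log_le_log_iff hd0 hR0).1 (by linarith)⟩, hd.1⟩

namespace PairAlg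

/-- The element `[φ n]`. -/
noncomputable def mono (φ : ℕ+ →* ℕ+ × ℕ+) (n : ℕ) : PairAlg := (n : ℝ) • emb φ n

theorem mono_of_pos (φ : ℕ+ →* ℕ+ × ℕ+) {n : ℕ} (hn : 0 < n) :
    mono φ n = MonoidAlgebra.single (φ n.toPNat') 1 := by
  rw [mono, emb, MonoidAlgebra.smul_single, smul_eq_mul, mul_inv_cancel₀ (by exact_mod_cast hn.ne')]

theorem mono_mul (φ : ℕ+ →* ℕ+ × ℕ+) (m n : ℕ) : mono φ (m * n) = mono φ m * mono φ n := by
  rw [mono, mono, mono, emb_mul, smul_mul_smul_comm, Nat.cast_mul]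

theorem prod_one_sub_mono (φ : ℕ+ →* ℕ+ × ℕ+) {P : Finset ℕ} (hP : ∀ p ∈ P, p.Prime) :
    ∏ p ∈ P, (1 - mono φ p) =
      ∑ d ∈ (∏ p ∈ P, p).divisors, (ArithmeticFunction.moebius d : PairAlg) * mono φ d := by
  let F : ArithmeticFunction PairAlg := ⟨mono φ, by simp [mono]⟩
  have hm : F.IsMultiplicative :=
    ⟨show mono φ 1 = 1 by simp [mono, emb_one], fun _ => mono_mul φ _ _⟩
  have h := hm.prodPrimeFactors_one_sub_of_squarefree _ (squarefree_prod_primes hP)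
  rwa [primeFactors_prod_eq hP] at h

theorem pair_mul_mono (g : ℕ+ × ℕ+ → ℝ) (x : PairAlg) (φ : ℕ+ →* ℕ+ × ℕ+) {n : ℕ} (hn : 0 < n) :
    pair g (x * mono φ n) = pair (fun t => g (t * φ n.toPNat')) x := by
  rw [mono_of_pos φ hn, pair_mul_single, one_mul]

/-- The local factor at `p` of the sieve weights at `n`. -/
noncomputable def sieveFactor (H₁ H₂ : Finset ℕ) (p n : ℕ) : PairAlg :=
  (if p ∣ ∏ h ∈ H₁, (n + h) then 1 - mono fstHom p else 1) *
    (if p ∣ ∏ h ∈ H₂, (n + h) then 1 - mono sndHom p else 1)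

theorem log_toPNat' {d : ℕ} (hd : 0 < d) : log ((d.toPNat' : ℕ+) : ℕ) = log d := by
  rw [Nat.toPNat'_coe, if_pos hd]

theorem lamR_mul_lamR {R : ℝ} (hR : 1 ≤ R) {P : Finset ℕ} (hP : ∀ p ∈ P, p.Prime)
    (hPR : ∀ p : ℕ, p.Prime → (p : ℝ) ≤ R → p ∈ P) {n : ℕ} {H₁ H₂ : Finset ℕ}
    (h₁ : ∏ h ∈ H₁, (n + h) ≠ 0) (h₂ : ∏ h ∈ H₂, (n + h) ≠ 0) (a b : ℕ) :
    lamR R n H₁ a * lamR R n H₂ b =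
      pair (ofLog (log R) fun u w => truncPow a u * truncPow b w)
        (∏ p ∈ P, sieveFactor H₁ H₂ p n) := by
  simp only [sieveFactor, Finset.prod_mul_distrib, ← Finset.prod_filter]
  have hA : ∀ D : ℕ, ∀ p ∈ P.filter (· ∣ D), p.Prime := fun D p hp =>
    hP p (Finset.mem_filter.1 hp).1
  rw [prod_one_sub_mono _ (hA _), prod_one_sub_mono _ (hA _), Finset.sum_mul_sum, pair_sum,
    lamR_eq_sum hR hP hPR h₁, lamR_eq_sum hR hP hPR h₂, Finset.sum_mul_sum]
  refine Finset.sum_congr rfl fun d hd => ?_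
  rw [pair_sum]
  refine Finset.sum_congr rfl fun e he => ?_
  have hd0 := Nat.pos_of_mem_divisors hd
  have he0 := Nat.pos_of_mem_divisors he
  have hcomm : (ArithmeticFunction.moebius d : PairAlg) * mono fstHom d *
      ((ArithmeticFunction.moebius e : PairAlg) * mono sndHom e) =
      ((ArithmeticFunction.moebius d * ArithmeticFunction.moebius e : ℤ) : PairAlg) *
        (mono fstHom d * mono sndHom e) := by push_cast; ring
  rw [hcomm, pair_intCast_mul, pair_mul_mono _ _ _ he0, mono_of_pos _ hd0, pair_single]
  simp only [ofLog, Prod.fst_mul, Prod.snd_mul, MonoidHom.inl_apply, MonoidHom.inr_apply, mul_one,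
    one_mul, log_toPNat' hd0, log_toPNat' he0]
  push_cast; ring

theorem sieveFactor_mod (H₁ H₂ : Finset ℕ) (p n : ℕ) :
    sieveFactor H₁ H₂ p (n % p) = sieveFactor H₁ H₂ p n := by
  simp only [sieveFactor, dvd_prod_add_mod]

theorem sum_sieveFactor (H₁ H₂ : Finset ℕ) (p : ℕ) (hp : 0 < p) :
    ∑ x ∈ Finset.range p, sieveFactor H₁ H₂ p x = (p : ℝ) •
      numerAt (fun p => rootCount H₁ p) (fun p => rootCount H₂ p)
        (fun p => commonRootCount H₁ H₂ p) p := by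
  have hxy : mono fstHom p * mono sndHom p = mono diagHom p := by
    rw [mono_of_pos _ hp, mono_of_pos _ hp, mono_of_pos _ hp, MonoidAlgebra.single_mul_single]
    simp
  have e : ∀ x, sieveFactor H₁ H₂ p x = 1 -
      (if p ∣ ∏ h ∈ H₁, (x + h) then mono fstHom p else 0) -
      (if p ∣ ∏ h ∈ H₂, (x + h) then mono sndHom p else 0) +
      (if p ∣ ∏ h ∈ H₁, (x + h) ∧ p ∣ ∏ h ∈ H₂, (x + h) then mono diagHom p else 0) := by
    intro x
    rw [sieveFactor, ← hxy]
    by_cases h1 : p ∣ ∏ h ∈ H₁, (x + h) <;> by_cases h2 : p ∣ ∏ h ∈ H₂, (x + h) <;>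
      simp only [h1, h2, if_true, if_false, and_self, and_true, and_false] <;> ring
  simp only [e, Finset.sum_add_distrib, Finset.sum_sub_distrib, ← Finset.sum_filter,
    Finset.sum_const, Finset.card_range, numerAt, numer, smul_add, smul_sub, rootCount,
    commonRootCount, mono, Nat.cast_smul_eq_nsmul]
  simp only [smul_smul, mul_comm]

/-- The mean value over a period of the product of two sieve weights. -/
theorem sum_lamR_mul_lamR {R : ℝ} (hR : 1 ≤ R) {P : Finset ℕ} (hP : ∀ p ∈ P, p.Prime)
    (hPR : ∀ p : ℕ, p.Prime → (p : ℝ) ≤ R → p ∈ P) {H₁ H₂ : Finset ℕ}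
    (h₁ : 0 ∉ H₁) (h₂ : 0 ∉ H₂) (a b : ℕ) :
    ∑ x ∈ Finset.range (∏ p ∈ P, p), lamR R x H₁ a * lamR R x H₂ b =
      ((∏ p ∈ P, p : ℕ) : ℝ) * pair (ofLog (log R) fun u w => truncPow a u * truncPow b w)
        (∏ p ∈ P, numerAt (fun p => rootCount H₁ p) (fun p => rootCount H₂ p)
          (fun p => commonRootCount H₁ H₂ p) p) := by
  have hne : ∀ (H : Finset ℕ) (x : ℕ), 0 ∉ H → ∏ h ∈ H, (x + h) ≠ 0 := fun H x h0 =>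
    Finset.prod_ne_zero_iff.2 fun h hh => by
      have : h ≠ 0 := by rintro rfl; exact h0 hh
      omega
  have e : ∏ p ∈ P, ((p : ℝ) • numerAt (fun p => rootCount H₁ p) (fun p => rootCount H₂ p)
      (fun p => commonRootCount H₁ H₂ p) p) = MonoidAlgebra.single 1 ((∏ p ∈ P, p : ℕ) : ℝ) *
      ∏ p ∈ P, numerAt (fun p => rootCount H₁ p) (fun p => rootCount H₂ p)
      (fun p => commonRootCount H₁ H₂ p) p := by
    rw [Finset.prod_smul, ← smul_one_mul, MonoidAlgebra.one_def, MonoidAlgebra.smul_single,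
      smul_eq_mul, mul_one, Nat.cast_prod]
  rw [Finset.sum_congr rfl fun x _ => lamR_mul_lamR hR hP hPR (hne H₁ x h₁) (hne H₂ x h₂) a b,
    ← pair_sum, sum_range_prod_primes hP fun p _ x => sieveFactor_mod H₁ H₂ p x,
    Finset.prod_congr rfl fun p hp => sum_sieveFactor H₁ H₂ p (hP p hp).pos, e, mul_comm,
    pair_mul_single]
  simp only [mul_one]

end PairAlg

theorem sum_range_mul_of_periodic {f : ℕ → ℝ} {m : ℕ} (hf : Function.Periodic f m) (t : ℕ) :
    ∑ x ∈ Finset.range (t * m), f x = t * ∑ x ∈ Finset.range m, f x := by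
  induction t with
  | zero => simp
  | succ t ih =>
    rw [add_mul, one_mul, Finset.sum_range_add, ih]
    have : ∀ x, f (t * m + x) = f x := fun x => by
      rw [add_comm]; exact hf.nat_mul t x
    simp only [this]; push_cast; ring

theorem sum_range_add_of_periodic {f : ℕ → ℝ} {m : ℕ} (hf : Function.Periodic f m) (a : ℕ) :
    ∑ x ∈ Finset.range m, f (a + x) = ∑ x ∈ Finset.range m, f x := by
  induction a with
  | zero => simp
  | succ a ih =>
    rw [← ih]
    have h1 := Finset.sum_range_succ (fun x => f (a + x)) m
    have h2 := Finset.sum_range_succ' (fun x => f (a + x)) m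
    have h3 : f (a + m) = f a := hf a
    simp only [add_zero] at h2
    have e : ∀ x, f (a + 1 + x) = f (a + (x + 1)) := fun x => by congr 1; ring
    simp only [e]; linarith

/-- A nonnegative periodic function has its mean value on an interval, up to a period. -/
theorem abs_sum_Ioc_sub_le_of_periodic {f : ℕ → ℝ} (hf0 : ∀ x, 0 ≤ f x) {m : ℕ} (hm : 0 < m)
    (hf : Function.Periodic f m) (a l : ℕ) :
    |∑ n ∈ Finset.Ioc a (a + l), f n - l * ((∑ x ∈ Finset.range m, f x) / m)| ≤
      ∑ x ∈ Finset.range m, f x := by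
  set S := ∑ x ∈ Finset.range m, f x with hS
  have hS0 : 0 ≤ S := Finset.sum_nonneg fun x _ => hf0 x
  have hg : Function.Periodic (fun x => f (a + 1 + x)) m := fun x => by
    simp only [← add_assoc]; exact hf _
  have e1 : ∑ n ∈ Finset.Ioc a (a + l), f n = ∑ x ∈ Finset.range l, f (a + 1 + x) := by
    rw [← Finset.Ico_add_one_add_one_eq_Ioc, Finset.sum_Ico_eq_sum_range]
    congr 2; omega
  have hl : (l : ℝ) = (l / m : ℕ) * m + (l % m : ℕ) := by
    have := Nat.div_add_mod' l m
    exact_mod_cast this.symm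
  have e2 : ∑ x ∈ Finset.range l, f (a + 1 + x) = (l / m : ℕ) * S +
      ∑ x ∈ Finset.range (l % m), f (a + 1 + (l / m * m + x)) := by
    conv_lhs => rw [← Nat.div_add_mod' l m]
    rw [Finset.sum_range_add, sum_range_mul_of_periodic hg, sum_range_add_of_periodic hf]
  set r := ∑ x ∈ Finset.range (l % m), f (a + 1 + (l / m * m + x)) with hr
  have hr0 : 0 ≤ r := Finset.sum_nonneg fun x _ => hf0 _
  have hr1 : r ≤ S := by
    rw [hS, ← sum_range_add_of_periodic hf (a + 1 + l / m * m), hr]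
    simp only [← add_assoc]
    exact Finset.sum_le_sum_of_subset_of_nonneg
      (Finset.range_subset_range.2 (Nat.mod_lt _ hm).le) fun x _ _ => hf0 _
  have hm' : (0 : ℝ) < m := by exact_mod_cast hm
  have hs0 : 0 ≤ ((l % m : ℕ) : ℝ) * (S / m) := by positivity
  have hs1 : ((l % m : ℕ) : ℝ) * (S / m) ≤ S := by
    have : ((l % m : ℕ) : ℝ) ≤ m := by exact_mod_cast (Nat.mod_lt _ hm).le
    calc ((l % m : ℕ) : ℝ) * (S / m) ≤ m * (S / m) := by gcongr
      _ = S := by field_simp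
  have e3 : ((l / m : ℕ) : ℝ) * m * (S / m) = (l / m : ℕ) * S := by field_simp
  rw [e1, e2, hl, add_mul, e3, abs_le]
  constructor <;> linarith

theorem abs_sum_Ioc_sub_le_two_mul_of_periodic {f : ℕ → ℝ} (hf0 : ∀ x, 0 ≤ f x) {m : ℕ}
    (hm : 0 < m) (hf : Function.Periodic f m) (a l : ℕ) {y : ℝ} (hy : |(l : ℝ) - y| ≤ 1) :
    |∑ n ∈ Finset.Ioc a (a + l), f n - y * ((∑ x ∈ Finset.range m, f x) / m)| ≤
      2 * ∑ x ∈ Finset.range m, f x := by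
  have hS0 : 0 ≤ ∑ x ∈ Finset.range m, f x := Finset.sum_nonneg fun x _ => hf0 x
  refine (abs_sub_le _ (l * ((∑ x ∈ Finset.range m, f x) / m)) _).trans ?_
  rw [two_mul]
  refine add_le_add (abs_sum_Ioc_sub_le_of_periodic hf0 hm hf a l) ?_
  rw [← sub_mul, abs_mul, abs_of_nonneg (div_nonneg hS0 (Nat.cast_nonneg m))]
  exact (mul_le_of_le_one_left (by positivity) hy).trans
    (div_le_self hS0 (by exact_mod_cast hm))

theorem sum_card_pow_le (k n : ℕ) :
    ∑ d ∈ (Finset.Icc 1 n).filter Squarefree, (k : ℝ) ^ d.primeFactors.card ≤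
      n * (1 + log n) ^ k := by
  classical
  set S := (Finset.Icc 1 n).filter Squarefree with hSdef
  have hS : ∀ d ∈ S, 1 ≤ d ∧ d ≤ n ∧ Squarefree d := fun d hd => by
    rw [hSdef, Finset.mem_filter, Finset.mem_Icc] at hd; exact ⟨hd.1.1, hd.1.2, hd.2⟩
  have e : ∀ d ∈ S, (k : ℝ) ^ d.primeFactors.card ≤
      n * ∑ t ∈ Nat.finMulAntidiag k d, ∏ i, ((t i : ℕ) : ℝ)⁻¹ := by
    intro d hd
    obtain ⟨h1, h2, h3⟩ := hS d hd
    have e1 : ∀ t ∈ Nat.finMulAntidiag k d, ∏ i, ((t i : ℕ) : ℝ)⁻¹ = (d : ℝ)⁻¹ := by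
      intro t ht
      rw [Finset.prod_inv_distrib, ← Nat.cast_prod, (Nat.mem_finMulAntidiag.1 ht).1]
    rw [Finset.sum_congr rfl e1, Finset.sum_const, Nat.card_finMulAntidiag_of_squarefree h3,
      nsmul_eq_mul, ArithmeticFunction.cardDistinctFactors_apply, ← List.card_toFinset]
    push_cast
    have hd0 : (0 : ℝ) < d := by exact_mod_cast h1
    have hdn : (d : ℝ) ≤ n := by exact_mod_cast h2
    change _ ≤ (n : ℝ) * ((k : ℝ) ^ d.primeFactors.card * _)
    rw [mul_left_comm]
    refine le_mul_of_one_le_right (by positivity) ?_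
    rw [← div_eq_mul_inv, one_le_div hd0]; exact hdn
  refine (Finset.sum_le_sum e).trans ?_
  rw [← Finset.mul_sum]
  refine mul_le_mul_of_nonneg_left ?_ (Nat.cast_nonneg n)
  have hdisj : (S : Set ℕ).PairwiseDisjoint (Nat.finMulAntidiag k) := by
    intro d _ d' _ hdd
    rw [Function.onFun, Finset.disjoint_left]
    intro t ht ht'
    exact hdd ((Nat.mem_finMulAntidiag.1 ht).1.symm.trans (Nat.mem_finMulAntidiag.1 ht').1)
  rw [← Finset.sum_biUnion hdisj]
  have hh : ∑ m ∈ Finset.Icc 1 n, (m : ℝ)⁻¹ ≤ 1 + log n := by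
    have := harmonic_le_one_add_log n
    rw [harmonic_eq_sum_Icc] at this
    push_cast at this
    exact this
  calc _ ≤ ∑ t ∈ Fintype.piFinset fun _ : Fin k => Finset.Icc 1 n, ∏ i, ((t i : ℕ) : ℝ)⁻¹ := by
        refine Finset.sum_le_sum_of_subset_of_nonneg (fun t ht => ?_) fun t _ _ =>
          Finset.prod_nonneg fun i _ => by positivity
        obtain ⟨d, hd, ht⟩ := Finset.mem_biUnion.1 ht
        obtain ⟨h1, h2, -⟩ := hS d hd
        refine Fintype.mem_piFinset.2 fun i => ?_
        have hti : t i ∣ d := Nat.dvd_of_mem_finMulAntidiag ht i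
        exact Finset.mem_Icc.2 ⟨Nat.pos_of_dvd_of_pos hti h1, (Nat.le_of_dvd h1 hti).trans h2⟩
    _ = (∑ m ∈ Finset.Icc 1 n, (m : ℝ)⁻¹) ^ k := by
        rw [← Finset.prod_univ_sum (fun _ : Fin k => Finset.Icc 1 n) fun _ m => (m : ℝ)⁻¹]
        simp
    _ ≤ _ := by gcongr

theorem rootCount_le_pow (H : Finset ℕ) {d : ℕ} (hd : Squarefree d) :
    rootCount H d ≤ H.card ^ d.primeFactors.card := by
  have hP : ∀ p ∈ d.primeFactors, p.Prime := fun p => Nat.prime_of_mem_primeFactors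
  have e : ∀ x, (if d ∣ ∏ h ∈ H, (x + h) then 1 else 0 : ℕ) =
      ∏ p ∈ d.primeFactors, if p ∣ ∏ h ∈ H, (x + h) then 1 else 0 := by
    intro x
    rw [Finset.prod_boole]
    congr 1
    refine propext ⟨fun h p hp => (Nat.dvd_of_mem_primeFactors hp).trans h, fun h => ?_⟩
    rw [← Nat.prod_primeFactors_of_squarefree hd]
    exact Finset.prod_primes_dvd _ (fun p hp => (hP p hp).prime) h
  have hr : Finset.range d = Finset.range (∏ p ∈ d.primeFactors, p) := by
    rw [Nat.prod_primeFactors_of_squarefree hd]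
  rw [rootCount, Finset.card_filter, Finset.sum_congr rfl fun x _ => e x, hr,
    sum_range_prod_primes hP (f := fun p x => if p ∣ ∏ h ∈ H, (x + h) then 1 else 0)
      fun p _ x => by simp only [dvd_prod_add_mod]]
  simp only [← Finset.card_filter]
  exact Finset.prod_le_pow_card _ _ _ fun p hp => rootCount_le_card H (hP p hp)

theorem sum_range_lcm_le (H₁ H₂ : Finset ℕ) {d e : ℕ} (hd : 0 < d) (he : 0 < e) :
    ∑ x ∈ Finset.range (d.lcm e), ((if d ∣ ∏ h ∈ H₁, (x + h) then 1 else 0 : ℝ) *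
      if e ∣ ∏ h ∈ H₂, (x + h) then 1 else 0) ≤ rootCount H₁ d * rootCount H₂ e := by
  have e1 : ∀ x, ((if d ∣ ∏ h ∈ H₁, (x + h) then 1 else 0 : ℝ) *
      if e ∣ ∏ h ∈ H₂, (x + h) then 1 else 0) =
      if d ∣ ∏ h ∈ H₁, (x + h) ∧ e ∣ ∏ h ∈ H₂, (x + h) then 1 else 0 := fun x => by
    rw [ite_and]; split_ifs <;> simp
  rw [Finset.sum_congr rfl fun x _ => e1 x, Finset.sum_boole, ← Nat.cast_mul, Nat.cast_le,
    rootCount, rootCount, ← Finset.card_product]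
  refine Finset.card_le_card_of_injOn (fun x => (x % d, x % e)) (fun x hx => ?_)
    fun x hx y hy hxy => ?_
  · rw [Finset.mem_coe, Finset.mem_filter] at hx
    rw [Finset.mem_coe, Finset.mem_product, Finset.mem_filter, Finset.mem_filter,
      dvd_prod_add_mod, dvd_prod_add_mod]
    exact ⟨⟨Finset.mem_range.2 (Nat.mod_lt _ hd), hx.2.1⟩,
      ⟨Finset.mem_range.2 (Nat.mod_lt _ he), hx.2.2⟩⟩
  · rw [Finset.mem_coe, Finset.mem_filter, Finset.mem_range] at hx hy
    rw [Prod.mk.injEq] at hxy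
    have : x ≡ y [MOD d.lcm e] := Nat.mod_lcm hxy.1 hxy.2
    exact Nat.ModEq.eq_of_lt_of_lt this hx.1 hy.1

theorem lamR_eq_sum_Icc {R : ℝ} (hR : 1 ≤ R) {n : ℕ} {H : Finset ℕ}
    (hn : ∏ h ∈ H, (n + h) ≠ 0) (a : ℕ) :
    lamR R n H a = ∑ d ∈ (Finset.Icc 1 ⌊R⌋₊).filter Squarefree,
      (ArithmeticFunction.moebius d : ℝ) * truncPow a (log R - log d) *
        if d ∣ ∏ h ∈ H, (n + h) then 1 else 0 := by
  classical
  have hR0 : 0 < R := by linarith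
  rw [lamR, Finset.mul_sum]
  simp only [mul_ite, mul_one, mul_zero]
  rw [← Finset.sum_filter]
  have e : ∀ d ∈ (∏ h ∈ H, (n + h)).divisors.filter (fun d : ℕ => (d : ℝ) ≤ R),
      1 / (a.factorial : ℝ) * ((ArithmeticFunction.moebius d : ℝ) * log (R / d) ^ a) =
      (ArithmeticFunction.moebius d : ℝ) * truncPow a (log R - log d) := by
    intro d hd
    rw [Finset.mem_filter] at hd
    have hd0 : (0 : ℝ) < d := by exact_mod_cast Nat.pos_of_mem_divisors hd.1
    rw [log_div hR0.ne' hd0.ne', truncPow_of_nonneg _ (sub_nonneg.2 (log_le_log hd0 hd.2))]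
    ring
  rw [Finset.sum_congr rfl e]
  symm
  refine Finset.sum_subset (fun d hd => ?_) fun d hd hd' => ?_
  · simp only [Finset.mem_filter, Finset.mem_Icc, Nat.mem_divisors] at hd ⊢
    exact ⟨⟨hd.2, hn⟩, (Nat.le_floor_iff hR0.le).1 hd.1.1.2⟩
  · rw [ArithmeticFunction.moebius_eq_zero_of_not_squarefree, Int.cast_zero, zero_mul]
    intro hsq
    simp only [Finset.mem_filter, Finset.mem_Icc, Nat.mem_divisors] at hd hd'
    exact hd' ⟨⟨⟨Nat.pos_of_dvd_of_pos hd.1.1 (Nat.pos_of_ne_zero hn), Nat.le_floor hd.2⟩, hsq⟩,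
      hd.1.1⟩

theorem truncPow_log_sub_le {R : ℝ} (hR : 1 ≤ R) (a : ℕ) (d : ℕ) :
    truncPow a (log R - log d) ≤ log R ^ a := by
  have hU := log_nonneg hR
  refine (truncPow_mono a (sub_le_self _ (log_natCast_nonneg d))).trans ?_
  rw [truncPow_of_nonneg _ hU]
  exact div_le_self (by positivity) (by exact_mod_cast a.factorial_pos)

theorem abs_sum_lamR_mul_lamR_sub_le {R : ℝ} (hR : 1 ≤ R) {q : ℕ}
    (hq0 : 0 < q) (hq : ∀ d : ℕ, Squarefree d → (d : ℝ) ≤ R → d ∣ q) {H₁ H₂ : Finset ℕ}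
    (h₁ : 0 ∉ H₁) (h₂ : 0 ∉ H₂) (a b X l : ℕ)
    {y : ℝ} (hy : |(l : ℝ) - y| ≤ 1) :
    |∑ n ∈ Finset.Ioc X (X + l), lamR R n H₁ a * lamR R n H₂ b -
      y * ((∑ x ∈ Finset.range q, lamR R x H₁ a * lamR R x H₂ b) / q)| ≤
      2 * R ^ 2 * log R ^ (a + b) * (1 + log R) ^ (H₁.card + H₂.card) := by
  classical
  have hU := log_nonneg hR
  have hne : ∀ (H : Finset ℕ) (x : ℕ), 0 ∉ H → ∏ h ∈ H, (x + h) ≠ 0 := fun H x h0 =>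
    Finset.prod_ne_zero_iff.2 fun h hh => by
      have : h ≠ 0 := by rintro rfl; exact h0 hh
      omega
  set S := (Finset.Icc 1 ⌊R⌋₊).filter Squarefree with hSdef
  have hS : ∀ d ∈ S, 0 < d ∧ (d : ℝ) ≤ R ∧ Squarefree d := fun d hd => by
    rw [hSdef, Finset.mem_filter, Finset.mem_Icc] at hd
    exact ⟨hd.1.1, (Nat.le_floor_iff (by linarith)).1 hd.1.2, hd.2⟩
  let c : ℕ → ℕ → ℝ := fun a d => (ArithmeticFunction.moebius d : ℝ) * truncPow a (log R - log d)
  have hc : ∀ a d, |c a d| ≤ log R ^ a := fun a d => by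
    rw [abs_mul, abs_of_nonneg (truncPow_nonneg _ _)]
    have h1 : |(ArithmeticFunction.moebius d : ℝ)| ≤ 1 := by
      exact_mod_cast ArithmeticFunction.abs_moebius_le_one
    calc _ ≤ 1 * truncPow a (log R - log d) :=
          mul_le_mul_of_nonneg_right h1 (truncPow_nonneg _ _)
      _ ≤ _ := by rw [one_mul]; exact truncPow_log_sub_le hR a d
  let f : ℕ → ℕ → ℕ → ℝ := fun d e x => (if d ∣ ∏ h ∈ H₁, (x + h) then 1 else 0 : ℝ) *
      if e ∣ ∏ h ∈ H₂, (x + h) then 1 else 0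
  have hF : ∀ n, lamR R n H₁ a * lamR R n H₂ b = ∑ d ∈ S, ∑ e ∈ S, c a d * c b e * f d e n := by
    intro n
    rw [lamR_eq_sum_Icc hR (hne H₁ n h₁), lamR_eq_sum_Icc hR (hne H₂ n h₂), Finset.sum_mul_sum]
    exact Finset.sum_congr rfl fun d _ => Finset.sum_congr rfl fun e _ => by
      simp only [c, f]; ring
  have hf0 : ∀ d e x, 0 ≤ f d e x := fun d e x => by
    simp only [f]; split_ifs <;> norm_num
  have hsum : ∀ T : Finset ℕ, ∑ n ∈ T, lamR R n H₁ a * lamR R n H₂ b =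
      ∑ d ∈ S, ∑ e ∈ S, c a d * c b e * ∑ n ∈ T, f d e n := by
    intro T
    rw [Finset.sum_congr rfl fun n _ => hF n, Finset.sum_comm]
    refine Finset.sum_congr rfl fun d _ => ?_
    rw [Finset.sum_comm]
    exact Finset.sum_congr rfl fun e _ => (Finset.mul_sum _ _ _).symm
  have hfl : (⌊R⌋₊ : ℝ) ≤ R := Nat.floor_le (by linarith)
  have hfl1 : (1 : ℝ) ≤ ⌊R⌋₊ := by exact_mod_cast Nat.le_floor (by simpa using hR)
  have hroot : ∀ H : Finset ℕ, ∑ d ∈ S, (rootCount H d : ℝ) ≤ R * (1 + log R) ^ H.card := by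
    intro H
    calc ∑ d ∈ S, (rootCount H d : ℝ) ≤ ∑ d ∈ S, (H.card : ℝ) ^ d.primeFactors.card :=
          Finset.sum_le_sum fun d hd => by exact_mod_cast rootCount_le_pow H (hS d hd).2.2
      _ ≤ ⌊R⌋₊ * (1 + log ⌊R⌋₊) ^ H.card := sum_card_pow_le _ _
      _ ≤ _ := by
        have := log_nonneg hfl1
        have := log_le_log (by linarith) hfl
        gcongr
  have hde : ∀ d ∈ S, ∀ e ∈ S, |∑ n ∈ Finset.Ioc X (X + l), f d e n -
      y * ((∑ x ∈ Finset.range q, f d e x) / q)| ≤ 2 * (rootCount H₁ d * rootCount H₂ e) := by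
    intro d hd e he
    obtain ⟨hd0, hdR, hds⟩ := hS d hd
    obtain ⟨he0, heR, hes⟩ := hS e he
    have hm := Nat.lcm_pos hd0 he0
    have hmod : ∀ (H : Finset ℕ) (x y k : ℕ), x ≡ y [MOD k] →
        (k ∣ ∏ h ∈ H, (x + h) ↔ k ∣ ∏ h ∈ H, (y + h)) := fun H x y k hxy => by
      rw [← dvd_prod_add_mod H x, hxy, dvd_prod_add_mod]
    have hper : Function.Periodic (f d e) (d.lcm e) := by
      intro x
      have h1 : x + d.lcm e ≡ x [MOD d.lcm e] := by simp [Nat.ModEq]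
      simp only [f, hmod H₁ _ _ d (h1.of_dvd (Nat.dvd_lcm_left d e)),
        hmod H₂ _ _ e (h1.of_dvd (Nat.dvd_lcm_right d e))]
    obtain ⟨t, ht⟩ := Nat.lcm_dvd (hq d hds hdR) (hq e hes heR)
    have ht0 : 0 < t := Nat.pos_of_ne_zero fun h => by simp [h] at ht; omega
    have hmean : (∑ x ∈ Finset.range q, f d e x) / q =
        (∑ x ∈ Finset.range (d.lcm e), f d e x) / (d.lcm e : ℕ) := by
      rw [ht, mul_comm, sum_range_mul_of_periodic hper, Nat.cast_mul, mul_div_mul_left]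
      exact_mod_cast ht0.ne'
    rw [hmean]
    exact (abs_sum_Ioc_sub_le_two_mul_of_periodic (hf0 d e) hm hper X l hy).trans
      (mul_le_mul_of_nonneg_left (sum_range_lcm_le H₁ H₂ hd0 he0) two_pos.le)
  have hdiff : ∑ n ∈ Finset.Ioc X (X + l), lamR R n H₁ a * lamR R n H₂ b -
      y * ((∑ x ∈ Finset.range q, lamR R x H₁ a * lamR R x H₂ b) / q) =
      ∑ d ∈ S, ∑ e ∈ S, c a d * c b e * (∑ n ∈ Finset.Ioc X (X + l), f d e n -
      y * ((∑ x ∈ Finset.range q, f d e x) / q)) := by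
    rw [hsum, hsum, Finset.sum_div, Finset.mul_sum, ← Finset.sum_sub_distrib]
    refine Finset.sum_congr rfl fun d _ => ?_
    rw [Finset.sum_div, Finset.mul_sum, ← Finset.sum_sub_distrib]
    exact Finset.sum_congr rfl fun e _ => by ring
  rw [hdiff]
  calc _ ≤ ∑ d ∈ S, ∑ e ∈ S, log R ^ a * log R ^ b *
          (2 * (rootCount H₁ d * rootCount H₂ e)) := by
        refine (Finset.abs_sum_le_sum_abs _ _).trans (Finset.sum_le_sum fun d hd =>
          (Finset.abs_sum_le_sum_abs _ _).trans (Finset.sum_le_sum fun e he => ?_))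
        rw [abs_mul, abs_mul]
        exact mul_le_mul (mul_le_mul (hc a d) (hc b e) (abs_nonneg _) (by positivity))
          (hde d hd e he) (abs_nonneg _) (by positivity)
    _ = log R ^ (a + b) * (2 * ((∑ d ∈ S, (rootCount H₁ d : ℝ)) *
        ∑ e ∈ S, (rootCount H₂ e : ℝ))) := by
        rw [pow_add, Finset.sum_mul_sum]
        simp only [Finset.mul_sum]
    _ ≤ log R ^ (a + b) * (2 * ((R * (1 + log R) ^ H₁.card) * (R * (1 + log R) ^ H₂.card))) := by
        gcongr
        · exact hroot H₁
        · exact hroot H₂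
    _ = _ := by ring

theorem one_sub_pow_le {x : ℝ} (hx : 0 ≤ x) (hx1 : x ≤ 1) (k : ℕ) :
    (1 - x) ^ k ≤ 1 - k * x + k ^ 2 * x ^ 2 := by
  induction k with
  | zero => simp
  | succ k ih =>
    have h1 : (1 - x) ^ (k + 1) ≤ (1 - k * x + k ^ 2 * x ^ 2) * (1 - x) := by
      rw [pow_succ]; exact mul_le_mul_of_nonneg_right ih (by linarith)
    have h2 : 0 ≤ (k : ℝ) ^ 2 * x ^ 3 + (k + 1) * x ^ 2 := by positivity
    push_cast
    nlinarith

theorem abs_one_sub_mul_inv_sub_one_le {x : ℝ} (hx : 0 ≤ x) (hx1 : x ≤ 1 / 2) (k : ℕ) :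
    |(1 - k * x) * ((1 - x) ^ k)⁻¹ - 1| ≤ 2 ^ k * k ^ 2 * x ^ 2 := by
  have h1 : 1 - k * x ≤ (1 - x) ^ k := by
    have := one_add_mul_le_pow (a := -x) (by linarith) k
    simpa [sub_eq_add_neg] using this
  have h2 := one_sub_pow_le hx (by linarith) k
  have h3 : (2 ^ k : ℝ)⁻¹ ≤ (1 - x) ^ k := by
    rw [← inv_pow]; exact pow_le_pow_left₀ (by norm_num) (by linarith) k
  have h4 : 0 < (1 - x) ^ k := by apply pow_pos; linarith
  have h5 : ((1 - x) ^ k)⁻¹ ≤ 2 ^ k := inv_le_of_inv_le₀ (by positivity) h3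
  have e : (1 - k * x) * ((1 - x) ^ k)⁻¹ - 1 =
    -(((1 - x) ^ k - (1 - k * x)) * ((1 - x) ^ k)⁻¹) := by
    field_simp; ring
  rw [e, abs_neg, abs_of_nonneg (mul_nonneg (by linarith) (by positivity))]
  calc _ ≤ (k ^ 2 * x ^ 2) * (2 ^ k : ℝ) :=
        mul_le_mul (by linarith) h5 (by positivity) (by positivity)
    _ = _ := by ring

theorem hasProd_singSeries (H : Finset ℕ) :
    HasProd (fun p : Nat.Primes => (1 - (residCard H (p : ℕ) : ℝ) / (p : ℕ)) *
      ((1 - 1 / ((p : ℕ) : ℝ)) ^ H.card)⁻¹) (singSeries H) := by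
  refine Multipliable.hasProd ?_
  have hs : Summable fun p : Nat.Primes => (1 - (residCard H (p : ℕ) : ℝ) / (p : ℕ)) *
      ((1 - 1 / ((p : ℕ) : ℝ)) ^ H.card)⁻¹ - 1 := by
    refine Summable.of_norm_bounded_eventually
      (g := fun p : Nat.Primes => 2 ^ H.card * (H.card : ℝ) ^ 2 * (1 / ((p : ℕ) : ℝ) ^ 2)) ?_ ?_
    · exact ((Real.summable_one_div_nat_pow.2 one_lt_two).comp_injective
        Nat.Primes.coe_nat_injective).mul_left _
    · have hfin : {p : Nat.Primes | (p : ℕ) ∣ diffProd H}.Finite :=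
        Set.Finite.of_finite_image ((diffProd H).divisors.finite_toSet.subset (by
          rintro _ ⟨p, hp, rfl⟩
          exact Nat.mem_divisors.2 ⟨hp, diffProd_ne_zero H⟩))
          Nat.Primes.coe_nat_injective.injOn
      refine Set.Finite.subset hfin fun p hp => ?_
      by_contra hd
      refine hp ?_
      have hpr : (p : ℕ).Prime := p.2
      have h2 : 1 / ((p : ℕ) : ℝ) ≤ 1 / 2 :=
        one_div_le_one_div_of_le two_pos (by exact_mod_cast hpr.two_le)
      have := abs_one_sub_mul_inv_sub_one_le (by positivity) h2 H.card
      change ‖_‖ ≤ _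
      rw [← rootCount_eq_residCard H hpr, rootCount_eq_card subset_rfl hpr hd, Real.norm_eq_abs]
      simpa [div_eq_mul_inv] using this
  simpa using multipliable_one_add_of_summable hs.norm

theorem aug_corrAt_eq {H₁ H₂ : Finset ℕ} (J : ℕ) {p : ℕ} (hp : p.Prime) :
    PairAlg.aug (PairAlg.corrAt J H₁.card H₂.card (H₁ ∩ H₂).card (fun p => rootCount H₁ p)
      (fun p => rootCount H₂ p) (fun p => commonRootCount H₁ H₂ p) p) =
      (1 - (residCard (H₁ ∪ H₂) p : ℝ) / p) * ((1 - 1 / (p : ℝ)) ^ (H₁ ∪ H₂).card)⁻¹ := by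
  have hp1 : (p : ℝ)⁻¹ ≠ 1 := by
    rw [Ne, inv_eq_one]; exact_mod_cast hp.one_lt.ne'
  rw [PairAlg.corrAt, PairAlg.aug_corr hp1 J (PairAlg.aug_emb _ _) (PairAlg.aug_emb _ _)
    (PairAlg.aug_emb _ _) (Finset.card_union_add_card_inter H₁ H₂)
    (v := (rootCount (H₁ ∪ H₂) p : ℝ)) (by exact_mod_cast rootCount_union_add H₁ H₂ hp),
    rootCount_eq_residCard _ hp, one_div, div_eq_mul_inv]

theorem exists_prod_nrm_corrAt_le (M : ℕ) : ∃ K : ℝ, ∀ (L : ℝ) (P H₁ H₂ : Finset ℕ) (J : ℕ),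
    1 ≤ L → log (diffProd (H₁ ∪ H₂)) ≤ L → (∀ p ∈ P, p.Prime) → H₁.card ≤ M → H₂.card ≤ M →
    ∏ p ∈ P, PairAlg.nrm (PairAlg.corrAt J H₁.card H₂.card (H₁ ∩ H₂).card (fun p => rootCount H₁ p)
      (fun p => rootCount H₂ p) (fun p => commonRootCount H₁ H₂ p) p) ≤ K * L ^ (1 / 8 : ℝ) := by
  obtain ⟨K, hK⟩ := PairAlg.exists_prod_le _ (PairAlg.corrConst_nonneg M)
  refine ⟨K, fun L P H₁ H₂ J hL hD hP h₁ h₂ => hK L _ P _ hL (diffProd_ne_zero (H₁ ∪ H₂)) hD hP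
    (fun p _ => PairAlg.nrm_nonneg _) (fun p hp => ?_) fun p hp hd => ?_⟩
  · have hr := (Finset.card_le_card (Finset.inter_subset_left (s₁ := H₁) (s₂ := H₂))).trans h₁
    refine PairAlg.nrm_corrAt_le h₁ h₂ hr (hP p hp) (Nat.cast_nonneg _) ?_ (Nat.cast_nonneg _) ?_
      (Nat.cast_nonneg _) ?_
    · exact_mod_cast (rootCount_le_card H₁ (hP p hp)).trans h₁
    · exact_mod_cast (rootCount_le_card H₂ (hP p hp)).trans h₂
    · exact_mod_cast (commonRootCount_le H₁ H₂ (hP p hp)).trans h₁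
  · have hr := (Finset.card_le_card (Finset.inter_subset_left (s₁ := H₁) (s₂ := H₂))).trans h₁
    have e1 := rootCount_eq_card Finset.subset_union_left (hP p hp) hd
    have e2 := rootCount_eq_card Finset.subset_union_right (hP p hp) hd
    have e3 := rootCount_eq_card subset_rfl (hP p hp) hd
    have e4 := rootCount_union_add H₁ H₂ (hP p hp)
    have e5 := Finset.card_union_add_card_inter H₁ H₂
    have e6 : commonRootCount H₁ H₂ p = (H₁ ∩ H₂).card := by omega
    exact PairAlg.nrm_corrAt_le_sq h₁ h₂ hr (hP p hp) (by rw [e1]) (by rw [e2]) (by rw [e6])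

/-- The inclusion of the primes in the natural numbers. -/
def primesEmb : Nat.Primes ↪ ℕ := ⟨fun p => p, Nat.Primes.coe_nat_injective⟩

theorem prod_coe_primes (s : Finset Nat.Primes) (f : ℕ → ℝ) :
    ∏ p ∈ s, f p = ∏ p ∈ s.map primesEmb, f p :=
  (Finset.prod_map s primesEmb f).symm

/-- The correlation on an interval, with an explicit error term. -/
theorem exists_abs_correlation_sub_le (M : ℕ) : ∃ K : ℝ, ∀ (R B : ℝ) (H₁ H₂ : Finset ℕ)
    (l₁ l₂ X l : ℕ) (y : ℝ), |(l : ℝ) - y| ≤ 1 → 0 ≤ y → 1 ≤ R → 0 ∉ H₁ → 0 ∉ H₂ →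
      H₁.card ≤ M → H₂.card ≤ M → 1 ≤ B →
    log (diffProd (H₁ ∪ H₂)) ≤ B →
    |∑ n ∈ Finset.Ioc X (X + l), lamR R n H₁ (H₁.card + l₁) * lamR R n H₂ (H₂.card + l₂) -
      y * (singSeries (H₁ ∪ H₂) * ((l₁ + l₂).choose l₁ * (log R ^ ((H₁ ∩ H₂).card + l₁ + l₂) /
        ((H₁ ∩ H₂).card + l₁ + l₂).factorial)))| ≤
      2 * R ^ 2 * log R ^ (H₁.card + l₁ + (H₂.card + l₂)) * (1 + log R) ^ (H₁.card + H₂.card) +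
      y * (PairAlg.smoothErr R H₁.card H₂.card (H₁ ∩ H₂).card l₁ l₂ * (K * B ^ (1 / 8 : ℝ))) := by
  classical
  obtain ⟨K, hK⟩ := exists_prod_nrm_corrAt_le M
  refine ⟨K, fun R B H₁ H₂ l₁ l₂ X l y hy hy0 hR h₁ h₂ hM₁ hM₂ hB hD => ?_⟩
  obtain ⟨J, hJ⟩ := pow_unbounded_of_one_lt R (one_lt_two (α := ℝ))
  have hlim := hasProd_singSeries (H₁ ∪ H₂)
  rw [HasProd, SummationFilter.unconditional_filter] at hlim
  have hfin : {p : Nat.Primes | ((p : ℕ) : ℝ) ≤ R}.Finite :=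
    Set.Finite.of_finite_image ((Finset.Icc 0 ⌊R⌋₊).finite_toSet.subset (by
      rintro _ ⟨p, hp, rfl⟩
      exact Finset.mem_coe.2 (Finset.mem_Icc.2 ⟨Nat.zero_le _, Nat.le_floor hp⟩)))
      Nat.Primes.coe_nat_injective.injOn
  have hs0 : 0 ≤ PairAlg.smoothErr R H₁.card H₂.card (H₁ ∩ H₂).card l₁ l₂ := by
    have := log_nonneg hR
    have := moebiusMass_nonneg
    unfold PairAlg.smoothErr; positivity
  refine le_of_tendsto (((hlim.mul_const _).const_mul y).const_sub _).abs ?_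
  filter_upwards [Filter.eventually_ge_atTop hfin.toFinset] with s hs
  set P : Finset ℕ := s.map primesEmb with hPdef
  have hP : ∀ p ∈ P, p.Prime := fun p hp => by
    obtain ⟨q, -, rfl⟩ := Finset.mem_map.1 hp
    exact q.2
  have hPR : ∀ p : ℕ, p.Prime → (p : ℝ) ≤ R → p ∈ P := fun p hp hpR =>
    Finset.mem_map.2 ⟨⟨p, hp⟩, hs (hfin.mem_toFinset.2 hpR), rfl⟩
  have hq0 : 0 < ∏ p ∈ P, p := Finset.prod_pos fun p hp => (hP p hp).pos
  have hmean := PairAlg.sum_lamR_mul_lamR hR hP hPR h₁ h₂ (H₁.card + l₁) (H₂.card + l₂)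
  have hav := abs_sum_lamR_mul_lamR_sub_le hR hq0 (fun d hd hdR =>
    PairAlg.dvd_prod_of_squarefree hd fun p hp hpd => hPR p hp
      ((Nat.cast_le.2 (Nat.le_of_dvd (Nat.pos_of_ne_zero hd.ne_zero) hpd)).trans hdR)) h₁ h₂
    (H₁.card + l₁) (H₂.card + l₂) X l hy
  rw [hmean, mul_div_cancel_left₀ _ (by exact_mod_cast hq0.ne')] at hav
  have hpair := PairAlg.abs_pair_prod_numerAt_sub_le hR hP hPR hJ H₁.card H₂.card (H₁ ∩ H₂).card
    l₁ l₂ (fun p => rootCount H₁ p) (fun p => rootCount H₂ p) (fun p => commonRootCount H₁ H₂ p)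
  have hprod := (prod_coe_primes s fun p => (1 - (residCard (H₁ ∪ H₂) p : ℝ) / p) *
    ((1 - 1 / (p : ℝ)) ^ (H₁ ∪ H₂).card)⁻¹).trans
      (Finset.prod_congr rfl fun p hp => (aug_corrAt_eq J (hP p hp)).symm)
  rw [hprod]
  have herr := hpair.trans (mul_le_mul_of_nonneg_left (hK B P H₁ H₂ J hB hD hP hM₁ hM₂) hs0)
  refine (abs_sub_le _ _ _).trans (add_le_add hav ?_)
  rw [← mul_sub, abs_mul, abs_of_nonneg hy0]
  exact mul_le_mul_of_nonneg_left herr hy0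

theorem smoothErr_mul_le {R K A : ℝ} (hA : 0 < A) (hR : 1 ≤ log R) {M k₁ k₂ r l₁ l₂ : ℕ}
    (hM : k₁ + k₂ + l₁ + l₂ ≤ M) (hr : r ≤ k₁) :
    PairAlg.smoothErr R k₁ k₂ r l₁ l₂ * (K * (1 + A * M ^ 2 * log R) ^ (1 / 8 : ℝ)) ≤
      2 ^ M * (2 ^ M + M + 1) * (1 + moebiusMass) ^ M * 2 ^ M * |K| *
        (1 + A * M ^ 2) ^ (1 / 8 : ℝ) * (1 + log R) ^ (-(1 / 8) : ℝ) * log R ^ (r + l₁ + l₂) := by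
  set U := log R
  have hU : 0 < 1 + U := by linarith
  have hm := moebiusMass_nonneg
  have h1 : ((l₁ + l₂).choose l₁ : ℝ) ≤ 2 ^ M := by
    exact_mod_cast (Nat.choose_le_two_pow _ _).trans (Nat.pow_le_pow_right two_pos (by omega))
  have h2 : (2 : ℝ) ^ r + (r + l₁ + l₂ : ℕ) + 1 ≤ 2 ^ M + M + 1 := by
    have e1 : (2 : ℝ) ^ r ≤ 2 ^ M := pow_le_pow_right₀ one_le_two (by omega)
    have e2 : ((r + l₁ + l₂ : ℕ) : ℝ) ≤ M := by exact_mod_cast (by omega : r + l₁ + l₂ ≤ M)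
    linarith
  have h3 : moebiusMass ^ k₁ * moebiusMass ^ k₂ ≤ (1 + moebiusMass) ^ M := by
    rw [← pow_add]
    calc _ ≤ (1 + moebiusMass) ^ (k₁ + k₂) := pow_le_pow_left₀ hm (by linarith) _
      _ ≤ _ := pow_le_pow_right₀ (by linarith) (by omega)
  have h4 : (1 + U) ^ (r + l₁ + l₂) ≤ 2 ^ M * U ^ (r + l₁ + l₂) := by
    calc _ ≤ (2 * U) ^ (r + l₁ + l₂) := pow_le_pow_left₀ hU.le (by linarith) _
      _ = 2 ^ (r + l₁ + l₂) * U ^ (r + l₁ + l₂) := mul_pow _ _ _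
      _ ≤ _ := by
        have : (2 : ℝ) ^ (r + l₁ + l₂) ≤ 2 ^ M := pow_le_pow_right₀ one_le_two (by omega)
        gcongr
  have h5 : (1 + A * M ^ 2 * U) ^ (1 / 8 : ℝ) ≤
      (1 + A * M ^ 2) ^ (1 / 8 : ℝ) * (1 + U) ^ (1 / 8 : ℝ) := by
    rw [← mul_rpow (by positivity) hU.le]
    refine rpow_le_rpow (by positivity) ?_ (by norm_num)
    have : 0 ≤ A * (M : ℝ) ^ 2 := by positivity
    nlinarith
  have h6 : (1 + U) ^ (((r + l₁ + l₂ : ℕ) : ℝ) - 1 / 4) * (1 + U) ^ (1 / 8 : ℝ) =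
      (1 + U) ^ (r + l₁ + l₂) * (1 + U) ^ (-(1 / 8) : ℝ) := by
    rw [← rpow_add hU, ← rpow_natCast, ← rpow_add hU]; congr 1; ring
  calc _ = ((l₁ + l₂).choose l₁ : ℝ) * (2 ^ r + (r + l₁ + l₂ : ℕ) + 1) *
        (moebiusMass ^ k₁ * moebiusMass ^ k₂) * K * ((1 + U) ^ (((r + l₁ + l₂ : ℕ) : ℝ) - 1 / 4) *
        (1 + A * M ^ 2 * U) ^ (1 / 8 : ℝ)) := by rw [PairAlg.smoothErr]; ring
    _ ≤ (2 ^ M) * (2 ^ M + M + 1) * (1 + moebiusMass) ^ M * |K| *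
        ((1 + U) ^ (((r + l₁ + l₂ : ℕ) : ℝ) - 1 / 4) *
        ((1 + A * M ^ 2) ^ (1 / 8 : ℝ) * (1 + U) ^ (1 / 8 : ℝ))) := by
      refine (mul_le_mul_of_nonneg_right (mul_le_mul_of_nonneg_left (le_abs_self K)
        (by positivity)) (by positivity)).trans ?_
      gcongr
    _ = (2 ^ M) * (2 ^ M + M + 1) * (1 + moebiusMass) ^ M * |K| * (1 + A * M ^ 2) ^ (1 / 8 : ℝ) *
        ((1 + U) ^ (r + l₁ + l₂) * (1 + U) ^ (-(1 / 8) : ℝ)) := by rw [← h6]; ring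
    _ ≤ (2 ^ M) * (2 ^ M + M + 1) * (1 + moebiusMass) ^ M * |K| * (1 + A * M ^ 2) ^ (1 / 8 : ℝ) *
        ((2 ^ M * U ^ (r + l₁ + l₂)) * (1 + U) ^ (-(1 / 8) : ℝ)) := by gcongr
    _ = _ := by ring

theorem level_bound {N R ε : ℝ} {M : ℕ} (hM : 1 ≤ M) (hε : 0 < ε) (hN : 0 < N)
    (hR1 : 1 ≤ log R) (hR0 : 0 < R) (hL : 4 ≤ log N) (hL' : 4 / ε ≤ log N)
    (hRN : R ≤ N ^ (1 / 2 : ℝ) * log N ^ (-(4 * M : ℝ))) {a k : ℕ} (ha : a ≤ M) (hk : k ≤ M) :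
    2 * R ^ 2 * log R ^ a * (1 + log R) ^ k ≤ ε / 2 * N := by
  set L := log N
  have hL0 : 0 < L := by linarith
  have hpow : L ^ (-(4 * M : ℝ)) = (L ^ (4 * M))⁻¹ := by
    rw [rpow_neg hL0.le]; congr 1; exact_mod_cast rpow_natCast L (4 * M)
  rw [hpow] at hRN
  have hsq : (N ^ (1 / 2 : ℝ)) ^ 2 = N := by
    rw [← sqrt_eq_rpow, sq_sqrt hN.le]
  have h1 : R * L ^ (4 * M) ≤ N ^ (1 / 2 : ℝ) := by
    rwa [← div_eq_mul_inv, le_div_iff₀ (by positivity)] at hRN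
  have h2 : R ^ 2 * L ^ (8 * M) ≤ N := by
    calc _ = (R * L ^ (4 * M)) ^ 2 := by ring
      _ ≤ (N ^ (1 / 2 : ℝ)) ^ 2 := pow_le_pow_left₀ (by positivity) h1 2
      _ = N := hsq
  have hRleN : R ≤ N := by
    have h3 : R ^ 2 ≤ N := (le_mul_of_one_le_right (by positivity)
      (one_le_pow₀ (by linarith))).trans h2
    have h4 : 1 ≤ R := by
      by_contra! h
      linarith [log_nonpos hR0.le h.le]
    nlinarith
  have hU : log R ≤ L := log_le_log hR0 hRleN
  have h5 : log R ^ a * (1 + log R) ^ k ≤ 4 ^ M * L ^ (2 * M) := by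
    calc _ ≤ (2 * L) ^ a * (2 * L) ^ k := by gcongr <;> linarith
      _ ≤ (2 * L) ^ M * (2 * L) ^ M := by gcongr <;> linarith
      _ = _ := by rw [← mul_pow, pow_mul, ← mul_pow]; congr 1; ring
  have h6 : 2 * 4 ^ M ≤ ε / 2 * L ^ (6 * M) := by
    calc (2 : ℝ) * 4 ^ M = ε / 2 * (4 / ε * 4 ^ M) := by field_simp; norm_num
      _ ≤ ε / 2 * (L * L ^ M) := by gcongr
      _ = ε / 2 * L ^ (M + 1) := by ring
      _ ≤ _ := by
        have := pow_le_pow_right₀ (by linarith : (1 : ℝ) ≤ L) (by omega : M + 1 ≤ 6 * M)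
        gcongr
  calc _ = 2 * R ^ 2 * (log R ^ a * (1 + log R) ^ k) := by ring
    _ ≤ 2 * R ^ 2 * (4 ^ M * L ^ (2 * M)) := by gcongr
    _ = 2 * 4 ^ M * (R ^ 2 * L ^ (2 * M)) := by ring
    _ ≤ ε / 2 * L ^ (6 * M) * (R ^ 2 * L ^ (2 * M)) := by gcongr
    _ = ε / 2 * (R ^ 2 * L ^ (8 * M)) := by ring
    _ ≤ _ := by gcongr

theorem filter_Icc_eq_Ioc {N : ℝ} (hN : 0 ≤ N) :
    (Finset.Icc 1 ⌊2 * N⌋₊).filter (fun n : ℕ => N < (n : ℝ) ∧ (n : ℝ) ≤ 2 * N) =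
      Finset.Ioc ⌊N⌋₊ (⌊N⌋₊ + (⌊2 * N⌋₊ - ⌊N⌋₊)) := by
  have hle : ⌊N⌋₊ ≤ ⌊2 * N⌋₊ := Nat.floor_le_floor (by linarith)
  rw [Nat.add_sub_cancel' hle]
  ext n
  rw [Finset.mem_filter, Finset.mem_Icc, Finset.mem_Ioc, Nat.floor_lt hN,
    Nat.le_floor_iff (by positivity)]
  refine ⟨fun h => h.2, fun h => ⟨⟨?_, h.2⟩, h⟩⟩
  have : (0 : ℝ) < n := hN.trans_lt h.1
  exact_mod_cast this

theorem abs_floor_sub_floor_sub_le {N : ℝ} (hN : 0 ≤ N) :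
    |((⌊2 * N⌋₊ - ⌊N⌋₊ : ℕ) : ℝ) - N| ≤ 1 := by
  have hle : ⌊N⌋₊ ≤ ⌊2 * N⌋₊ := Nat.floor_le_floor (by linarith)
  rw [Nat.cast_sub hle, abs_le]
  have h1 := Nat.floor_le hN
  have h2 := Nat.lt_floor_add_one N
  have h3 := Nat.floor_le (by positivity : 0 ≤ 2 * N)
  have h4 := Nat.lt_floor_add_one (2 * N)
  constructor <;> linarith

theorem lamR_empty {R : ℝ} (hR : 1 ≤ R) (n : ℕ) : lamR R n ∅ 0 = 1 := by
  have : (Finset.filter (fun d : ℕ => (d : ℝ) ≤ R) {1}) = {1} := by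
    rw [Finset.filter_singleton, if_pos (by simpa using hR)]
  simp [lamR, this]

theorem singSeries_empty : singSeries ∅ = 1 := by simp [singSeries, residCard]

end GPY

/-- Proposition 1 of Goldston–Pintz–Yıldırım: asymptotic for the sum of a product of
two sieve weights. -/
theorem two_lambda_correlation (M : ℕ) (A ε : ℝ) (hA : 0 < A) (hε : 0 < ε) :
    ∃ N₀ R₀ : ℝ, ∀ (N R : ℝ) (h : ℕ) (H₁ H₂ : Finset ℕ) (k₁ k₂ r l₁ l₂ : ℕ),
      N₀ ≤ N → R₀ ≤ R → R ≤ N ^ ((1 : ℝ) / 2) * (Real.log N) ^ (-(4 * M : ℝ)) →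
      0 < h → (h : ℝ) ≤ R ^ A →
      H₁ ⊆ Finset.Icc 1 h → H₂ ⊆ Finset.Icc 1 h →
      H₁.card = k₁ → H₂.card = k₂ → (H₁ ∩ H₂).card = r →
      k₁ + k₂ + l₁ + l₂ ≤ M →
      |(∑ n ∈ (Finset.Icc 1 ⌊2 * N⌋₊).filter (fun n : ℕ => N < (n : ℝ) ∧ (n : ℝ) ≤ 2 * N),
            lamR R n H₁ (k₁ + l₁) * lamR R n H₂ (k₂ + l₂)) -
          (Nat.choose (l₁ + l₂) l₁ : ℝ) *
            ((Real.log R) ^ (r + l₁ + l₂) / (Nat.factorial (r + l₁ + l₂) : ℝ)) *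
            singSeries (H₁ ∪ H₂) * N| ≤
        ε * N * (Real.log R) ^ (r + l₁ + l₂) := by
  obtain ⟨K, hK⟩ := GPY.exists_abs_correlation_sub_le M
  set C : ℝ := 2 ^ M * (2 ^ M + M + 1) * (1 + GPY.moebiusMass) ^ M * 2 ^ M * |K| *
        (1 + A * M ^ 2) ^ (1 / 8 : ℝ)
  have htend : Filter.Tendsto (fun R : ℝ => C * (1 + Real.log R) ^ (-(1 / 8) : ℝ)) Filter.atTop
      (nhds 0) := by
    rw [← mul_zero C]
    exact ((tendsto_rpow_neg_atTop (by norm_num : (0 : ℝ) < 1 / 8)).comp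
      (Filter.tendsto_atTop_add_const_left _ 1 Real.tendsto_log_atTop)).const_mul C
  obtain ⟨R₀, hR₀⟩ := Filter.eventually_atTop.1 ((Filter.eventually_gt_atTop 0).and
    ((Real.tendsto_log_atTop.eventually_ge_atTop 1).and
      (htend.eventually_le_const (half_pos hε))))
  obtain ⟨N₀, hN₀⟩ := Filter.eventually_atTop.1 ((Filter.eventually_gt_atTop 0).and
    ((Filter.eventually_ge_atTop (1 / ε)).and
      ((Real.tendsto_log_atTop.eventually_ge_atTop 4).and
      (Real.tendsto_log_atTop.eventually_ge_atTop (4 / ε)))))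
  refine ⟨N₀, R₀, ?_⟩
  rintro N R h H₁ H₂ _ _ _ l₁ l₂ hN hR hRN hh hhR hs₁ hs₂ rfl rfl rfl hM
  obtain ⟨hN0, hN1, hN4, hNε⟩ := hN₀ N hN
  obtain ⟨hR0, hU, hC⟩ := hR₀ R hR
  have hR1 : 1 ≤ R := by
    by_contra! hlt
    linarith [Real.log_nonpos hR0.le hlt.le]
  have hy := GPY.abs_floor_sub_floor_sub_le hN0.le
  rw [GPY.filter_Icc_eq_Ioc hN0.le]
  rcases Nat.eq_zero_or_pos M with rfl | hM1
  · obtain rfl : H₁ = ∅ := Finset.card_eq_zero.1 (by omega)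
    obtain rfl : H₂ = ∅ := Finset.card_eq_zero.1 (by omega)
    obtain rfl : l₁ = 0 := by omega
    obtain rfl : l₂ = 0 := by omega
    rw [div_le_iff₀ hε] at hN1
    simp only [Finset.card_empty, Finset.inter_self, add_zero, GPY.lamR_empty hR1, mul_one,
      Finset.sum_const, Nat.card_Ioc, add_tsub_cancel_left, Nat.choose_self, Nat.cast_one,
      Nat.factorial_zero, pow_zero, div_one, Finset.union_self, GPY.singSeries_empty, one_mul,
      nsmul_eq_mul]
    linarith
  · have hr : (H₁ ∩ H₂).card ≤ H₁.card := Finset.card_le_card Finset.inter_subset_left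
    have hUn : H₁ ∪ H₂ ⊆ Finset.Icc 1 h := Finset.union_subset hs₁ hs₂
    have hcard : (H₁ ∪ H₂).card ≤ M := (Finset.card_union_le _ _).trans (by omega)
    have hlogh : Real.log h ≤ A * Real.log R := by
      rw [← Real.log_rpow hR0]
      exact Real.log_le_log (by exact_mod_cast hh) hhR
    have hB : 0 ≤ A * (M : ℝ) ^ 2 * Real.log R := by positivity
    have hD : Real.log (GPY.diffProd (H₁ ∪ H₂)) ≤ 1 + A * M ^ 2 * Real.log R := by
      refine (GPY.log_diffProd_le hUn hcard).trans ?_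
      nlinarith [mul_le_mul_of_nonneg_left hlogh (sq_nonneg (M : ℝ))]
    have h0 : ∀ H ⊆ Finset.Icc 1 h, 0 ∉ H := fun H hH h0 => by
      simpa using hH h0
    have hmain := hK R (1 + A * M ^ 2 * Real.log R) H₁ H₂ l₁ l₂ ⌊N⌋₊ _ N hy hN0.le hR1
      (h0 H₁ hs₁) (h0 H₂ hs₂) (by omega) (by omega) (by linarith) hD
    have hsm := GPY.smoothErr_mul_le (K := K) hA hU hM hr
    have hlev := GPY.level_bound hM1 hε hN0 hU hR0 hN4 hNε hRN
      (a := H₁.card + l₁ + (H₂.card + l₂)) (k := H₁.card + H₂.card) (by omega) (by omega)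
    set n := (H₁ ∩ H₂).card + l₁ + l₂
    have hpow : 1 ≤ Real.log R ^ n := one_le_pow₀ hU
    have e : (Nat.choose (l₁ + l₂) l₁ : ℝ) * (Real.log R ^ n / (Nat.factorial n : ℝ)) *
        singSeries (H₁ ∪ H₂) * N = N * (singSeries (H₁ ∪ H₂) * ((Nat.choose (l₁ + l₂) l₁ : ℝ) *
          (Real.log R ^ n / (Nat.factorial n : ℝ)))) := by ring
    rw [e]
    refine hmain.trans ?_
    have h1 : ε / 2 * N ≤ ε / 2 * N * Real.log R ^ n :=
      le_mul_of_one_le_right (by positivity) hpow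
    have h2 := mul_le_mul_of_nonneg_left (hsm.trans (mul_le_mul_of_nonneg_right hC
      (by positivity : 0 ≤ Real.log R ^ n))) hN0.le
    linarith
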